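/- (False Pole Theorem) Let d ≥ 3 and let K ⊂ ℝ^d be a convex body, regarded as a subset of an affine chart of ℝP^d. If K has an interior false pole p with respect to some hyperplane H ⊂ ℝP^d, then K is an ellipsoid. -/

import Mathlib

noncomputable section

open Set Module

/-- The vector space `ℝ^{d+1}` whose projectivization is `ℝP^d`. -/
abbrev PV (d : ℕ) : Type := Fin (d + 1) → ℝ

/-- Real projective `d`-space `ℝP^d`. -/
abbrev RP (d : ℕ) : Type := Projectivization ℝ (PV d)

/-- The affine chart embedding of `ℝ^d` into `ℝP^d` determined by a linear
change of coordinates `e` of `ℝ^{d+1}`. -/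
def chartMap {d : ℕ} (e : PV d ≃ₗ[ℝ] PV d) (x : Fin d → ℝ) : RP d :=
  Projectivization.mk ℝ (e (Fin.snoc x 1)) <| by
    rw [ne_eq, LinearEquiv.map_eq_zero_iff]
    intro h
    have h1 := congrFun h (Fin.last d)
    simp [Fin.snoc_last] at h1

/-- The set of points of `ℝP^d` lying in (the projectivization of) a linear subspace `W`. -/
def projSet {d : ℕ} (W : Submodule ℝ (PV d)) : Set (RP d) :=
  {x : RP d | x.submodule ≤ W}

/-- The projective line through two points, as a set of points of `ℝP^d`. -/
def projLine {d : ℕ} (A B : RP d) : Set (RP d) :=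
  {x : RP d | x.submodule ≤ A.submodule ⊔ B.submodule}

/-- The projective span `aff {p, l}` of a point `p` and the projective subspace
corresponding to the linear subspace `W`. -/
def projSpan {d : ℕ} (p : RP d) (W : Submodule ℝ (PV d)) : Set (RP d) :=
  {x : RP d | x.submodule ≤ W ⊔ p.submodule}

/-- Four collinear points of `ℝP^d` are harmonic, `[A,B;P,Q] = -1`:  there are
representatives `a, b` of `A, B` such that `a + b` represents `P` and `a - b`
represents `Q`. -/
def HarmonicQuad {d : ℕ} (A B P Q : RP d) : Prop :=
  ∃ (a b : PV d) (ha : a ≠ 0) (hb : b ≠ 0) (hab : a + b ≠ 0) (hab' : a - b ≠ 0),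
    A = Projectivization.mk ℝ a ha ∧ B = Projectivization.mk ℝ b hb ∧
      P = Projectivization.mk ℝ (a + b) hab ∧ Q = Projectivization.mk ℝ (a - b) hab'

/-- `g` is a pole, with polar the set `H`, of a convex body with boundary `bdK`:
every line through `g` meeting the boundary in two points `A ≠ B` and meeting `H`
in a point `q` satisfies `[A,B;g,q] = -1`. -/
def IsPoleOf {d : ℕ} (bdK : Set (RP d)) (g : RP d) (H : Set (RP d)) : Prop :=
  ∀ A B q : RP d, A ∈ bdK → B ∈ bdK → A ≠ B →
    g ∈ projLine A B → q ∈ projLine A B → q ∈ H → HarmonicQuad A B g q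

/-- `Φ` is the harmonic homology of `ℝP^d` with hyperplane `G` and center `τ`:
it is induced by a linear involution which is the identity on a linear hyperplane
representing `G` and is `-1` on the line representing `τ`. -/
def IsHarmonicHomology {d : ℕ} (Φ : RP d → RP d) (G : Set (RP d)) (τ : RP d) : Prop :=
  ∃ (σ : PV d ≃ₗ[ℝ] PV d) (W : Submodule ℝ (PV d)) (t : PV d) (ht : t ≠ 0),
    Module.finrank ℝ W = d ∧ G = projSet W ∧ τ = Projectivization.mk ℝ t ht ∧ t ∉ W ∧
      (∀ v ∈ W, σ v = v) ∧ σ t = -t ∧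
      ∀ (v : PV d) (hv : v ≠ 0), ∃ hv' : σ v ≠ 0,
        Φ (Projectivization.mk ℝ v hv) = Projectivization.mk ℝ (σ v) hv'

/-- The boundary of the convex body `chartMap e '' K₀` of `ℝP^d`, i.e. the image of
the boundary of `K₀ ⊆ ℝ^d` under the affine chart embedding. -/
def chartFrontier {d : ℕ} (e : PV d ≃ₗ[ℝ] PV d) (K₀ : Set (Fin d → ℝ)) : Set (RP d) :=
  chartMap e '' frontier K₀

/-- The closed Euclidean unit ball of `ℝ^d`. -/
def euclUnitBall (d : ℕ) : Set (Fin d → ℝ) := {x : Fin d → ℝ | ∑ i, x i ^ 2 ≤ 1}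

/-- A subset of `ℝ^d` is an ellipsoid if it is the image of the closed Euclidean
unit ball under an invertible affine map. -/
def IsEllipsoidIn (d : ℕ) (S : Set (Fin d → ℝ)) : Prop :=
  ∃ T : (Fin d → ℝ) ≃ᵃ[ℝ] (Fin d → ℝ), S = T '' euclUnitBall d

/-- A subset of `ℝP^d` is an ellipsoid if, in some affine chart containing it, it is
the image of the closed Euclidean unit ball under an invertible affine map. -/
def IsProjEllipsoid {d : ℕ} (K : Set (RP d)) : Prop :=
  ∃ (e : PV d ≃ₗ[ℝ] PV d) (S : Set (Fin d → ℝ)), IsEllipsoidIn d S ∧ K = chartMap e '' S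

/-- `H` is a support hyperplane of the convex body `chartMap e '' K₀`: it meets the
body but misses its interior. -/
def IsSupportHyperplane {d : ℕ} (e : PV d ≃ₗ[ℝ] PV d) (K₀ : Set (Fin d → ℝ))
    (H : Set (RP d)) : Prop :=
  (H ∩ chartMap e '' K₀).Nonempty ∧ H ∩ chartMap e '' interior K₀ = ∅

/-- The relative boundary of the section of the convex body `chartMap e '' K₀` by the
projective plane corresponding to the linear subspace `W`. -/
def sectionFrontier {d : ℕ} (e : PV d ≃ₗ[ℝ] PV d) (K₀ : Set (Fin d → ℝ))
    (W : Submodule ℝ (PV d)) : Set (RP d) :=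
  chartMap e '' intrinsicFrontier ℝ (chartMap e ⁻¹' projSet W ∩ K₀)

/-- `p` is a false pole of the convex body `chartMap e '' K₀` with respect to `H`:
`p` is not a pole with respect to `H`, and for every projective 2-plane `Π` through `p`
the section `Π ∩ K` has a pole whose corresponding polar is `Π ∩ H`. -/
def IsFalsePole {d : ℕ} (e : PV d ≃ₗ[ℝ] PV d) (K₀ : Set (Fin d → ℝ)) (p : RP d)
    (H : Set (RP d)) : Prop :=
  ¬ IsPoleOf (chartFrontier e K₀) p H ∧
    ∀ W : Submodule ℝ (PV d), Module.finrank ℝ W = 3 → p.submodule ≤ W →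
      ∃ q : RP d, q.submodule ≤ W ∧ IsPoleOf (sectionFrontier e K₀ W) q (projSet W ∩ H)

section

theorem fpt_core3 (h : ℝ → ℝ) (μ : ℝ) (hμ0 : 0 < μ) (hμ1 : μ < 1)
    (hc : ConcaveOn ℝ (Icc (-1) 1) h) (heven : ∀ z, |z| ≤ 1 → h (-z) = h z)
    (h0 : h 0 = 1) (hlow : ∀ z, |z| ≤ 1 → 1 - |z| ≤ h z)
    (husc : ∀ r, (∀ z, 0 ≤ z → z < 1 → r ≤ h z) → r ≤ h 1)
    (H : ∀ ε > 0, ∃ c, ∀ z, |z| ≤ 1 → 0 ≤ h z ^ 2 - ε ^ 2 * (z - μ) ^ 2 →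
      |2 * c - z| ≤ 1 ∧
        h (2 * c - z) ^ 2 - ε ^ 2 * (2 * c - z - μ) ^ 2 = h z ^ 2 - ε ^ 2 * (z - μ) ^ 2) :
    ∀ z, |z| ≤ 1 → h z ^ 2 = 1 - z ^ 2 := by
  have hnn : ∀ z, |z| ≤ 1 → 0 ≤ h z := fun z hz => le_trans (by linarith) (hlow z hz)
  -- h ≤ 1
  have hle1 : ∀ z, |z| ≤ 1 → h z ≤ 1 := by
    intro z hz
    have hz' := abs_le.1 hz
    have := hc.2 (show z ∈ Icc (-1:ℝ) 1 from ⟨hz'.1, hz'.2⟩)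
      (show -z ∈ Icc (-1:ℝ) 1 from ⟨by linarith, by linarith⟩)
      (by norm_num : (0:ℝ) ≤ 1/2) (by norm_num : (0:ℝ) ≤ 1/2) (by norm_num)
    simp only [smul_eq_mul] at this
    rw [heven z hz] at this
    have e : (1/2 * z + 1/2 * -z : ℝ) = 0 := by ring
    rw [e, h0] at this
    linarith
  -- r nonneg criterion
  have hr : ∀ ε > 0, ∀ z, |z| ≤ 1 → 2 * ε ≤ h z → 0 ≤ h z ^ 2 - ε ^ 2 * (z - μ) ^ 2 := by
    intro ε hε z hz hh
    have hz' := abs_le.1 hz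
    have h1 : (z - μ) ^ 2 ≤ 2 ^ 2 := by
      apply sq_le_sq'
      · linarith
      · linarith
    have h2 : (2 * ε) ^ 2 ≤ h z ^ 2 := by
      apply pow_le_pow_left₀ (by positivity) hh
    nlinarith [sq_nonneg ε, mul_le_mul_of_nonneg_left h1 (sq_nonneg ε)]
  -- h 1 = 0
  have h1z : h 1 = 0 := by
    by_contra hne
    have hpos : 0 < h 1 := lt_of_le_of_ne (hnn 1 (by simp)) (Ne.symm hne)
    obtain ⟨c, hcz⟩ := H (h 1 / 2) (by positivity)
    have e1 := hcz 1 (by simp) (hr _ (by positivity) _ (by simp) (by linarith))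
    have em : h (-1) = h 1 := heven 1 (by simp)
    have e2 := hcz (-1) (by simp) (hr _ (by positivity) _ (by simp) (by rw [em]; linarith))
    have c0 : c = 0 := by
      have := abs_le.1 e1.1
      have := abs_le.1 e2.1
      linarith
    have e3 := e1.2
    rw [c0] at e3
    norm_num at e3
    rw [em] at e3
    have h4 : (h 1 / 2) ^ 2 * (4 * μ) = 0 := by linarith
    have : 0 < (h 1 / 2) ^ 2 * (4 * μ) := by positivity
    linarith
  -- choose c
  choose! c hcp using H
  have hcne : ∀ ε > 0, c ε ≠ 0 := by
    intro ε hε hc0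
    have hm : |μ| ≤ 1 := by rw [abs_of_pos hμ0]; exact hμ1.le
    have := (hcp ε hε μ hm (by simp; positivity)).2
    rw [hc0] at this
    simp only [mul_zero, zero_sub, sub_self] at this
    rw [heven μ hm] at this
    have h4 : ε ^ 2 * (4 * μ ^ 2) = 0 := by linarith
    have : 0 < ε ^ 2 * (4 * μ ^ 2) := by positivity
    linarith
  have hcsmall : ∀ ε > 0, ε ≤ 1/2 → |c ε| ≤ ε := by
    intro ε hε hε2
    have ha : |1 - 2 * ε| ≤ 1 := by rw [abs_le]; constructor <;> linarith
    have hb : 2 * ε ≤ h (1 - 2 * ε) := by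
      have := hlow _ ha
      rw [abs_of_nonneg (by linarith)] at this
      linarith
    have e1 := (hcp ε hε _ ha (hr _ hε _ ha hb)).1
    have e2 := (hcp ε hε (-(1 - 2 * ε)) (by rwa [abs_neg])
      (hr _ hε _ (by rwa [abs_neg]) (by rwa [heven _ ha]))).1
    rw [abs_le] at *
    constructor <;> linarith [e1.1, e2.2]
  -- periodicity
  set γ : ℝ → ℝ := fun ε => ε ^ 2 * (μ - c ε) / c ε with hγ
  have hper : ∀ ε > 0, ∀ s, 0 ≤ s → 2 * ε ≤ 1 - s → ∀ k : ℕ, 2 * |c ε| * k ≤ s →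
      h (-(2 * c ε * k)) ^ 2 = 1 - γ ε * (2 * c ε * k) ^ 2 := by
    intro ε hε s hs0 hs k
    induction k with
    | zero => intro _; simp [h0]
    | succ k ih =>
      intro hk
      push_cast at hk
      have hk' : 2 * |c ε| * k ≤ s := by nlinarith [abs_nonneg (c ε)]
      have ihk := ih hk'
      have hzabs : |-(2 * c ε * k)| = 2 * |c ε| * k := by
        rw [abs_neg, abs_mul, abs_mul]; simp
      have hz1 : |-(2 * c ε * k)| ≤ 1 := by rw [hzabs]; linarith
      have hlo := hlow _ hz1
      rw [hzabs] at hlo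
      have := hcp ε hε _ hz1 (hr _ hε _ hz1 (by linarith))
      have ee : 2 * c ε - -(2 * c ε * k) = 2 * c ε * ((k : ℝ) + 1) := by ring
      rw [ee] at this
      push_cast
      rw [heven _ this.1]
      have h2 := this.2
      rw [ihk] at h2
      have hg : γ ε * c ε = ε ^ 2 * (μ - c ε) := by
        rw [hγ]; field_simp [hcne ε hε]
      linear_combination h2 + (4 * c ε * (2 * k + 1)) * hg
  -- the sequence
  set e : ℕ → ℝ := fun n => 1 / ((n : ℝ) + 1) with he
  have hepos : ∀ n, 0 < e n := fun n => by positivity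
  have het : Filter.Tendsto e Filter.atTop (nhds 0) := tendsto_one_div_add_atTop_nhds_zero_nat
  have hct : Filter.Tendsto (fun n => c (e n)) Filter.atTop (nhds 0) := by
    rw [tendsto_zero_iff_abs_tendsto_zero]
    refine tendsto_of_tendsto_of_tendsto_of_le_of_le' tendsto_const_nhds het ?_ ?_
    · exact Filter.Eventually.of_forall fun n => abs_nonneg _
    · have : ∀ᶠ n in Filter.atTop, e n < 1/2 := het.eventually (gt_mem_nhds (by norm_num))
      filter_upwards [this] with n hn
      exact hcsmall _ (hepos n) hn.le
  have hcont : ContinuousOn h (Ioo (-1) 1) := by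
    have := hc.continuousOn_interior
    rwa [interior_Icc] at this
  have hlim : ∀ s, 0 < s → s < 1 →
      Filter.Tendsto (fun n => γ (e n)) Filter.atTop (nhds ((1 - h s ^ 2) / s ^ 2)) := by
    intro s hs0 hs1
    set x : ℕ → ℝ := fun n => 2 * |c (e n)| * (⌊s / (2 * |c (e n)|)⌋₊ : ℝ) with hx
    have hxs : ∀ n, x n ≤ s ∧ s - 2 * |c (e n)| ≤ x n := by
      intro n
      have hp : 0 < 2 * |c (e n)| := by
        have := abs_pos.2 (hcne _ (hepos n)); linarith
      have a1 := Nat.floor_le (a := s / (2 * |c (e n)|)) (by positivity)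
      have a2 := Nat.lt_floor_add_one (s / (2 * |c (e n)|))
      rw [le_div_iff₀ hp] at a1
      rw [div_lt_iff₀ hp] at a2
      constructor
      · rw [hx]; simp only; linarith
      · rw [hx]; simp only; linarith
    have hxt : Filter.Tendsto x Filter.atTop (nhds s) := by
      refine tendsto_of_tendsto_of_tendsto_of_le_of_le (g := fun n => s - 2 * |c (e n)|) ?_
        tendsto_const_nhds (fun n => (hxs n).2) (fun n => (hxs n).1)
      have := (hct.abs.const_mul 2).const_sub s
      simpa using this
    have hht : Filter.Tendsto (fun n => h (x n)) Filter.atTop (nhds (h s)) := by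
      have : ContinuousAt h s :=
        hcont.continuousAt (Ioo_mem_nhds (by linarith) hs1)
      exact this.tendsto.comp hxt
    have hq : Filter.Tendsto (fun n => (1 - h (x n) ^ 2) / (x n) ^ 2) Filter.atTop
        (nhds ((1 - h s ^ 2) / s ^ 2)) := by
      refine Filter.Tendsto.div ((hht.pow 2).const_sub 1) (hxt.pow 2) (by positivity)
    refine hq.congr' ?_
    have e1 : ∀ᶠ n in Filter.atTop, e n < (1 - s) / 2 := het.eventually (gt_mem_nhds (by linarith))
    have e2 : ∀ᶠ n in Filter.atTop, s / 2 < x n := hxt.eventually (lt_mem_nhds (by linarith))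
    filter_upwards [e1, e2] with n hn1 hn2
    have hp := hper (e n) (hepos n) s hs0.le (by linarith) _ ((hxs n).1)
    set k : ℝ := (⌊s / (2 * |c (e n)|)⌋₊ : ℝ) with hk
    have hxpos : 0 < x n := by linarith
    have hsq : (2 * c (e n) * k) ^ 2 = x n ^ 2 := by
      rw [hx]; simp only; rw [mul_pow, mul_pow, mul_pow, mul_pow, sq_abs]
    have hhx : h (-(2 * c (e n) * k)) = h (x n) := by
      have hx1 : |x n| ≤ 1 := by rw [abs_of_pos hxpos]; linarith [(hxs n).1]
      rcases sq_eq_sq_iff_eq_or_eq_neg.1 hsq with h' | h'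
      · rw [h', heven _ hx1]
      · rw [h', neg_neg]
    rw [hhx, hsq] at hp
    rw [hp]
    field_simp
    ring
  set g := (1 - h (1/2) ^ 2) / (1/2) ^ 2 with hg
  have hform : ∀ s, 0 < s → s < 1 → h s ^ 2 = 1 - g * s ^ 2 := by
    intro s hs0 hs1
    have := tendsto_nhds_unique (hlim s hs0 hs1) (hlim (1/2) (by norm_num) (by norm_num))
    rw [← hg, div_eq_iff (by positivity)] at this
    linarith
  have hg1 : g ≤ 1 := by
    by_contra hgt
    push Not at hgt
    have hx1 : 1 / g < 1 := by rw [div_lt_one (by linarith)]; exact hgt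
    have hx0 : 0 < 1 / g := by positivity
    have := hform ((1 + 1 / g) / 2) (by linarith) (by linarith)
    have hh := sq_nonneg (h ((1 + 1 / g) / 2))
    rw [this] at hh
    have e3 : g * ((1 + 1/g)/2)^2 = (g + 2 + 1/g)/4 := by field_simp; ring
    rw [e3] at hh
    have e4 : g + 1/g - 2 = (g - 1)^2 / g := by field_simp; ring
    have : 0 < (g-1)^2 / g := by
      have : 0 < g - 1 := by linarith
      positivity
    linarith
  have hg0 : 0 ≤ g := by
    have := hle1 (1/2) (by rw [abs_of_pos] <;> norm_num)
    have := hnn (1/2) (by rw [abs_of_pos] <;> norm_num)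
    rw [hg]
    apply div_nonneg
    · nlinarith
    · positivity
  have hg2 : 1 ≤ g := by
    by_contra hlt
    push Not at hlt
    have : Real.sqrt (1 - g) ≤ h 1 := by
      apply husc
      intro z hz0 hz1
      apply Real.sqrt_le_iff.2
      refine ⟨hnn z (by rw [abs_of_nonneg hz0]; exact hz1.le), ?_⟩
      rcases hz0.eq_or_lt with h' | h'
      · rw [← h', h0]; linarith
      · have hz2 : z ^ 2 ≤ 1 := by nlinarith
        rw [hform z h' hz1]; nlinarith
    rw [h1z] at this
    have := Real.sqrt_pos.2 (show 0 < 1 - g by linarith)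
    linarith
  have hgg : g = 1 := le_antisymm hg1 hg2
  have hpos : ∀ z, 0 ≤ z → z ≤ 1 → h z ^ 2 = 1 - z ^ 2 := by
    intro z hz0 hz1
    rcases hz0.eq_or_lt with h' | h'
    · rw [← h', h0]; norm_num
    · rcases hz1.eq_or_lt with h2 | h2
      · rw [h2, h1z]; norm_num
      · rw [hform z h' h2, hgg]; ring
  intro z hz
  rcases le_total 0 z with h' | h'
  · exact hpos z h' (abs_le.1 hz).2
  · rw [← heven z hz, hpos (-z) (by linarith) (by linarith [(abs_le.1 hz).1])]; ring

end

section

theorem fpt_kappa (h : ℝ → ℝ) (μ : ℝ) (hμ0 : 0 < μ) (hμ1 : μ < 1)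
    (hc : ConcaveOn ℝ (Icc (-1) 1) h) (h0 : h 0 = 1) (hlt : h μ < 1) :
    ∃ k > 0, HasDerivAt (fun s => h (μ + s) - h (μ - s)) (-2 * k) 0 := by
  have hg : ConvexOn ℝ (Icc (-1) 1) (-h) := hc.neg
  have hmem : μ ∈ interior (Icc (-1:ℝ) 1) := by
    rw [interior_Icc]; exact ⟨by linarith, hμ1⟩
  have hr := hg.hasDerivWithinAt_rightDeriv_of_mem_interior hmem
  have hl := hg.hasDerivWithinAt_leftDeriv_of_mem_interior hmem
  have hlr := hg.leftDeriv_le_rightDeriv_of_mem_interior hmem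
  have hsl := hg.slope_le_of_hasDerivWithinAt_Iio (x := 0) (y := μ) ⟨by norm_num, by norm_num⟩
    ⟨by linarith, hμ1.le⟩ hμ0 hl
  set r := derivWithin (-h) (Ioi μ) μ
  set l := derivWithin (-h) (Iio μ) μ
  have hlpos : 0 < l := by
    refine lt_of_lt_of_le ?_ hsl
    rw [slope_def_field]
    apply div_pos
    · simp only [Pi.neg_apply]; linarith
    · linarith
  refine ⟨(l + r) / 2, by linarith, ?_⟩
  have a1 : HasDerivWithinAt (fun s : ℝ => μ + s) 1 (Ioi 0) 0 :=
    ((hasDerivAt_id' (0:ℝ)).const_add μ).hasDerivWithinAt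
  have a2 : HasDerivWithinAt (fun s : ℝ => μ - s) (-1) (Ioi 0) 0 :=
    ((hasDerivAt_id' (0:ℝ)).const_sub μ).hasDerivWithinAt
  have a3 : HasDerivWithinAt (fun s : ℝ => μ + s) 1 (Iio 0) 0 :=
    ((hasDerivAt_id' (0:ℝ)).const_add μ).hasDerivWithinAt
  have a4 : HasDerivWithinAt (fun s : ℝ => μ - s) (-1) (Iio 0) 0 :=
    ((hasDerivAt_id' (0:ℝ)).const_sub μ).hasDerivWithinAt
  have r' : HasDerivWithinAt h (-r) (Ioi μ) μ := by simpa using hr.neg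
  have l' : HasDerivWithinAt h (-l) (Iio μ) μ := by simpa using hl.neg
  have b1 : HasDerivWithinAt (fun s => h (μ + s)) (-r * 1) (Ioi 0) 0 :=
    HasDerivWithinAt.comp (h₂ := h) (h := fun s : ℝ => μ + s) (s' := Ioi μ) 0 (by simpa using r') a1
      (fun s hs => by simpa using hs)
  have b2 : HasDerivWithinAt (fun s => h (μ - s)) (-l * (-1)) (Ioi 0) 0 :=
    HasDerivWithinAt.comp (h₂ := h) (h := fun s : ℝ => μ - s) (s' := Iio μ) 0 (by simpa using l') a2
      (fun s hs => by simpa using hs)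
  have b3 : HasDerivWithinAt (fun s => h (μ + s)) (-l * 1) (Iio 0) 0 :=
    HasDerivWithinAt.comp (h₂ := h) (h := fun s : ℝ => μ + s) (s' := Iio μ) 0 (by simpa using l') a3
      (fun s hs => by simpa using hs)
  have b4 : HasDerivWithinAt (fun s => h (μ - s)) (-r * (-1)) (Iio 0) 0 :=
    HasDerivWithinAt.comp (h₂ := h) (h := fun s : ℝ => μ - s) (s' := Ioi μ) 0 (by simpa using r') a4
      (fun s hs => by have h' : s < 0 := hs; show μ < μ - s; linarith)
  have c1 : HasDerivWithinAt (fun s => h (μ + s) - h (μ - s)) (-2 * ((l + r) / 2)) (Ici 0) 0 := by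
    rw [← hasDerivWithinAt_Ioi_iff_Ici]
    exact (b1.sub b2).congr_deriv (by ring)
  have c2 : HasDerivWithinAt (fun s => h (μ + s) - h (μ - s)) (-2 * ((l + r) / 2)) (Iic 0) 0 := by
    rw [← hasDerivWithinAt_Iio_iff_Iic]
    exact (b3.sub b4).congr_deriv (by ring)
  have := c2.union c1
  rw [Iic_union_Ici] at this
  exact hasDerivWithinAt_univ.1 this

theorem fpt_lip (h : ℝ → ℝ) (μ : ℝ) (hμ0 : 0 < μ) (hμ1 : μ < 1)
    (hc : ConcaveOn ℝ (Icc (-1) 1) h) :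
    ∃ C > 0, ∃ ρ > 0, ρ < 1 - μ ∧ ∀ s t, |s| < ρ → |t| < ρ →
      |h (μ + s) - h (μ + t)| ≤ C * |s - t| := by
  have hop : ConcaveOn ℝ (Ioo (-1) 1) h := hc.subset Ioo_subset_Icc_self (convex_Ioo _ _)
  have := hop.locallyLipschitzOn isOpen_Ioo
  obtain ⟨C, t, ht, hC⟩ := this (show μ ∈ Ioo (-1:ℝ) 1 from ⟨by linarith, hμ1⟩)
  have ht' : t ∈ nhds μ := by
    rw [IsOpen.nhdsWithin_eq isOpen_Ioo ⟨by linarith, hμ1⟩] at ht; exact ht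
  obtain ⟨ρ, hρ, hb⟩ := Metric.mem_nhds_iff.1 ht'
  refine ⟨C + 1, by positivity, min ρ ((1 - μ) / 2), lt_min hρ (by linarith), ?_, ?_⟩
  · exact lt_of_le_of_lt (min_le_right _ _) (by linarith)
  · intro s u hs hu
    have := hC.dist_le_mul (μ + s) (hb (by simp [lt_of_lt_of_le hs (min_le_left _ _)])) (μ + u)
      (hb (by simp [lt_of_lt_of_le hu (min_le_left _ _)]))
    rw [Real.dist_eq, Real.dist_eq] at this
    have e : μ + s - (μ + u) = s - u := by ring
    rw [e] at this
    nlinarith [abs_nonneg (s - u)]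

variable {T : Type*} [NormedAddCommGroup T] [NormedSpace ℝ T]

theorem fpt_hmu (hT : finrank ℝ T = 2) (h : ℝ → ℝ) (μ : ℝ)
    (hμ0 : 0 < μ) (hμ1 : μ < 1) (hle1 : ∀ z, |z| ≤ 1 → h z ≤ 1)
    (hlow : ∀ z, |z| ≤ 1 → 1 - |z| ≤ h z)
    (H : ∀ ξ : T →ₗ[ℝ] ℝ, ∃ c : T, ∀ y, |μ + ξ y| ≤ 1 → ‖y‖ ≤ h (μ + ξ y) →
      |μ + ξ ((2:ℝ) • c - y)| ≤ 1 ∧ ‖(2:ℝ) • c - y‖ ≤ h (μ + ξ ((2:ℝ) • c - y))) : h μ < 1 := by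
  by_contra hcon
  push Not at hcon
  have : FiniteDimensional ℝ T := FiniteDimensional.of_finrank_pos (by omega)
  have : Nontrivial T := Module.nontrivial_of_finrank_pos (R := ℝ) (by omega)
  have : ProperSpace T := FiniteDimensional.proper ℝ T
  obtain ⟨a, ha⟩ := (isCompact_closedBall (0:T) 1).extremePoints_nonempty ⟨0, by simp⟩
  have hμabs : |μ| ≤ 1 := by rw [abs_of_pos hμ0]; exact hμ1.le
  have han : ‖a‖ ≤ 1 := by simpa using ha.1
  have hext : ∀ c : T, ‖a + c‖ ≤ 1 → ‖a - c‖ ≤ 1 → c = 0 := by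
    intro c h1 h2
    have := ha.2 (x₁ := a + c) (by simpa using h1) (x₂ := a - c) (by simpa using h2)
      ⟨1/2, 1/2, by norm_num, by norm_num, by norm_num, by module⟩
    simpa using this
  have ha0 : a ≠ 0 := by
    rintro rfl
    obtain ⟨v, hv⟩ := exists_norm_eq T (c := 1) zero_le_one
    have := hext v (by simp [hv]) (by simp [hv])
    rw [this] at hv; simp at hv
  obtain ⟨ξ, hξ0, hξa⟩ : ∃ ξ : T →ₗ[ℝ] ℝ, ξ ≠ 0 ∧ ξ a = 0 := by
    have hlt : (Submodule.span ℝ {a}) < ⊤ := by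
      rw [lt_top_iff_ne_top]
      intro htop
      have h1 := finrank_span_singleton (K := ℝ) ha0
      rw [htop, finrank_top, hT] at h1
      omega
    obtain ⟨f, hf, hf2⟩ := Submodule.exists_le_ker_of_lt_top _ hlt
    exact ⟨f, hf, by simpa using hf2 (Submodule.mem_span_singleton_self a)⟩
  obtain ⟨b, hb⟩ : ∃ b, ξ b = 1 := by
    obtain ⟨b, hb⟩ := LinearMap.surjective hξ0 1
    exact ⟨b, hb⟩
  -- all centres vanish
  have hcen : ∀ η : ℝ, ∀ y, |μ + η * ξ y| ≤ 1 → ‖y‖ ≤ h (μ + η * ξ y) →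
      |μ - η * ξ y| ≤ 1 := by
    intro η y h1 h2
    obtain ⟨c, hc⟩ := H (η • ξ)
    simp only [LinearMap.smul_apply, smul_eq_mul] at hc
    have c1 := hc a (by simp [hξa, hμabs]) (by simp [hξa]; linarith)
    have c2 := hc (-a) (by simp [hξa, hμabs]) (by simp [hξa]; linarith)
    have c0 : (2:ℝ) • c = 0 := by
      apply hext
      · have := c2.2.trans (hle1 _ c2.1)
        rw [sub_neg_eq_add, add_comm] at this; exact this
      · have := c1.2.trans (hle1 _ c1.1)
        rw [norm_sub_rev] at this; exact this
    have := (hc y h1 h2).1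
    rw [c0] at this
    simpa [sub_eq_add_neg] using this
  have hbn : 0 < ‖b‖ + 1 := by positivity
  have ht : 0 < μ / (‖b‖ + 1) := by positivity
  set t := μ / (‖b‖ + 1) with htd
  have hz1 : |μ - 1| ≤ 1 := by rw [abs_le]; constructor <;> linarith
  have e1 : μ + (-1/t) * ξ (t • b) = μ - 1 := by
    rw [map_smul, hb, smul_eq_mul]; field_simp; ring
  have e2 : μ - (-1/t) * ξ (t • b) = μ + 1 := by
    rw [map_smul, hb, smul_eq_mul]; field_simp; ring
  have := hcen (-1/t) (t • b) (by rw [e1]; exact hz1) (by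
    rw [e1, norm_smul, Real.norm_of_nonneg ht.le]
    have h1 := hlow _ hz1
    rw [abs_of_nonpos (by linarith)] at h1
    have h2 : t * ‖b‖ ≤ μ := by
      have : t * (‖b‖ + 1) = μ := by rw [htd]; field_simp
      nlinarith
    linarith)
  rw [e2] at this
  linarith [(abs_le.1 this).2]

theorem fpt_ivt (h : ℝ → ℝ) (μ : ℝ) (hμ0 : 0 < μ) (hcont : ContinuousOn h (Ioo (-1) 1))
    (hle1 : ∀ z, |z| ≤ 1 → h z ≤ 1) (hnn : ∀ z, |z| ≤ 1 → 0 ≤ h z) (q : ℝ) (hq : |q| < 1 - μ) :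
    ∃ t, 0 ≤ t ∧ t ≤ 1 ∧ h (μ + t * q) = t := by
  have hq' := abs_lt.1 hq
  have key : ∀ t ∈ Icc (0:ℝ) 1, |t * q| ≤ |q| := by
    intro t ht
    rw [abs_mul, abs_of_nonneg ht.1]
    nlinarith [abs_nonneg q, ht.2]
  have hin : ∀ t ∈ Icc (0:ℝ) 1, μ + t * q ∈ Ioo (-1:ℝ) 1 := by
    intro t ht
    have := abs_le.1 (key t ht)
    constructor <;> linarith [abs_nonneg q]
  have hin2 : ∀ t ∈ Icc (0:ℝ) 1, |μ + t * q| ≤ 1 := fun t ht =>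
    abs_le.2 ⟨(hin t ht).1.le, (hin t ht).2.le⟩
  have hco : ContinuousOn (fun t => t - h (μ + t * q)) (Icc 0 1) := by
    apply ContinuousOn.sub continuousOn_id
    exact hcont.comp (by fun_prop) hin
  have := intermediate_value_Icc (zero_le_one) hco
  have h0 : (0:ℝ) ∈ Icc ((fun t => t - h (μ + t * q)) 0) ((fun t => t - h (μ + t * q)) 1) := by
    constructor
    · simp only; linarith [hnn _ (hin2 0 (by simp))]
    · simp only; linarith [hle1 _ (hin2 1 (by simp))]
  obtain ⟨t, ht, ht2⟩ := this h0
  exact ⟨t, ht.1, ht.2, by simp only at ht2; linarith⟩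

end

section

theorem fpt_bxi {T : Type*} [NormedAddCommGroup T] [NormedSpace ℝ T] [FiniteDimensional ℝ T]
    (h : ℝ → ℝ) (μ k : ℝ)
    (hμ0 : 0 < μ) (hμ1 : μ < 1) (hc : ConcaveOn ℝ (Icc (-1) 1) h)
    (hle1 : ∀ z, |z| ≤ 1 → h z ≤ 1) (hnn : ∀ z, |z| ≤ 1 → 0 ≤ h z)
    (hk : HasDerivAt (fun s => h (μ + s) - h (μ - s)) (-2 * k) 0)
    (ξ : T →ₗ[ℝ] ℝ)
    (H : ∀ η : ℝ, ∃ c : T, ∀ y, |μ + η * ξ y| ≤ 1 → ‖y‖ ≤ h (μ + η * ξ y) →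
      |μ + η * ξ ((2:ℝ) • c - y)| ≤ 1 ∧
        ‖(2:ℝ) • c - y‖ ≤ h (μ + η * ξ ((2:ℝ) • c - y))) :
    ∃ b : T, ∀ (F : T →ₗ[ℝ] ℝ) (a : T), (∀ x, F x ≤ ‖x‖) → F a = 1 → ‖a‖ = 1 →
      F b = -(k * h μ) * ξ a := by
  have : ProperSpace T := FiniteDimensional.proper ℝ T
  have hcont : ContinuousOn h (Ioo (-1) 1) := by
    have := hc.continuousOn_interior
    rwa [interior_Icc] at this
  obtain ⟨C, hC0, ρ, hρ0, hρ1, hlip⟩ := fpt_lip h μ hμ0 hμ1 hc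
  have hμabs : |μ| ≤ 1 := by rw [abs_of_pos hμ0]; exact hμ1.le
  -- bound for ξ
  obtain ⟨X, hX0, hX⟩ : ∃ X > 0, ∀ y, |ξ y| ≤ X * ‖y‖ := by
    refine ⟨‖LinearMap.toContinuousLinearMap ξ‖ + 1, by positivity, fun y => ?_⟩
    have := (LinearMap.toContinuousLinearMap ξ).le_opNorm y
    rw [Real.norm_eq_abs] at this
    simp only [LinearMap.coe_toContinuousLinearMap'] at this
    nlinarith [norm_nonneg y]
  -- dual vectors
  have hdual : ∀ c : T, c ≠ 0 → ∃ (F : T →ₗ[ℝ] ℝ) (a : T), (∀ x, F x ≤ ‖x‖) ∧ F a = 1 ∧ ‖a‖ = 1 ∧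
      F c = -‖c‖ := by
    intro c hc0
    have hcn : 0 < ‖c‖ := norm_pos_iff.2 hc0
    obtain ⟨g, hg1, hg2⟩ := exists_dual_vector ℝ c hcn.ne'
    refine ⟨-(g : T →ₗ[ℝ] ℝ), -(‖c‖⁻¹ • c), ?_, ?_, ?_, ?_⟩
    · intro x
      have := g.le_opNorm x
      rw [hg1, one_mul, Real.norm_eq_abs] at this
      simpa using (neg_le_abs _).trans this
    · simp [hg2, hcn.ne']
    · rw [norm_neg, norm_smul, norm_inv, norm_norm]; field_simp
    · simp [hg2]
  choose c hcc using H
  have hcb : ∀ η, ‖c η‖ ≤ 1 := by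
    intro η
    have h1 := hcc η 0 (by simpa using hμabs) (by simpa using hnn μ hμabs)
    have h2 := h1.2.trans (hle1 _ h1.1)
    rw [sub_zero, norm_smul] at h2
    norm_num at h2
    linarith [norm_nonneg (c η)]
  -- main inequality
  have main : ∀ η, 0 < η → 3 * η * X < ρ → ∀ (F : T →ₗ[ℝ] ℝ) (a : T), (∀ x, F x ≤ ‖x‖) → F a = 1 →
      ‖a‖ = 1 → ∃ t, 0 ≤ t ∧ t ≤ 1 ∧ h (μ + t * (η * ξ a)) = t ∧
        |t * (η * ξ a)| < ρ ∧ |t * (η * ξ a) - 2 * η * ξ (c η)| < ρ ∧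
        |t * (η * ξ a)| ≤ η * X ∧ |t * (η * ξ a) - 2 * η * ξ (c η)| ≤ 3 * η * X ∧
        h (μ + t * (η * ξ a)) - h (μ - (t * (η * ξ a) - 2 * η * ξ (c η))) ≤ 2 * F (c η) := by
    intro η hη hηρ F a hF hFa ha
    have hξa : |ξ a| ≤ X := by simpa [ha] using hX a
    have hξc : |ξ (c η)| ≤ X := (hX _).trans (by nlinarith [hcb η])
    have hqb : |η * ξ a| ≤ η * X := by
      rw [abs_mul, abs_of_pos hη]; exact mul_le_mul_of_nonneg_left hξa hη.le
    have hηX : 0 < η * X := by positivity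
    obtain ⟨t, ht0, ht1, ht⟩ := fpt_ivt h μ hμ0 hcont hle1 hnn (η * ξ a) (by nlinarith)
    have hs1 : |t * (η * ξ a)| ≤ η * X := by
      rw [abs_mul, abs_of_nonneg ht0]; nlinarith [abs_nonneg (η * ξ a)]
    have hs2 : |t * (η * ξ a) - 2 * η * ξ (c η)| ≤ 3 * η * X := by
      have h3 : |2 * η * ξ (c η)| ≤ 2 * η * X := by
        rw [abs_mul, abs_of_pos (by positivity : (0:ℝ) < 2 * η)]
        exact mul_le_mul_of_nonneg_left hξc (by positivity)
      calc _ ≤ |t * (η * ξ a)| + |2 * η * ξ (c η)| := abs_sub _ _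
        _ ≤ _ := by linarith
    refine ⟨t, ht0, ht1, ht, by nlinarith, by linarith, hs1, hs2, ?_⟩
    have e1 : μ + η * ξ (t • a) = μ + t * (η * ξ a) := by
      rw [map_smul, smul_eq_mul]; ring
    have hs1' := abs_le.1 hs1
    have := hcc η (t • a) (by rw [e1, abs_le]; constructor <;> nlinarith)
      (by rw [e1, ht, norm_smul, ha, Real.norm_of_nonneg ht0, mul_one])
    have e2 : μ + η * ξ ((2:ℝ) • c η - t • a) = μ - (t * (η * ξ a) - 2 * η * ξ (c η)) := by
      rw [map_sub, map_smul, map_smul, smul_eq_mul, smul_eq_mul]; ring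
    rw [e2] at this
    have h4 := hF (-((2:ℝ) • c η - t • a))
    rw [norm_neg] at h4
    have e3 : F (-((2:ℝ) • c η - t • a)) = t - 2 * F (c η) := by
      rw [map_neg, map_sub, map_smul, map_smul, smul_eq_mul, smul_eq_mul, hFa]; ring
    rw [e3] at h4
    rw [ht]
    linarith [this.2]
  have hcO : ∀ η, 0 < η → 3 * η * X < ρ → ‖c η‖ ≤ (2 * C * X) * η := by
    intro η hη hηρ
    by_cases hc0 : c η = 0
    · rw [hc0, norm_zero]; positivity
    obtain ⟨F, a, hF, hFa, ha, hFc⟩ := hdual _ hc0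
    obtain ⟨t, ht0, ht1, ht, hs1, hs2, hs1', hs2', hm⟩ := main η hη hηρ F a hF hFa ha
    rw [hFc] at hm
    set s1 := t * (η * ξ a)
    set s2 := s1 - 2 * η * ξ (c η)
    have := hlip s1 (-s2) hs1 (by rwa [abs_neg])
    rw [← sub_eq_add_neg] at this
    have h5 := (abs_le.1 this).1
    have h6 : |s1 - -s2| ≤ 4 * η * X := by
      rw [sub_neg_eq_add]
      exact (abs_add_le _ _).trans (by linarith)
    nlinarith [mul_le_mul_of_nonneg_left h6 hC0.le]
  -- sequence
  set e : ℕ → ℝ := fun n => 1 / ((n : ℝ) + 1) with he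
  have hepos : ∀ n, 0 < e n := fun n => by positivity
  have het : Filter.Tendsto e Filter.atTop (nhds 0) := tendsto_one_div_add_atTop_nhds_zero_nat
  have hev : ∀ᶠ n in Filter.atTop, 3 * e n * X < ρ := by
    have h1 : Filter.Tendsto (fun n => 3 * e n * X) Filter.atTop (nhds 0) := by
      simpa using (het.const_mul 3).mul_const X
    exact h1.eventually (gt_mem_nhds hρ0)
  obtain ⟨N, hN⟩ := Filter.eventually_atTop.1 hev
  set e' : ℕ → ℝ := fun n => e (n + N) with he'
  have he'pos : ∀ n, 0 < e' n := fun n => hepos _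
  have he't : Filter.Tendsto e' Filter.atTop (nhds 0) :=
    het.comp (Filter.tendsto_add_atTop_nat N)
  have he'ρ : ∀ n, 3 * e' n * X < ρ := fun n => hN _ (by omega)
  obtain ⟨b, -, φ, hφ, hlim⟩ := (isCompact_closedBall (0:T) (2 * C * X)).tendsto_subseq
    (x := fun n => (e' n)⁻¹ • c (e' n)) (fun n => by
      rw [mem_closedBall_zero_iff, norm_smul, norm_inv, Real.norm_of_nonneg (he'pos n).le,
        inv_mul_le_iff₀ (he'pos n), mul_comm]
      exact hcO _ (he'pos n) (he'ρ n))
  have hηt : Filter.Tendsto (fun n => e' (φ n)) Filter.atTop (nhds 0) :=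
    he't.comp hφ.tendsto_atTop
  have half : ∀ (F : T →ₗ[ℝ] ℝ) (a : T), (∀ x, F x ≤ ‖x‖) → F a = 1 → ‖a‖ = 1 →
      -(k * h μ) * ξ a ≤ F b := by
    intro F a hF hFa ha
    choose t ht0 ht1 ht hs1 hs2 hs1' hs2' hm using
      fun n => main (e' (φ n)) (he'pos _) (he'ρ _) F a hF hFa ha
    have hFcont : Continuous F := LinearMap.continuous_of_finiteDimensional F
    have hξcont : Continuous ξ := LinearMap.continuous_of_finiteDimensional ξ
    have hst : Filter.Tendsto (fun n => t n * (e' (φ n) * ξ a)) Filter.atTop (nhds 0) := by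
      refine squeeze_zero_norm (a := fun n => e' (φ n) * X) (fun n => hs1' n) ?_
      simpa using hηt.mul_const X
    have htt : Filter.Tendsto t Filter.atTop (nhds (h μ)) := by
      have h1 : ContinuousAt h μ := hcont.continuousAt (Ioo_mem_nhds (by linarith) hμ1)
      have h2 : Filter.Tendsto (fun n => μ + t n * (e' (φ n) * ξ a)) Filter.atTop (nhds μ) := by
        simpa using hst.const_add μ
      exact (h1.tendsto.comp h2).congr fun n => ht n
    set κ := fun s => h (μ + s) - h (μ - s) with hκ
    have hds : Filter.Tendsto (fun n => dslope κ 0 (t n * (e' (φ n) * ξ a))) Filter.atTop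
        (nhds (-2 * k)) := by
      have h1 : ContinuousAt (dslope κ 0) 0 := continuousAt_dslope_same.2 hk.differentiableAt
      have h2 := h1.tendsto
      rw [dslope_same, hk.deriv] at h2
      exact h2.comp hst
    have hct : Filter.Tendsto (fun n => ξ (c (e' (φ n)))) Filter.atTop (nhds 0) := by
      have h1 : Filter.Tendsto (fun n => c (e' (φ n))) Filter.atTop (nhds 0) := by
        refine squeeze_zero_norm (a := fun n => 2 * C * X * e' (φ n))
          (fun n => hcO _ (he'pos _) (he'ρ _)) ?_
        simpa using hηt.const_mul (2 * C * X)
      have := (hξcont.tendsto 0).comp h1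
      rw [map_zero] at this
      exact this
    have L1 : Filter.Tendsto (fun n => t n * ξ a * dslope κ 0 (t n * (e' (φ n) * ξ a))
        - C * (2 * |ξ (c (e' (φ n)))|)) Filter.atTop
        (nhds (h μ * ξ a * (-2 * k) - C * (2 * |0|))) :=
      ((htt.mul_const _).mul hds).sub ((hct.abs.const_mul 2).const_mul C)
    have L2 : Filter.Tendsto (fun n => 2 * F ((e' (φ n))⁻¹ • c (e' (φ n)))) Filter.atTop
        (nhds (2 * F b)) := ((hFcont.tendsto b).comp hlim).const_mul 2
    have := le_of_tendsto_of_tendsto' L1 L2 (fun n => by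
      have hη := he'pos (φ n)
      set η := e' (φ n)
      have m1 := hm n
      set s1 := t n * (η * ξ a) with hs1d
      have m2 := (abs_le.1 (hlip (-s1) (-(s1 - 2 * η * ξ (c η))) (by rw [abs_neg]; exact hs1 n)
        (by rw [abs_neg]; exact hs2 n))).1
      have e5 : -s1 - -(s1 - 2 * η * ξ (c η)) = -(2 * η * ξ (c η)) := by ring
      rw [e5, abs_neg, abs_mul, abs_of_pos (by positivity : (0:ℝ) < 2 * η), ← sub_eq_add_neg,
        ← sub_eq_add_neg] at m2
      have m3 : κ s1 = s1 * dslope κ 0 s1 := by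
        have := sub_smul_dslope κ 0 s1
        simp only [sub_zero, smul_eq_mul] at this
        rw [this, hκ]; simp
      have m4 : κ s1 = h (μ + s1) - h (μ - s1) := rfl
      rw [map_smul, smul_eq_mul]
      have m5 : 2 * (η⁻¹ * F (c η)) = (2 * F (c η)) / η := by field_simp
      rw [m5, le_div_iff₀ hη]
      have m6 : (t n * ξ a * dslope κ 0 s1 - C * (2 * |ξ (c η)|)) * η
        = s1 * dslope κ 0 s1 - C * (2 * η * |ξ (c η)|) := by rw [hs1d]; ring
      rw [m6, ← m3, m4]
      linarith)
    simp only [abs_zero, mul_zero, sub_zero] at this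
    linarith
  refine ⟨b, fun F a hF hFa ha => le_antisymm ?_ (half F a hF hFa ha)⟩
  have := half (-F) (-a) (fun x => by
    have := hF (-x); rw [norm_neg, map_neg] at this; simpa using this) (by simpa using hFa)
    (by simpa using ha)
  simp only [map_neg, LinearMap.neg_apply] at this
  linarith

end

section

theorem fpt_par {T : Type*} [NormedAddCommGroup T] [NormedSpace ℝ T] [FiniteDimensional ℝ T]
    (K : ℝ) (hK : 0 < K)
    (H : ∀ ξ : T →ₗ[ℝ] ℝ, ∃ b : T, ∀ (F : T →ₗ[ℝ] ℝ) (a : T), (∀ x, F x ≤ ‖x‖) → F a = 1 →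
      ‖a‖ = 1 → F b = -K * ξ a) :
    ∀ x y : T, ‖x + y‖ * ‖x + y‖ + ‖x - y‖ * ‖x - y‖ = 2 * (‖x‖ * ‖x‖ + ‖y‖ * ‖y‖) := by
  have hdual : ∀ a : T, ‖a‖ = 1 → ∃ F : T →ₗ[ℝ] ℝ, (∀ x, F x ≤ ‖x‖) ∧ F a = 1 := by
    intro a ha
    obtain ⟨g, hg1, hg2⟩ := exists_dual_vector ℝ a (by rw [ha]; norm_num)
    refine ⟨g, fun x => ?_, by simp [hg2, ha]⟩
    have := g.le_opNorm x
    rw [hg1, one_mul, Real.norm_eq_abs] at this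
    simpa using (le_abs_self _).trans this
  have hnorm : ∀ x : T, x ≠ 0 → ‖(‖x‖⁻¹ • x)‖ = 1 := by
    intro x hx
    rw [norm_smul, norm_inv, norm_norm]; exact inv_mul_cancel₀ (norm_ne_zero_iff.2 hx)
  have huniq : ∀ b : T, (∀ (F : T →ₗ[ℝ] ℝ) (a : T), (∀ x, F x ≤ ‖x‖) → F a = 1 → ‖a‖ = 1 → F b = 0)
      → b = 0 := by
    intro b hb
    by_contra hb0
    obtain ⟨F, hF, hFa⟩ := hdual _ (hnorm b hb0)
    have := hb F _ hF hFa (hnorm b hb0)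
    rw [map_smul, this] at hFa
    simp at hFa
  choose b hb using H
  let Λ : (T →ₗ[ℝ] ℝ) →ₗ[ℝ] T :=
    { toFun := b
      map_add' := fun ξ ζ => by
        rw [← sub_eq_zero]
        apply huniq
        intro F a hF hFa ha
        rw [map_sub, map_add, hb _ F a hF hFa ha, hb _ F a hF hFa ha, hb _ F a hF hFa ha]
        simp; ring
      map_smul' := fun r ξ => by
        rw [← sub_eq_zero]
        apply huniq
        intro F a hF hFa ha
        rw [map_sub, RingHom.id_apply, map_smul, hb _ F a hF hFa ha, hb _ F a hF hFa ha]
        simp; ring }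
  have hinj : Function.Injective Λ := by
    rw [injective_iff_map_eq_zero]
    intro ξ hξ
    ext x
    by_cases hx : x = 0
    · simp [hx]
    obtain ⟨F, hF, hFa⟩ := hdual _ (hnorm x hx)
    have h1 := hb ξ F _ hF hFa (hnorm x hx)
    have h2 : b ξ = 0 := hξ
    rw [h2, map_zero, map_smul] at h1
    have h3 : (‖x‖⁻¹ : ℝ) ≠ 0 := inv_ne_zero (norm_ne_zero_iff.2 hx)
    simp only [smul_eq_mul] at h1
    have h4 : ‖x‖⁻¹ * ξ x = 0 := by
      have := hK.ne'
      by_contra hne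
      exact absurd h1.symm (mul_ne_zero (neg_ne_zero.2 this) hne)
    rcases mul_eq_zero.1 h4 with h5 | h5
    · exact absurd h5 h3
    · simpa using h5
  let Λ' := LinearEquiv.ofInjectiveOfFinrankEq Λ hinj (by
    exact Subspace.dual_finrank_eq)
  have hsq : ∀ x : T, ‖x‖ * ‖x‖ = -K * (Λ'.symm x) x := by
    intro x
    by_cases hx : x = 0
    · simp [hx]
    have hxn : ‖x‖ ≠ 0 := norm_ne_zero_iff.2 hx
    obtain ⟨F, hF, hFa⟩ := hdual _ (hnorm x hx)
    have h1 := hb (Λ'.symm x) F _ hF hFa (hnorm x hx)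
    have h2 : b (Λ'.symm x) = x := Λ'.apply_symm_apply x
    rw [h2, map_smul] at h1
    rw [map_smul] at hFa
    simp only [smul_eq_mul] at h1 hFa
    have h3 : F x = ‖x‖ := by
      field_simp at hFa; linarith
    rw [h3] at h1
    field_simp at h1
    linarith
  intro x y
  rw [hsq, hsq, hsq, hsq]
  simp only [map_add, map_sub, LinearMap.add_apply, LinearMap.sub_apply]
  ring

theorem fpt_core2 {T : Type*} [NormedAddCommGroup T] [NormedSpace ℝ T] (hT : finrank ℝ T = 2)
    (h : ℝ → ℝ) (μ : ℝ) (hμ0 : 0 < μ) (hμ1 : μ < 1)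
    (hc : ConcaveOn ℝ (Icc (-1) 1) h) (heven : ∀ z, |z| ≤ 1 → h (-z) = h z)
    (h0 : h 0 = 1) (hlow : ∀ z, |z| ≤ 1 → 1 - |z| ≤ h z) (hle1 : ∀ z, |z| ≤ 1 → h z ≤ 1)
    (husc : ∀ r, (∀ z, 0 ≤ z → z < 1 → r ≤ h z) → r ≤ h 1)
    (H : ∀ ξ : T →ₗ[ℝ] ℝ, ∃ c : T, ∀ y, |μ + ξ y| ≤ 1 → ‖y‖ ≤ h (μ + ξ y) →
      |μ + ξ ((2:ℝ) • c - y)| ≤ 1 ∧ ‖(2:ℝ) • c - y‖ ≤ h (μ + ξ ((2:ℝ) • c - y))) :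
    (∀ x y : T, ‖x + y‖ * ‖x + y‖ + ‖x - y‖ * ‖x - y‖ = 2 * (‖x‖ * ‖x‖ + ‖y‖ * ‖y‖)) ∧
      ∀ z, |z| ≤ 1 → h z ^ 2 = 1 - z ^ 2 := by
  have : FiniteDimensional ℝ T := FiniteDimensional.of_finrank_pos (by omega)
  have hnn : ∀ z, |z| ≤ 1 → 0 ≤ h z := fun z hz => le_trans (by linarith) (hlow z hz)
  have hlt := fpt_hmu hT h μ hμ0 hμ1 hle1 hlow H
  obtain ⟨k, hk0, hk⟩ := fpt_kappa h μ hμ0 hμ1 hc h0 hlt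
  have hHpos : 0 < h μ := by
    have := hlow μ (by rw [abs_of_pos hμ0]; exact hμ1.le)
    rw [abs_of_pos hμ0] at this
    linarith
  have hpar := fpt_par (T := T) (k * h μ) (by positivity) (fun ξ =>
    fpt_bxi h μ k hμ0 hμ1 hc hle1 hnn hk ξ (fun η => by
      obtain ⟨c, hc⟩ := H (η • ξ)
      exact ⟨c, by simpa using hc⟩))
  refine ⟨hpar, ?_⟩
  letI : InnerProductSpace ℝ T := InnerProductSpace.ofNorm ℝ hpar
  have B := (stdOrthonormalBasis ℝ T).reindex (finCongr hT)
  have hns : ∀ y : T, ‖y‖ ^ 2 = inner ℝ (B 0) y ^ 2 + inner ℝ (B 1) y ^ 2 := by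
    intro y
    rw [← B.sum_sq_norm_inner_right y, Fin.sum_univ_two]
    simp
  have hB := B.orthonormal
  have h00 : inner ℝ (B 0) (B 0) = (1:ℝ) := by simp
  have h11 : inner ℝ (B 1) (B 1) = (1:ℝ) := by simp
  have h01 : inner ℝ (B 0) (B 1) = (0:ℝ) := hB.2 (by decide)
  have h10 : inner ℝ (B 1) (B 0) = (0:ℝ) := hB.2 (by decide)
  apply fpt_core3 h μ hμ0 hμ1 hc heven h0 hlow husc
  intro ε hε
  obtain ⟨c, hcc⟩ := H ((1 / ε) • (innerₗ T (B 1)))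
  set C := μ + inner ℝ (B 1) c / ε with hC
  have step : ∀ z, |z| ≤ 1 → 0 ≤ h z ^ 2 - ε ^ 2 * (z - μ) ^ 2 → |2 * C - z| ≤ 1 ∧
      h z ^ 2 - ε ^ 2 * (z - μ) ^ 2 ≤ h (2 * C - z) ^ 2 - ε ^ 2 * (2 * C - z - μ) ^ 2 := by
    intro z hz hr
    set r := h z ^ 2 - ε ^ 2 * (z - μ) ^ 2 with hrd
    have gen : ∀ x : ℝ, x ^ 2 = r → |2 * C - z| ≤ 1 ∧
        (2 * inner ℝ (B 0) c - x) ^ 2 + ε ^ 2 * (2 * C - z - μ) ^ 2 ≤ h (2 * C - z) ^ 2 := by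
      intro x hx
      set y := x • B 0 + (ε * (z - μ)) • B 1 with hy
      have i0 : inner ℝ (B 0) y = x := by
        rw [hy, inner_add_right, inner_smul_right, inner_smul_right, h00, h01]; ring
      have i1 : inner ℝ (B 1) y = ε * (z - μ) := by
        rw [hy, inner_add_right, inner_smul_right, inner_smul_right, h10, h11]; ring
      have e1 : μ + ((1 / ε) • (innerₗ T (B 1))) y = z := by
        simp only [LinearMap.smul_apply, innerₗ_apply_apply, smul_eq_mul, i1]
        field_simp; ring
      have j0 : inner ℝ (B 0) ((2:ℝ) • c - y) = 2 * inner ℝ (B 0) c - x := by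
        rw [inner_sub_right, inner_smul_right, i0]
      have j1 : inner ℝ (B 1) ((2:ℝ) • c - y) = ε * (2 * C - z - μ) := by
        rw [inner_sub_right, inner_smul_right, i1, hC]; field_simp; ring
      have e2 : μ + ((1 / ε) • (innerₗ T (B 1))) ((2:ℝ) • c - y) = 2 * C - z := by
        simp only [LinearMap.smul_apply, innerₗ_apply_apply, smul_eq_mul, j1]
        field_simp; ring
      have := hcc y (by rw [e1]; exact hz) (by
        rw [e1]
        apply (sq_le_sq₀ (norm_nonneg _) (hnn z hz)).1
        rw [hns, i0, i1, hx, hrd]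
        apply le_of_eq; ring)
      rw [e2] at this
      refine ⟨this.1, ?_⟩
      have h5 := pow_le_pow_left₀ (norm_nonneg _) this.2 2
      rw [hns, j0, j1] at h5
      linarith
    have g1 := gen (Real.sqrt r) (Real.sq_sqrt hr)
    have g2 := gen (-Real.sqrt r) (by rw [neg_sq]; exact Real.sq_sqrt hr)
    refine ⟨g1.1, ?_⟩
    have := Real.sq_sqrt hr
    nlinarith [g1.2, g2.2, sq_nonneg (inner ℝ (B 0) c : ℝ)]
  refine ⟨C, fun z hz hr => ?_⟩
  obtain ⟨s1, s2⟩ := step z hz hr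
  obtain ⟨s3, s4⟩ := step (2 * C - z) s1 (hr.trans s2)
  have e3 : 2 * C - (2 * C - z) = z := by ring
  rw [e3] at s4
  exact ⟨s1, le_antisymm s4 s2⟩

end

section

theorem fpt_finrank_pair {E : Type*} [AddCommGroup E] [Module ℝ E] (x y : E)
    (h : ∀ a b : ℝ, a • x + b • y = 0 → a = 0 ∧ b = 0) :
    finrank ℝ (Submodule.span ℝ {x, y}) = 2 := by
  have hl : LinearIndependent ℝ ![x, y] := LinearIndependent.pair_iff.2 h
  have := finrank_span_eq_card hl
  rw [Matrix.range_cons, Matrix.range_cons, Matrix.range_empty, union_empty, singleton_union] at this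
  simpa using this

/-- A functional in the subdifferential at `e` is nonnegative at the section centres. -/
theorem fpt_fc {E : Type*} [NormedAddCommGroup E] [NormedSpace ℝ E] [FiniteDimensional ℝ E]
    (e : E) (μ : ℝ) (he : ‖e‖ = 1) (hμ0 : 0 < μ) (hμ1 : μ < 1) (D : Submodule ℝ E) (c : E)
    (hcD : c - μ • e ∈ D)
    (hc : ∀ X, X - μ • e ∈ D → ‖X‖ ≤ 1 → ‖(2:ℝ) • c - X‖ ≤ 1)
    (f : E →ₗ[ℝ] ℝ) (hf : ∀ x, f x ≤ ‖x‖) (hfe : f e = 1) : 0 ≤ f c := by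
  have : ProperSpace E := FiniteDimensional.proper ℝ E
  have hfcont : Continuous f := LinearMap.continuous_of_finiteDimensional f
  have hS : IsCompact {X : E | X - μ • e ∈ D ∧ ‖X‖ ≤ 1} := by
    have h1 : IsClosed {X : E | X - μ • e ∈ D} :=
      (Submodule.closed_of_finiteDimensional D).preimage (by fun_prop : Continuous fun X : E => X - μ • e)
    have h2 := (isCompact_closedBall (0:E) 1).inter_left h1
    convert h2 using 1
    ext X; simp
  obtain ⟨X, ⟨hXD, hX1⟩, hmax⟩ := hS.exists_isMaxOn ⟨μ • e, by simp, by
    rw [norm_smul, he, Real.norm_of_nonneg hμ0.le]; linarith⟩ hfcont.continuousOn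
  set t := 2 * μ / (1 + μ) with ht
  have ht' : t * (1 + μ) = 2 * μ := by rw [ht]; field_simp
  have ht0 : 0 < t := by positivity
  have ht1 : t < 1 := by rw [ht, div_lt_one (by linarith)]; linarith
  have hm := hmax (show (1 - t) • (X - (2:ℝ) • c) + t • e ∈ {X : E | X - μ • e ∈ D ∧ ‖X‖ ≤ 1} from ⟨by
      have : (1 - t) • (X - (2:ℝ) • c) + t • e - μ • e
        = (1 - t) • ((X - μ • e) - (2:ℝ) • (c - μ • e)) := by
        have h2 : t = μ * 2 - t * μ := by linarith
        match_scalars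
        · ring
        · ring
        · linear_combination ht'
      rw [this]
      exact D.smul_mem _ (D.sub_mem hXD (D.smul_mem _ hcD)), by
      calc _ ≤ ‖(1 - t) • (X - (2:ℝ) • c)‖ + ‖t • e‖ := norm_add_le _ _
        _ = (1 - t) * ‖(2:ℝ) • c - X‖ + t := by
          rw [norm_smul, norm_smul, he, Real.norm_of_nonneg (by linarith), Real.norm_of_nonneg ht0.le,
            norm_sub_rev, mul_one]
        _ ≤ _ := by nlinarith [hc X hXD hX1]⟩)
  simp only [mem_ofPred_eq, map_add, map_smul, map_sub, smul_eq_mul, hfe] at hm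
  have := (hf X).trans hX1
  by_contra hneg
  push Not at hneg
  nlinarith [mul_pos (sub_pos.2 ht1) (neg_pos.2 hneg)]

theorem fpt_B1 {E : Type*} [NormedAddCommGroup E] [NormedSpace ℝ E] [FiniteDimensional ℝ E]
    (e : E) (μ : ℝ) (he : ‖e‖ = 1) (hμ0 : 0 < μ) (hμ1 : μ < 1)
    (H : ∀ D : Submodule ℝ E, finrank ℝ D = 2 → ∃ c, c - μ • e ∈ D ∧
      ∀ X, X - μ • e ∈ D → ‖X‖ ≤ 1 → ‖(2:ℝ) • c - X‖ ≤ 1)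
    (w q : E) (hind : ∀ x y z : ℝ, x • e + y • w + z • q = 0 → x = 0 ∧ y = 0 ∧ z = 0) :
    ∃ v, v + q ∈ Submodule.span ℝ {e, w} ∧
      (∀ a ∈ Submodule.span ℝ {e, w}, ∀ s : ℝ, ‖a‖ ≤ ‖a + s • v‖) ∧
      ∀ f : E →ₗ[ℝ] ℝ, (∀ x, f x ≤ ‖x‖) → f e = 1 → 0 ≤ f v := by
  have : ProperSpace E := FiniteDimensional.proper ℝ E
  set P := Submodule.span ℝ {e, w} with hP
  have hPc : IsClosed (P : Set E) := Submodule.closed_of_finiteDimensional P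
  obtain ⟨α, hαe, hαw⟩ : ∃ α : E →ₗ[ℝ] ℝ, α e = 1 ∧ α w = 0 := by
    have hn : e ∉ Submodule.span ℝ {w} := by
      intro hmem
      obtain ⟨r, hr⟩ := Submodule.mem_span_singleton.1 hmem
      have := (hind 1 (-r) 0 (by rw [← hr]; module)).1
      norm_num at this
    obtain ⟨f, hf1, hf2⟩ := Submodule.exists_le_ker_of_notMem hn
    refine ⟨(f e)⁻¹ • f, by simp [hf1], ?_⟩
    have : f w = 0 := hf2 (Submodule.mem_span_singleton_self w)
    simp [this]
  obtain ⟨A, hA0, hA⟩ : ∃ A > 0, ∀ y, |α y| ≤ A * ‖y‖ := by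
    refine ⟨‖LinearMap.toContinuousLinearMap α‖ + 1, by positivity, fun y => ?_⟩
    have := (LinearMap.toContinuousLinearMap α).le_opNorm y
    rw [Real.norm_eq_abs] at this
    simp only [LinearMap.coe_toContinuousLinearMap'] at this
    nlinarith [norm_nonneg y]
  set Q := ‖q‖ with hQ
  have hQ0 : 0 ≤ Q := norm_nonneg q
  -- section centres
  have HC : ∀ ε : ℝ, ∃ c ∈ P, (∀ y ∈ P, ‖y + (ε * (α y - μ)) • q‖ ≤ 1 →
      ‖((2:ℝ) • (c + (ε * (α c - μ)) • q)) - (y + (ε * (α y - μ)) • q)‖ ≤ 1) ∧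
      ∀ f : E →ₗ[ℝ] ℝ, (∀ x, f x ≤ ‖x‖) → f e = 1 → 0 ≤ f (c + (ε * (α c - μ)) • q) := by
    intro ε
    set D := Submodule.span ℝ {e + ε • q, w} with hD
    have hDr : finrank ℝ D = 2 := by
      apply fpt_finrank_pair
      intro a b hab
      have := hind a b (a * ε) (by rw [← hab]; module)
      exact ⟨this.1, this.2.1⟩
    obtain ⟨c, hcD, hc⟩ := H D hDr
    obtain ⟨a, b, hab⟩ := Submodule.mem_span_pair.1 hcD
    have hy : ∀ y ∈ P, y + (ε * (α y - μ)) • q - μ • e ∈ D := by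
      intro y hyP
      obtain ⟨s, r, rfl⟩ := Submodule.mem_span_pair.1 hyP
      refine Submodule.mem_span_pair.2 ⟨s - μ, r, ?_⟩
      simp only [map_add, map_smul, hαe, hαw, smul_eq_mul]
      module
    have hα : α ((a + μ) • e + b • w) = a + μ := by simp [hαe, hαw]
    have hc' : (a + μ) • e + b • w + (ε * (α ((a + μ) • e + b • w) - μ)) • q = c := by
      rw [hα]
      have : c = a • (e + ε • q) + b • w + μ • e := by rw [hab]; abel
      rw [this]; module
    refine ⟨(a + μ) • e + b • w, Submodule.mem_span_pair.2 ⟨_, _, rfl⟩, ?_, ?_⟩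
    · rw [hc']
      intro y hyP hy1
      exact hc _ (hy y hyP) hy1
    · rw [hc']
      exact fun f hf hfe => fpt_fc e μ he hμ0 hμ1 D c hcD hc f hf hfe
  choose c hcP hcc hcf using HC
  set R := (A + 1) * Q with hR
  have hR0 : 0 ≤ R := by positivity
  -- bound on c
  set C1 := R + (4 * A + 1) * Q with hC1
  have hcO : ∀ ε, 0 < ε → ε * R ≤ 1 → ε * (A * Q) ≤ 1/2 → ε * Q ≤ 1 → ‖c ε‖ ≤ C1 * ε := by
    intro ε hε h1 h2 h3
    by_cases hc0 : c ε = 0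
    · rw [hc0, norm_zero]; positivity
    have hcn : 0 < ‖c ε‖ := norm_pos_iff.2 hc0
    set l := (1 - ε * R) / ‖c ε‖ with hl
    have hl0 : 0 ≤ l := div_nonneg (by linarith) hcn.le
    have hlc : l * ‖c ε‖ = 1 - ε * R := by rw [hl]; field_simp
    set y := -(l • c ε) with hy
    have hyP : y ∈ P := P.neg_mem (P.smul_mem _ (hcP ε))
    have hyn : ‖y‖ = 1 - ε * R := by rw [hy, norm_neg, norm_smul, Real.norm_of_nonneg hl0, hlc]
    have hy1 : ‖y + (ε * (α y - μ)) • q‖ ≤ 1 := by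
      calc _ ≤ ‖y‖ + ‖(ε * (α y - μ)) • q‖ := norm_add_le _ _
        _ = 1 - ε * R + ε * |α y - μ| * Q := by
          rw [hyn, norm_smul, Real.norm_eq_abs, abs_mul, abs_of_pos hε]
        _ ≤ 1 - ε * R + ε * (A + 1) * Q := by
          have : |α y - μ| ≤ A + 1 := by
            have h5 := hA y
            have h6 : |α y - μ| ≤ |α y| + |μ| := abs_sub _ _
            rw [abs_of_pos hμ0] at h6
            have : A * ‖y‖ ≤ A * 1 := by
              apply mul_le_mul_of_nonneg_left _ hA0.le
              rw [hyn]; nlinarith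
            linarith
          gcongr
        _ = 1 := by rw [hR]; ring
    have h4 := hcc ε y hyP hy1
    set N := ‖(2:ℝ) • c ε - y‖ with hN
    have hNe : N = 2 * ‖c ε‖ + (1 - ε * R) := by
      have : (2:ℝ) • c ε - y = (2 + l) • c ε := by rw [hy]; module
      rw [hN, this, norm_smul, Real.norm_of_nonneg (by linarith)]
      linarith
    have hN1 : N ≤ 1 + ε * (A * N + 1) * Q := by
      have e1 : (2:ℝ) • c ε - y = ((2:ℝ) • (c ε + (ε * (α (c ε) - μ)) • q) - (y + (ε * (α y - μ)) • q))
          - (ε * (α ((2:ℝ) • c ε - y) - μ)) • q := by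
        simp only [map_sub, map_smul, smul_eq_mul]
        module
      have hb := norm_sub_le ((2:ℝ) • (c ε + (ε * (α (c ε) - μ)) • q) - (y + (ε * (α y - μ)) • q))
          ((ε * (α ((2:ℝ) • c ε - y) - μ)) • q)
      rw [← e1] at hb
      calc N ≤ _ := hb
        _ ≤ 1 + ε * |α ((2:ℝ) • c ε - y) - μ| * Q := by
          refine add_le_add h4 (le_of_eq ?_)
          rw [norm_smul, Real.norm_eq_abs, abs_mul, abs_of_pos hε]
        _ ≤ _ := by
          have : |α ((2:ℝ) • c ε - y) - μ| ≤ A * N + 1 := by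
            have h5 := hA ((2:ℝ) • c ε - y)
            have h6 : |α ((2:ℝ) • c ε - y) - μ| ≤ |α ((2:ℝ) • c ε - y)| + |μ| := abs_sub _ _
            rw [abs_of_pos hμ0] at h6
            linarith
          gcongr
    have hN0 : 0 ≤ N := norm_nonneg _
    have hN4 : N ≤ 4 := by nlinarith
    have : ε * (A * N + 1) * Q ≤ ε * (A * 4 + 1) * Q := by gcongr
    rw [hC1]; nlinarith
  -- sequence
  set d : ℕ → ℝ := fun n => 1 / ((n : ℝ) + 1) with hd
  have hdpos : ∀ n, 0 < d n := fun n => by positivity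
  have hdt : Filter.Tendsto d Filter.atTop (nhds 0) := tendsto_one_div_add_atTop_nhds_zero_nat
  have hdt' : ∀ B r : ℝ, 0 < r → ∀ᶠ n in Filter.atTop, d n * B < r := by
    intro B r hr
    have h1 : Filter.Tendsto (fun n => d n * B) Filter.atTop (nhds 0) := by
      simpa using hdt.mul_const B
    exact h1.eventually (gt_mem_nhds hr)
  have hev : ∀ᶠ n in Filter.atTop, d n * R ≤ 1 ∧ d n * (A * Q) ≤ 1/2 ∧ d n * Q ≤ 1 ∧
      d n * ((2 * A + 1) * Q) ≤ 1 := by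
    filter_upwards [hdt' R 1 one_pos, hdt' (A * Q) (1/2) (by norm_num), hdt' Q 1 one_pos,
      hdt' ((2 * A + 1) * Q) 1 one_pos] with n h1 h2 h3 h4
    exact ⟨h1.le, h2.le, h3.le, h4.le⟩
  obtain ⟨N, hN⟩ := Filter.eventually_atTop.1 hev
  set e' : ℕ → ℝ := fun n => d (n + N) with he'
  have he'pos : ∀ n, 0 < e' n := fun n => hdpos _
  have he't : Filter.Tendsto e' Filter.atTop (nhds 0) :=
    hdt.comp (Filter.tendsto_add_atTop_nat N)
  have hO : ∀ n, ‖c (e' n)‖ ≤ C1 * e' n := fun n => by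
    obtain ⟨h1, h2, h3, -⟩ := hN (n + N) (by omega)
    exact hcO _ (he'pos n) h1 h2 h3
  obtain ⟨u, -, φ, hφ, hlim⟩ := (isCompact_closedBall (0:E) C1).tendsto_subseq
    (x := fun n => (e' n)⁻¹ • c (e' n)) (fun n => by
      rw [mem_closedBall_zero_iff, norm_smul, norm_inv, Real.norm_of_nonneg (he'pos n).le,
        inv_mul_le_iff₀ (he'pos n), mul_comm]
      exact hO n)
  set η : ℕ → ℝ := fun n => e' (φ n) with hη
  have hηpos : ∀ n, 0 < η n := fun n => he'pos _
  have hηt : Filter.Tendsto η Filter.atTop (nhds 0) := he't.comp hφ.tendsto_atTop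
  have huP : u ∈ P := hPc.mem_of_tendsto hlim
    (Filter.Eventually.of_forall fun n => P.smul_mem _ (hcP _))
  have hct : Filter.Tendsto (fun n => c (η n)) Filter.atTop (nhds 0) := by
    refine squeeze_zero_norm (a := fun n => C1 * η n) (fun n => hO _) ?_
    simpa using hηt.const_mul C1
  have hαcont : Continuous α := LinearMap.continuous_of_finiteDimensional α
  set cc : ℕ → E := fun n => c (η n) + (η n * (α (c (η n)) - μ)) • q with hccd
  have hvlim : Filter.Tendsto (fun n => (η n)⁻¹ • cc n) Filter.atTop (nhds (u - μ • q)) := by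
    have h1 : Filter.Tendsto (fun n => α (c (η n))) Filter.atTop (nhds 0) := by
      have := (hαcont.tendsto 0).comp hct
      rw [map_zero] at this
      exact this
    have h2 : Filter.Tendsto (fun n => (η n)⁻¹ • c (η n) + (α (c (η n)) - μ) • q) Filter.atTop
        (nhds (u + (0 - μ) • q)) := hlim.add ((h1.sub_const μ).smul_const q)
    have e1 : u + (0 - μ) • q = u - μ • q := by module
    rw [e1] at h2
    refine h2.congr fun n => ?_
    rw [hccd]
    simp only [smul_add, smul_smul]
    rw [← mul_assoc, inv_mul_cancel₀ (hηpos n).ne', one_mul]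
  set v := u - μ • q with hv
  -- positive direction
  have pos1 : ∀ a ∈ P, ‖a‖ = 1 → ∀ s : ℝ, 0 < s → 1 ≤ ‖a + s • v‖ := by
    intro a haP ha s hs
    by_contra hlt
    push Not at hlt
    have hαa : |α a| ≤ A := by simpa [ha] using hA a
    have IVT : ∀ n, ∃ t, 1 - η n * R ≤ t ∧ t ≤ 1 + η n * ((2 * A + 1) * Q) ∧
        ‖t • a + (η n * (α (t • a) - μ)) • q‖ = 1 := by
      intro n
      obtain ⟨h1, h2, h3, h4⟩ := hN (φ n + N) (by omega)
      change η n * R ≤ 1 at h1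
      change η n * ((2 * A + 1) * Q) ≤ 1 at h4
      have hε := hηpos n
      set ε := η n
      have hcont : ContinuousOn (fun t : ℝ => ‖t • a + (ε * (α (t • a) - μ)) • q‖)
          (Icc (1 - ε * R) (1 + ε * ((2 * A + 1) * Q))) := by
        apply Continuous.continuousOn
        apply Continuous.norm
        apply Continuous.add (by fun_prop)
        apply Continuous.smul _ continuous_const
        apply Continuous.mul continuous_const
        apply Continuous.sub _ continuous_const
        exact hαcont.comp (by fun_prop)
      have hle : 1 - ε * R ≤ 1 + ε * ((2 * A + 1) * Q) := by
        have : 0 ≤ ε * R := by positivity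
        have : 0 ≤ ε * ((2 * A + 1) * Q) := by positivity
        linarith
      have hq : ∀ t, ‖(ε * (α (t • a) - μ)) • q‖ ≤ ε * (A * |t| + 1) * Q := by
        intro t
        rw [norm_smul, Real.norm_eq_abs, abs_mul, abs_of_pos hε]
        have : |α (t • a) - μ| ≤ A * |t| + 1 := by
          have h6 : |α (t • a) - μ| ≤ |α (t • a)| + |μ| := abs_sub _ _
          have h7 := hA (t • a)
          rw [norm_smul, ha, mul_one, Real.norm_eq_abs] at h7
          rw [abs_of_pos hμ0] at h6
          linarith
        gcongr
      have := intermediate_value_Icc hle hcont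
      obtain ⟨t, ht, ht2⟩ := this (show (1:ℝ) ∈ Icc _ _ from ⟨by
        refine (norm_add_le _ _).trans ?_
        have h8 := hq (1 - ε * R)
        rw [norm_smul, ha, Real.norm_eq_abs, abs_of_nonneg (by linarith)]
        rw [abs_of_nonneg (by linarith)] at h8
        have : ε * (A * (1 - ε * R) + 1) * Q ≤ ε * (A * 1 + 1) * Q := by
          have : 0 ≤ ε * R := by positivity
          gcongr
          linarith
        have e3 : ε * (A * 1 + 1) * Q = ε * R := by rw [hR]; ring
        linarith, by
        have h8 := hq (1 + ε * ((2 * A + 1) * Q))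
        have hp : 0 ≤ ε * ((2 * A + 1) * Q) := by positivity
        rw [abs_of_nonneg (by linarith)] at h8
        have h9 := norm_sub_le_norm_add ((1 + ε * ((2 * A + 1) * Q)) • a)
          ((ε * (α ((1 + ε * ((2 * A + 1) * Q)) • a) - μ)) • q)
        refine le_trans ?_ h9
        rw [norm_smul, ha, Real.norm_eq_abs, abs_of_nonneg (by linarith)]
        have : ε * (A * (1 + ε * ((2 * A + 1) * Q)) + 1) * Q ≤ ε * (A * (1 + 1) + 1) * Q := by
          gcongr
        have e3 : ε * (A * (1 + 1) + 1) * Q = ε * ((2 * A + 1) * Q) := by ring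
        linarith⟩)
      exact ⟨t, ht.1, ht.2, ht2⟩
    choose t ht1 ht2 ht3 using IVT
    have htt : Filter.Tendsto t Filter.atTop (nhds 1) := by
      refine tendsto_of_tendsto_of_tendsto_of_le_of_le (g := fun n => 1 - η n * R)
        (h := fun n => 1 + η n * ((2 * A + 1) * Q)) ?_ ?_ ht1 ht2
      · simpa using (hηt.mul_const R).const_sub 1
      · simpa using (hηt.mul_const ((2 * A + 1) * Q)).const_add 1
    set X : ℕ → E := fun n => t n • a + (η n * (α (t n • a) - μ)) • q with hX
    have hXt : Filter.Tendsto X Filter.atTop (nhds a) := by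
      have h1 : Filter.Tendsto (fun n => t n • a) Filter.atTop (nhds ((1:ℝ) • a)) :=
        htt.smul_const a
      have h2 : Filter.Tendsto (fun n => α (t n • a)) Filter.atTop (nhds (α ((1:ℝ) • a))) :=
        (hαcont.tendsto _).comp h1
      have h3 := h1.add ((hηt.mul (h2.sub_const μ)).smul_const q)
      have e4 : (1:ℝ) • a + (0 * (α ((1:ℝ) • a) - μ)) • q = a := by simp
      rw [e4] at h3
      exact h3
    have hZ : Filter.Tendsto (fun n => ‖X n + s • ((η n)⁻¹ • cc n)‖) Filter.atTop
        (nhds ‖a + s • v‖) := (hXt.add (hvlim.const_smul s)).norm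
    obtain ⟨n, hn⟩ := (hZ.eventually (gt_mem_nhds hlt)).exists
    have hY : ‖X n - (2:ℝ) • cc n‖ ≤ 1 := by
      rw [norm_sub_rev]
      exact hcc (η n) (t n • a) (P.smul_mem _ haP) (ht3 n).le
    have hX1 : ‖X n‖ = 1 := ht3 n
    set r := s * (η n)⁻¹ with hr
    have hr0 : 0 < r := mul_pos hs (inv_pos.2 (hηpos n))
    rw [smul_smul] at hn
    have hcomb : (2 + r) • X n = r • (X n - (2:ℝ) • cc n) + (2:ℝ) • (X n + r • cc n) := by
      module
    have h1 : ‖(2 + r) • X n‖ ≤ r * ‖X n - (2:ℝ) • cc n‖ + 2 * ‖X n + r • cc n‖ := by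
      rw [hcomb]
      refine (norm_add_le _ _).trans ?_
      rw [norm_smul, norm_smul, Real.norm_of_nonneg hr0.le, Real.norm_of_nonneg (by norm_num)]
    rw [norm_smul, hX1, Real.norm_of_nonneg (by linarith)] at h1
    nlinarith
  have all1 : ∀ a ∈ P, ‖a‖ = 1 → ∀ s : ℝ, 1 ≤ ‖a + s • v‖ := by
    intro a haP ha s
    rcases lt_trichotomy s 0 with h1 | h1 | h1
    · have := pos1 (-a) (P.neg_mem haP) (by rwa [norm_neg]) (-s) (by linarith)
      rw [neg_smul, ← neg_add, norm_neg] at this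
      exact this
    · rw [h1]; simp [ha]
    · exact pos1 a haP ha s h1
  have all2 : ∀ a ∈ P, ∀ s : ℝ, ‖a‖ ≤ ‖a + s • v‖ := by
    intro a haP s
    by_cases ha0 : a = 0
    · rw [ha0]; simp
    have han : 0 < ‖a‖ := norm_pos_iff.2 ha0
    have := all1 (‖a‖⁻¹ • a) (P.smul_mem _ haP) (by
      rw [norm_smul, norm_inv, norm_norm]; field_simp) (‖a‖⁻¹ * s)
    rw [mul_smul, ← smul_add, norm_smul, norm_inv, norm_norm, le_inv_mul_iff₀ han, mul_one] at this
    exact this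
  refine ⟨μ⁻¹ • v, ?_, ?_, ?_⟩
  · have : μ⁻¹ • v + q = μ⁻¹ • u := by
      rw [hv, smul_sub, smul_smul, inv_mul_cancel₀ hμ0.ne']; simp
    rw [this]
    exact P.smul_mem _ huP
  · intro a haP s
    rw [smul_smul]
    exact all2 a haP _
  · intro f hf hfe
    rw [map_smul, smul_eq_mul]
    apply mul_nonneg (by positivity)
    have hfcont : Continuous f := LinearMap.continuous_of_finiteDimensional f
    refine ge_of_tendsto ((hfcont.tendsto v).comp hvlim) (Filter.Eventually.of_forall fun n => ?_)
    simp only [Function.comp, map_smul, smul_eq_mul]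
    exact mul_nonneg (inv_pos.2 (hηpos n)).le (hcf (η n) f hf hfe)

end

section

theorem fpt_span3 {E : Type*} [AddCommGroup E] [Module ℝ E] (hE : finrank ℝ E = 3) (e w q : E)
    (hind : ∀ x y z : ℝ, x • e + y • w + z • q = 0 → x = 0 ∧ y = 0 ∧ z = 0) (u : E) :
    ∃ x y z : ℝ, u = x • e + y • w + z • q := by
  have : FiniteDimensional ℝ E := FiniteDimensional.of_finrank_pos (by omega)
  have hl : LinearIndependent ℝ ![e, w, q] := by
    rw [Fintype.linearIndependent_iff]
    intro g hg
    simp only [Fin.sum_univ_three, Matrix.cons_val_zero, Matrix.cons_val_one, Matrix.cons_val] at hg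
    have := hind _ _ _ hg
    intro i
    fin_cases i
    · exact this.1
    · exact this.2.1
    · exact this.2.2
  have := hl.span_eq_top_of_card_eq_finrank (by simp [hE])
  have hu : u ∈ Submodule.span ℝ (Set.range ![e, w, q]) := by rw [this]; trivial
  rw [Submodule.mem_span_range_iff_exists_fun] at hu
  obtain ⟨c, hc⟩ := hu
  simp only [Fin.sum_univ_three, Matrix.cons_val_zero, Matrix.cons_val_one, Matrix.cons_val] at hc
  exact ⟨_, _, _, hc.symm⟩

theorem fpt_third {E : Type*} [AddCommGroup E] [Module ℝ E] (hE : finrank ℝ E = 3) (e w : E)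
    (hind : ∀ x y : ℝ, x • e + y • w = 0 → x = 0 ∧ y = 0) :
    ∃ q : E, ∀ x y z : ℝ, x • e + y • w + z • q = 0 → x = 0 ∧ y = 0 ∧ z = 0 := by
  have : FiniteDimensional ℝ E := FiniteDimensional.of_finrank_pos (by omega)
  have h2 := fpt_finrank_pair e w hind
  have hne : Submodule.span ℝ {e, w} ≠ ⊤ := by
    intro h; rw [h, finrank_top, hE] at h2; omega
  obtain ⟨q, hq⟩ : ∃ q, q ∉ Submodule.span ℝ {e, w} := by
    by_contra hcon
    push Not at hcon
    exact hne (by rw [eq_top_iff]; exact fun x _ => hcon x)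
  refine ⟨q, fun x y z h => ?_⟩
  have hz : z = 0 := by
    by_contra hz
    apply hq
    rw [Submodule.mem_span_pair]
    refine ⟨-(x / z), -(y / z), ?_⟩
    have : q = z⁻¹ • (z • q) := by rw [smul_smul, inv_mul_cancel₀ hz, one_smul]
    have h3 : z • q = -(x • e + y • w) := by rw [eq_neg_iff_add_eq_zero, add_comm]; exact h
    rw [this, h3]
    module
  rw [hz, zero_smul, add_zero] at h
  exact ⟨(hind x y h).1, (hind x y h).2, hz⟩

/-- extension of functionals along the direction `v` -/
theorem fpt_ext {E : Type*} [NormedAddCommGroup E] [NormedSpace ℝ E] (hE : finrank ℝ E = 3)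
    (e w q v : E) (hind : ∀ x y z : ℝ, x • e + y • w + z • q = 0 → x = 0 ∧ y = 0 ∧ z = 0)
    (hvq : v + q ∈ Submodule.span ℝ {e, w})
    (hv : ∀ a ∈ Submodule.span ℝ {e, w}, ∀ s : ℝ, ‖a‖ ≤ ‖a + s • v‖)
    (f : E →ₗ[ℝ] ℝ) (hf : ∀ x, f x ≤ ‖x‖) (hfe : f e = 1) :
    ∃ F : E →ₗ[ℝ] ℝ, (∀ x, F x ≤ ‖x‖) ∧ F e = 1 ∧ F w = f w ∧ F v = 0 := by
  obtain ⟨a, b, hab⟩ := Submodule.mem_span_pair.1 hvq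
  have hvn : v ∉ Submodule.span ℝ {e, w} := by
    intro h
    obtain ⟨a', b', hab'⟩ := Submodule.mem_span_pair.1 h
    have := (hind (a' - a) (b' - b) 1 (by
      have : q = a • e + b • w - (a' • e + b' • w) := by rw [hab, hab']; abel
      rw [this]; module)).2.2
    norm_num at this
  obtain ⟨σ, hσv, hσ⟩ := Submodule.exists_le_ker_of_notMem hvn
  have hσe : σ e = 0 := hσ (Submodule.subset_span (by simp))
  have hσw : σ w = 0 := hσ (Submodule.subset_span (by simp))
  refine ⟨f - (f v / σ v) • σ, ?_, ?_, ?_, ?_⟩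
  · intro x
    obtain ⟨x1, x2, x3, hx⟩ := fpt_span3 hE e w q hind x
    have hq : q = a • e + b • w - v := by rw [hab]; abel
    have hx' : x = ((x1 + x3 * a) • e + (x2 + x3 * b) • w) + (-x3) • v := by
      rw [hx, hq]; module
    have h1 := hv _ (Submodule.mem_span_pair.2 ⟨x1 + x3 * a, x2 + x3 * b, rfl⟩) (-x3)
    have h2 := hf ((x1 + x3 * a) • e + (x2 + x3 * b) • w)
    rw [← hx'] at h1
    have h3 : (f - (f v / σ v) • σ) x = f ((x1 + x3 * a) • e + (x2 + x3 * b) • w) := by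
      rw [hx']
      simp only [LinearMap.sub_apply, LinearMap.smul_apply, map_add, map_smul, hσe, hσw, smul_eq_mul]
      field_simp
      ring
    rw [h3]; linarith
  · simp [hσe, hfe]
  · simp [hσw]
  · simp [hσv]

theorem fpt_extremal {E : Type*} [NormedAddCommGroup E] [NormedSpace ℝ E] [FiniteDimensional ℝ E]
    (e : E) (f f' : E →ₗ[ℝ] ℝ) (hf : ∀ x, f x ≤ ‖x‖) (hfe : f e = 1)
    (hf' : ∀ x, f' x ≤ ‖x‖) (hfe' : f' e = 1) (hne : f ≠ f') :
    ∃ (f1 f2 : E →ₗ[ℝ] ℝ) (w : E), (∀ x, f1 x ≤ ‖x‖) ∧ f1 e = 1 ∧ (∀ x, f2 x ≤ ‖x‖) ∧ f2 e = 1 ∧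
      f1 w ≠ f2 w ∧
      (∀ g : E →ₗ[ℝ] ℝ, (∀ x, g x ≤ ‖x‖) → g e = 1 → g w = f1 w → g = f1) ∧
      (∀ g : E →ₗ[ℝ] ℝ, (∀ x, g x ≤ ‖x‖) → g e = 1 → g w = f2 w → g = f2) := by
  let b := Module.finBasis ℝ E
  let G : (Fin (finrank ℝ E) → ℝ) ≃ₗ[ℝ] (E →ₗ[ℝ] ℝ) := b.constr ℝ
  have hGb : ∀ g i, G g (b i) = g i := fun g i => b.constr_basis ℝ g i
  set J : Set (Fin (finrank ℝ E) → ℝ) := {g | (∀ x, G g x ≤ ‖x‖) ∧ G g e = 1} with hJ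
  have hGc : ∀ x, Continuous fun g => G g x := by
    intro x
    exact LinearMap.continuous_of_finiteDimensional ((LinearMap.applyₗ x).comp G.toLinearMap)
  have hJc : IsCompact J := by
    apply Metric.isCompact_of_isClosed_isBounded
    · have : J = (⋂ x, {g | G g x ≤ ‖x‖}) ∩ {g | G g e = 1} := by
        ext g; simp [hJ]
      rw [this]
      exact (isClosed_iInter fun x => isClosed_le (hGc x) continuous_const).inter
        (isClosed_eq (hGc e) continuous_const)
    · refine (Metric.isBounded_closedBall (x := (0 : Fin (finrank ℝ E) → ℝ))
        (r := ∑ i, ‖b i‖)).subset ?_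
      intro g hg
      rw [mem_closedBall_zero_iff, pi_norm_le_iff_of_nonneg (by positivity)]
      intro i
      have h1 := hg.1 (b i)
      have h2 := hg.1 (-(b i))
      rw [map_neg, norm_neg] at h2
      rw [hGb] at h1 h2
      have h3 : ‖b i‖ ≤ ∑ i, ‖b i‖ :=
        Finset.single_le_sum (f := fun i => ‖b i‖) (fun i _ => norm_nonneg _) (Finset.mem_univ i)
      rw [Real.norm_eq_abs, abs_le]
      constructor <;> linarith
  have hmem : ∀ g : E →ₗ[ℝ] ℝ, (∀ x, g x ≤ ‖x‖) → g e = 1 → G.symm g ∈ J := by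
    intro g h1 h2
    simp only [hJ, mem_ofPred_eq, LinearEquiv.apply_symm_apply]
    exact ⟨h1, h2⟩
  obtain ⟨⟨g1, g2⟩, ⟨hg1, hg2⟩, hmax⟩ := (hJc.prod hJc).exists_isMaxOn
    (f := fun x : (Fin (finrank ℝ E) → ℝ) × (Fin (finrank ℝ E) → ℝ) => ∑ i, (x.1 i - x.2 i) ^ 2)
    ⟨(G.symm f, G.symm f'), hmem f hf hfe, hmem f' hf' hfe'⟩ (by fun_prop)
  have hmax' : ∀ a ∈ J, ∀ c ∈ J, ∑ i, (a i - c i) ^ 2 ≤ ∑ i, (g1 i - g2 i) ^ 2 :=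
    fun a ha c hc => hmax (show (a, c) ∈ J ×ˢ J from ⟨ha, hc⟩)
  set w : E := ∑ i, (g1 i - g2 i) • b i with hw
  have hGw : ∀ g, G g w = ∑ i, (g1 i - g2 i) * g i := by
    intro g
    rw [hw, map_sum]
    simp only [map_smul, hGb, smul_eq_mul]
  have hzero : ∀ a : Fin (finrank ℝ E) → ℝ, ∑ i, a i ^ 2 ≤ 0 → a = 0 := by
    intro a ha
    have h0 := le_antisymm ha (Finset.sum_nonneg fun i _ => sq_nonneg (a i))
    rw [Finset.sum_eq_zero_iff_of_nonneg (fun i _ => sq_nonneg (a i))] at h0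
    ext i
    simpa using h0 i (Finset.mem_univ i)
  refine ⟨G g1, G g2, w, hg1.1, hg1.2, hg2.1, hg2.2, ?_, ?_, ?_⟩
  · intro heq
    rw [hGw, hGw] at heq
    have h1 : ∑ i, (g1 i - g2 i) ^ 2 = 0 := by
      have : ∑ i, (g1 i - g2 i) ^ 2 = ∑ i, (g1 i - g2 i) * g1 i - ∑ i, (g1 i - g2 i) * g2 i := by
        rw [← Finset.sum_sub_distrib]
        exact Finset.sum_congr rfl fun i _ => by ring
      rw [this, heq, sub_self]
    have h2 := hmax' _ (hmem f hf hfe) _ (hmem f' hf' hfe')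
    rw [h1] at h2
    have h3 := hzero (G.symm f - G.symm f') (by simpa using h2)
    exact hne (G.symm.injective (sub_eq_zero.1 h3))
  · intro g h1 h2 h3
    have hg := hmem g h1 h2
    have e1 : G (G.symm g) = g := G.apply_symm_apply g
    set a := G.symm g
    rw [← e1, hGw, hGw] at h3
    have h4 := hmax' a hg g2 hg2
    have h5 : ∑ i, (a i - g2 i) ^ 2 = ∑ i, (g1 i - g2 i) ^ 2 + ∑ i, (a i - g1 i) ^ 2
        + 2 * (∑ i, (g1 i - g2 i) * a i - ∑ i, (g1 i - g2 i) * g1 i) := by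
      rw [← Finset.sum_sub_distrib, Finset.mul_sum, ← Finset.sum_add_distrib, ← Finset.sum_add_distrib]
      exact Finset.sum_congr rfl fun i _ => by ring
    have h6 := hzero (a - g1) (by simp only [Pi.sub_apply]; linarith)
    rw [← e1, sub_eq_zero.1 h6]
  · intro g h1 h2 h3
    have hg := hmem g h1 h2
    have e1 : G (G.symm g) = g := G.apply_symm_apply g
    set a := G.symm g
    rw [← e1, hGw, hGw] at h3
    have h4 := hmax' g1 hg1 a hg
    have h5 : ∑ i, (g1 i - a i) ^ 2 = ∑ i, (g1 i - g2 i) ^ 2 + ∑ i, (a i - g2 i) ^ 2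
        - 2 * (∑ i, (g1 i - g2 i) * a i - ∑ i, (g1 i - g2 i) * g2 i) := by
      rw [← Finset.sum_sub_distrib, Finset.mul_sum, ← Finset.sum_add_distrib, ← Finset.sum_sub_distrib]
      exact Finset.sum_congr rfl fun i _ => by ring
    have h6 := hzero (a - g2) (by simp only [Pi.sub_apply]; linarith)
    rw [← e1, sub_eq_zero.1 h6]

theorem fpt_B2 {E : Type*} [NormedAddCommGroup E] [NormedSpace ℝ E] (hE : finrank ℝ E = 3)
    (e : E) (μ : ℝ) (he : ‖e‖ = 1) (hμ0 : 0 < μ) (hμ1 : μ < 1)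
    (H : ∀ D : Submodule ℝ E, finrank ℝ D = 2 → ∃ c, c - μ • e ∈ D ∧
      ∀ X, X - μ • e ∈ D → ‖X‖ ≤ 1 → ‖(2:ℝ) • c - X‖ ≤ 1)
    (f f' : E →ₗ[ℝ] ℝ) (hf : ∀ x, f x ≤ ‖x‖) (hfe : f e = 1)
    (hf' : ∀ x, f' x ≤ ‖x‖) (hfe' : f' e = 1) : f = f' := by
  have : FiniteDimensional ℝ E := FiniteDimensional.of_finrank_pos (by omega)
  by_contra hne
  obtain ⟨f1, f2, w, h1, h1e, h2, h2e, hw, hu1, hu2⟩ := fpt_extremal e f f' hf hfe hf' hfe' hne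
  have he0 : e ≠ 0 := by rintro rfl; simp at he
  have hew : ∀ x y : ℝ, x • e + y • w = 0 → x = 0 ∧ y = 0 := by
    intro x y h
    have k1 := congrArg f1 h
    have k2 := congrArg f2 h
    simp only [map_add, map_smul, h1e, h2e, smul_eq_mul, mul_one, map_zero] at k1 k2
    have hy : y * (f1 w - f2 w) = 0 := by linarith
    have hy0 : y = 0 := (mul_eq_zero.1 hy).resolve_right (sub_ne_zero.2 hw)
    rw [hy0] at k1
    exact ⟨by linarith, hy0⟩
  have zero_of : ∀ x y : ℝ, x + y * f1 w = 0 → x + y * f2 w = 0 → x = 0 ∧ y = 0 := by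
    intro x y k1 k2
    have hy : y * (f1 w - f2 w) = 0 := by linarith
    have hy0 : y = 0 := (mul_eq_zero.1 hy).resolve_right (sub_ne_zero.2 hw)
    rw [hy0] at k1
    exact ⟨by linarith, hy0⟩
  obtain ⟨q, hq⟩ := fpt_third hE e w hew
  obtain ⟨v, hv1, hv2, hv3⟩ := fpt_B1 e μ he hμ0 hμ1 H w q hq
  have hq' : ∀ x y z : ℝ, x • e + y • w + z • (-q) = 0 → x = 0 ∧ y = 0 ∧ z = 0 := by
    intro x y z h
    have := hq x y (-z) (by rw [← h]; module)
    exact ⟨this.1, this.2.1, by linarith [this.2.2]⟩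
  obtain ⟨u, hu1', hu2', hu3'⟩ := fpt_B1 e μ he hμ0 hμ1 H w (-q) hq'
  have kill : ∀ (q v : E) (hq : ∀ x y z : ℝ, x • e + y • w + z • q = 0 → x = 0 ∧ y = 0 ∧ z = 0)
      (_ : v + q ∈ Submodule.span ℝ {e, w})
      (_ : ∀ a ∈ Submodule.span ℝ {e, w}, ∀ s : ℝ, ‖a‖ ≤ ‖a + s • v‖), f1 v = 0 ∧ f2 v = 0 := by
    intro q v hq k1 k2
    obtain ⟨F, hF1, hF2, hF3, hF4⟩ := fpt_ext hE e w q v hq k1 k2 f1 h1 h1e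
    obtain ⟨F', hF1', hF2', hF3', hF4'⟩ := fpt_ext hE e w q v hq k1 k2 f2 h2 h2e
    exact ⟨by rw [← hu1 F hF1 hF2 hF3]; exact hF4, by rw [← hu2 F' hF1' hF2' hF3']; exact hF4'⟩
  obtain ⟨v10, v20⟩ := kill q v hq hv1 hv2
  obtain ⟨u10, u20⟩ := kill (-q) u hq' hu1' hu2'
  have huv : u = -v := by
    have hsum := Submodule.add_mem _ hv1 hu1'
    have e1 : v + q + (u + -q) = v + u := by abel
    rw [e1] at hsum
    obtain ⟨x, y, hxy⟩ := Submodule.mem_span_pair.1 hsum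
    have k1 := congrArg f1 hxy
    have k2 := congrArg f2 hxy
    simp only [map_add, map_smul, h1e, h2e, smul_eq_mul, mul_one, v10, u10, v20, u20, add_zero] at k1 k2
    obtain ⟨rfl, rfl⟩ := zero_of x y k1 k2
    rw [zero_smul, zero_smul, zero_add] at hxy
    rw [eq_neg_iff_add_eq_zero, add_comm]; exact hxy.symm
  have hv0 : ∀ g : E →ₗ[ℝ] ℝ, (∀ x, g x ≤ ‖x‖) → g e = 1 → g v = 0 := by
    intro g g1 g2
    have k1 := hv3 g g1 g2
    have k2 := hu3' g g1 g2
    rw [huv, map_neg] at k2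
    linarith
  obtain ⟨a, b, hab⟩ := Submodule.mem_span_pair.1 hv1
  have hqv : q = a • e + b • w - v := by rw [hab]; abel
  have hvind : ∀ x y z : ℝ, x • e + y • w + z • v = 0 → x = 0 ∧ y = 0 ∧ z = 0 := by
    intro x y z h
    have hvq : v = a • e + b • w - q := by rw [hab]; abel
    have := hq (x + z * a) (y + z * b) (-z) (by rw [← h, hvq]; module)
    have hz : z = 0 := by linarith [this.2.2]
    rw [hz] at this
    exact ⟨by linarith [this.1], by linarith [this.2.1], hz⟩
  have hvne : v ≠ 0 := by
    rintro rfl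
    have := (hvind 0 0 1 (by simp)).2.2
    norm_num at this
  -- perturbation
  have hpert : ∀ r s : ℝ, ‖w + r • v‖ ≤ ‖w + r • v + s • v‖ := by
    intro r s
    have hind' : ∀ x y z : ℝ, x • e + y • (w + r • v) + z • v = 0 → x = 0 ∧ y = 0 ∧ z = 0 := by
      intro x y z h
      have := hvind x y (z + y * r) (by rw [← h]; module)
      refine ⟨this.1, this.2.1, ?_⟩
      have h3 := this.2.2
      rw [this.2.1] at h3
      linarith
    obtain ⟨v', k1, k2, -⟩ := fpt_B1 e μ he hμ0 hμ1 H (w + r • v) v hind'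
    obtain ⟨F, hF1, hF2, hF3, hF4⟩ := fpt_ext hE e _ v v' hind' k1 k2 f1 h1 h1e
    obtain ⟨F', hF1', hF2', hF3', hF4'⟩ := fpt_ext hE e _ v v' hind' k1 k2 f2 h2 h2e
    rw [map_add, map_smul, hv0 F hF1 hF2, map_add, map_smul, hv0 f1 h1 h1e] at hF3
    rw [map_add, map_smul, hv0 F' hF1' hF2', map_add, map_smul, hv0 f2 h2 h2e] at hF3'
    simp only [smul_zero, add_zero] at hF3 hF3'
    have z1 : f1 v' = 0 := by rw [← hu1 F hF1 hF2 hF3]; exact hF4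
    have z2 : f2 v' = 0 := by rw [← hu2 F' hF1' hF2' hF3']; exact hF4'
    obtain ⟨x, y, hxy⟩ := Submodule.mem_span_pair.1 k1
    have m1 := congrArg f1 hxy
    have m2 := congrArg f2 hxy
    simp only [map_add, map_smul, h1e, h2e, smul_eq_mul, mul_one, v10, v20, z1, z2, add_zero,
      mul_zero] at m1 m2
    obtain ⟨rfl, rfl⟩ := zero_of x y m1 m2
    rw [zero_smul, zero_smul, zero_add] at hxy
    have hv' : v' = -v := by rw [eq_neg_iff_add_eq_zero]; exact hxy.symm
    have := k2 (w + r • v) (Submodule.subset_span (by simp)) (-s)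
    rw [hv', smul_neg, neg_smul, neg_neg] at this
    exact this
  have hbd : ∀ r : ℝ, ‖w + r • v‖ ≤ ‖w‖ := by
    intro r
    have := hpert r (-r)
    have e1 : w + r • v + (-r) • v = w := by module
    rwa [e1] at this
  have hvn : 0 < ‖v‖ := norm_pos_iff.2 hvne
  have h3 := hbd ((2 * ‖w‖ + 1) / ‖v‖)
  have h4 : ‖((2 * ‖w‖ + 1) / ‖v‖) • v‖ = 2 * ‖w‖ + 1 := by
    rw [norm_smul, Real.norm_of_nonneg (by positivity)]; field_simp
  have h5 := norm_sub_le (w + ((2 * ‖w‖ + 1) / ‖v‖) • v) w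
  rw [add_sub_cancel_left, h4] at h5
  linarith

end

section

theorem fpt_tel {E : Type*} [NormedAddCommGroup E] [NormedSpace ℝ E] (e : E) (T : Submodule ℝ E)
    (Hv : ∀ w ∈ T, w ≠ 0 → ∃ v : E, (∀ d ∈ T, ∃ s r : ℝ, d = s • w + r • v) ∧
      ∀ α β s : ℝ, ‖α • e + β • w‖ ≤ ‖α • e + β • w + s • v‖)
    (w w' : E) (hw : w ∈ T) (hw' : w' ∈ T) (hn : ‖w‖ = 1) (hn' : ‖w'‖ = 1)
    (hind : ∀ x y : ℝ, x • w + y • w' = 0 → x = 0 ∧ y = 0) (α : ℝ) :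
    ‖α • e + w‖ ≤ ‖α • e + w'‖ := by
  set W : ℝ → E := fun t => w + t • (w' - w) with hW
  have hWT : ∀ t, W t ∈ T := fun t => T.add_mem hw (T.smul_mem _ (T.sub_mem hw' hw))
  have hW0 : ∀ t, W t ≠ 0 := by
    intro t h
    have := hind (1 - t) t (by rw [← h, hW]; module)
    linarith [this.1, this.2]
  have hWc : Continuous fun t => ‖W t‖ := by rw [hW]; fun_prop
  obtain ⟨t0, ht0, hmin⟩ := (isCompact_Icc (a := (0:ℝ)) (b := 1)).exists_isMinOn ⟨0, by simp⟩
    hWc.continuousOn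
  set k0 := ‖W t0‖ with hk0
  have hk0pos : 0 < k0 := norm_pos_iff.2 (hW0 t0)
  have hk : ∀ t, 0 ≤ t → t ≤ 1 → k0 ≤ ‖W t‖ := fun t h1 h2 => hmin ⟨h1, h2⟩
  -- derivative data
  have hs : ∀ t, ∃ s : ℝ, (∀ a δ : ℝ, ‖a • e + (1 + δ * s) • W t‖ ≤ ‖a • e + W (t + δ)‖) ∧
      |s| * ‖W t‖ ≤ ‖w' - w‖ := by
    intro t
    obtain ⟨v, hv1, hv2⟩ := Hv (W t) (hWT t) (hW0 t)
    obtain ⟨s, r, hd⟩ := hv1 (w' - w) (T.sub_mem hw' hw)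
    refine ⟨s, ?_, ?_⟩
    · intro a δ
      have e1 : a • e + W (t + δ) = a • e + (1 + δ * s) • W t + (δ * r) • v := by
        have : W (t + δ) = W t + δ • (w' - w) := by rw [hW]; module
        rw [this, hd]; module
      rw [e1]
      exact hv2 _ _ _
    · have := hv2 0 s r
      rw [zero_smul, zero_add, ← hd, norm_smul, Real.norm_eq_abs] at this
      exact this
  choose s hs1 hs2 using hs
  set S := ‖w' - w‖ / k0 with hS
  have hS0 : 0 ≤ S := by positivity
  have hsS : ∀ t, 0 ≤ t → t ≤ 1 → |s t| ≤ S := by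
    intro t h1 h2
    rw [hS, le_div_iff₀ hk0pos]
    refine le_trans ?_ (hs2 t)
    exact mul_le_mul_of_nonneg_left (hk t h1 h2) (abs_nonneg _)
  set M : ℝ → ℝ := fun t => ‖α • e + ‖W t‖⁻¹ • W t‖ with hM
  have step : ∀ t δ, 0 ≤ t → 0 < δ → t + δ ≤ 1 → δ * S ≤ 1 →
      M t - (δ * (s (t + δ) - s t) + δ ^ 2 * S ^ 2) ≤ M (t + δ) := by
    intro t δ ht hδ htδ hδS
    have hkt : 0 < ‖W t‖ := norm_pos_iff.2 (hW0 t)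
    have hkd : 0 < ‖W (t + δ)‖ := norm_pos_iff.2 (hW0 (t + δ))
    set k := ‖W t‖ with hkdef
    set k' := ‖W (t + δ)‖ with hkdef'
    have b1 := hsS t ht (by linarith)
    have b2 := hsS (t + δ) (by linarith) htδ
    have c1 : |δ * s t| ≤ 1 := by
      rw [abs_mul, abs_of_pos hδ]; exact (mul_le_mul_of_nonneg_left b1 hδ.le).trans hδS
    have c2 : |δ * s (t + δ)| ≤ 1 := by
      rw [abs_mul, abs_of_pos hδ]; exact (mul_le_mul_of_nonneg_left b2 hδ.le).trans hδS
    have p1 : 0 ≤ 1 + δ * s t := by linarith [(abs_le.1 c1).1]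
    have p2 : 0 ≤ 1 - δ * s (t + δ) := by linarith [(abs_le.1 c2).2]
    -- k' ≥ (1+δ s_t) k
    have d1 : (1 + δ * s t) * k ≤ k' := by
      have := hs1 t 0 δ
      rw [zero_smul, zero_add, zero_add, norm_smul, Real.norm_of_nonneg p1] at this
      exact this
    have d2 : (1 - δ * s (t + δ)) * k' ≤ k := by
      have := hs1 (t + δ) 0 (-δ)
      rw [zero_smul, zero_add, zero_add, norm_smul, add_neg_cancel_right] at this
      have e1 : 1 + -δ * s (t + δ) = 1 - δ * s (t + δ) := by ring
      rw [e1, Real.norm_of_nonneg p2] at this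
      exact this
    set ρ := (1 + δ * s t) * k / k' with hρ
    have ρ1 : ρ ≤ 1 := by rw [hρ, div_le_one hkd]; exact d1
    have ρ2 : (1 + δ * s t) * (1 - δ * s (t + δ)) ≤ ρ := by
      rw [hρ, le_div_iff₀ hkd, mul_assoc]
      exact mul_le_mul_of_nonneg_left d2 p1
    have m1 : ‖α • e + ρ • (k⁻¹ • W t)‖ ≤ M (t + δ) := by
      have h1 := hs1 t (α * k') δ
      have h2 : ‖k'⁻¹ • ((α * k') • e + (1 + δ * s t) • W t)‖ ≤ ‖k'⁻¹ • ((α * k') • e + W (t + δ))‖ := by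
        rw [norm_smul, norm_smul]
        exact mul_le_mul_of_nonneg_left h1 (norm_nonneg _)
      have e1 : k'⁻¹ • ((α * k') • e + (1 + δ * s t) • W t) = α • e + ρ • (k⁻¹ • W t) := by
        rw [hρ]
        generalize W t = x
        match_scalars
        · field_simp
        · field_simp
      have e2 : k'⁻¹ • ((α * k') • e + W (t + δ)) = α • e + k'⁻¹ • W (t + δ) := by
        generalize W (t + δ) = x
        match_scalars
        · field_simp
        · field_simp
      rw [e1, e2] at h2
      exact h2
    have m2 : M t ≤ ‖α • e + ρ • (k⁻¹ • W t)‖ + (1 - ρ) := by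
      have e1 : α • e + k⁻¹ • W t = (α • e + ρ • (k⁻¹ • W t)) + (1 - ρ) • (k⁻¹ • W t) := by module
      have e2 : ‖(1 - ρ) • (k⁻¹ • W t)‖ = 1 - ρ := by
        rw [norm_smul, norm_smul, Real.norm_of_nonneg (by linarith), norm_inv,
          Real.norm_of_nonneg hkt.le, ← hkdef, inv_mul_cancel₀ hkt.ne', mul_one]
      calc M t = ‖α • e + k⁻¹ • W t‖ := rfl
        _ ≤ _ := by rw [e1]; exact (norm_add_le _ _).trans (by rw [e2])
    have m3 : s t * s (t + δ) ≤ S ^ 2 := by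
      have : |s t * s (t + δ)| ≤ S * S := by
        rw [abs_mul]; exact mul_le_mul b1 b2 (abs_nonneg _) hS0
      nlinarith [le_abs_self (s t * s (t + δ))]
    nlinarith [mul_le_mul_of_nonneg_left m3 (sq_nonneg δ)]
  have tele : ∀ δ : ℝ, 0 < δ → δ * S ≤ 1 → ∀ n : ℕ, (n : ℝ) * δ ≤ 1 →
      M 0 - (δ * (s (n * δ) - s 0) + n * δ ^ 2 * S ^ 2) ≤ M (n * δ) := by
    intro δ hδ hδS n
    induction n with
    | zero => intro _; simp
    | succ n ih =>
      intro hn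
      push_cast at hn ⊢
      have e1 : ((n:ℝ) + 1) * δ = n * δ + δ := by ring
      rw [e1] at hn ⊢
      have h1 := ih (by linarith)
      have h2 := step (n * δ) δ (by positivity) hδ hn hδS
      linarith
  have M0 : M 0 = ‖α • e + w‖ := by simp [hM, hW, hn]
  have M1 : M 1 = ‖α • e + w'‖ := by simp [hM, hW, hn']
  rw [← M0, ← M1]
  have hlim : Filter.Tendsto (fun n : ℕ => M 0 - (2 * S + S ^ 2) * (1 / ((n : ℝ) + 1))) Filter.atTop
      (nhds (M 0 - (2 * S + S ^ 2) * 0)) :=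
    (tendsto_one_div_add_atTop_nhds_zero_nat.const_mul _).const_sub _
  rw [mul_zero, sub_zero] at hlim
  have hev : ∀ᶠ n : ℕ in Filter.atTop, 1 / ((n : ℝ) + 1) * S < 1 := by
    have : Filter.Tendsto (fun n : ℕ => 1 / ((n : ℝ) + 1) * S) Filter.atTop (nhds (0 * S)) :=
      tendsto_one_div_add_atTop_nhds_zero_nat.mul_const S
    rw [zero_mul] at this
    exact this.eventually (gt_mem_nhds one_pos)
  refine le_of_tendsto hlim ?_
  filter_upwards [hev] with n hn
  have hδ : 0 < 1 / ((n : ℝ) + 1) := by positivity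
  have e1 : ((n + 1 : ℕ) : ℝ) * (1 / ((n : ℝ) + 1)) = 1 := by push_cast; field_simp
  have := tele (1 / ((n : ℝ) + 1)) hδ hn.le (n + 1) (by rw [e1])
  rw [e1] at this
  refine le_trans ?_ this
  have b1 := abs_le.1 (hsS 0 le_rfl zero_le_one)
  have b2 := abs_le.1 (hsS 1 zero_le_one le_rfl)
  have e2 : ((n + 1 : ℕ) : ℝ) * (1 / ((n : ℝ) + 1)) ^ 2 * S ^ 2 = S ^ 2 * (1 / ((n : ℝ) + 1)) := by
    rw [pow_two, ← mul_assoc, e1]; ring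
  rw [e2]
  nlinarith

end

section

theorem fpt_Hv {E : Type*} [NormedAddCommGroup E] [NormedSpace ℝ E] (hE : finrank ℝ E = 3)
    (e : E) (μ : ℝ) (he : ‖e‖ = 1) (hμ0 : 0 < μ) (hμ1 : μ < 1)
    (H : ∀ D : Submodule ℝ E, finrank ℝ D = 2 → ∃ c, c - μ • e ∈ D ∧
      ∀ X, X - μ • e ∈ D → ‖X‖ ≤ 1 → ‖(2:ℝ) • c - X‖ ≤ 1)
    (f : E →ₗ[ℝ] ℝ) (hf : ∀ x, f x ≤ ‖x‖) (hfe : f e = 1) (w : E) (hw : f w = 0) (hw0 : w ≠ 0) :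
    ∃ v : E, f v = 0 ∧ v ≠ 0 ∧ (∀ d, f d = 0 → ∃ s r : ℝ, d = s • w + r • v) ∧
      ∀ α β s : ℝ, ‖α • e + β • w‖ ≤ ‖α • e + β • w + s • v‖ := by
  have : FiniteDimensional ℝ E := FiniteDimensional.of_finrank_pos (by omega)
  have hew : ∀ x y : ℝ, x • e + y • w = 0 → x = 0 ∧ y = 0 := by
    intro x y h
    have k1 := congrArg f h
    simp only [map_add, map_smul, smul_eq_mul, hfe, hw, map_zero] at k1
    have hx : x = 0 := by linarith
    rw [hx, zero_smul, zero_add] at h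
    exact ⟨hx, (smul_eq_zero.1 h).resolve_right hw0⟩
  obtain ⟨q, hq⟩ := fpt_third hE e w hew
  obtain ⟨v, hvq, hv, -⟩ := fpt_B1 e μ he hμ0 hμ1 H w q hq
  obtain ⟨F, hF, hFe, -, hFv⟩ := fpt_ext hE e w q v hq hvq hv f hf hfe
  have hFf := fpt_B2 hE e μ he hμ0 hμ1 H F f hF hFe hf hfe
  rw [hFf] at hFv
  obtain ⟨a, b, hab⟩ := Submodule.mem_span_pair.1 hvq
  refine ⟨v, hFv, ?_, ?_, ?_⟩
  · rintro rfl
    have := (hq a b (-1) (by rw [hab]; module)).2.2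
    norm_num at this
  · intro d hd
    obtain ⟨x, y, z, hxyz⟩ := fpt_span3 hE e w q hq d
    have hqq : q = a • e + b • w - v := by rw [hab]; abel
    have hfq : f q = a := by rw [hqq]; simp [hfe, hw, hFv]
    have h0 : x + z * a = 0 := by
      rw [← hd, hxyz]; simp [hfe, hw, hfq]
    refine ⟨y + z * b, -z, ?_⟩
    have hx : x = - (z * a) := by linarith
    rw [hxyz, hqq, hx]
    module
  · intro α β s
    exact hv _ (Submodule.mem_span_pair.2 ⟨α, β, rfl⟩) s

theorem fpt_B3 {E : Type*} [NormedAddCommGroup E] [NormedSpace ℝ E] (hE : finrank ℝ E = 3)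
    (e : E) (μ : ℝ) (he : ‖e‖ = 1) (hμ0 : 0 < μ) (hμ1 : μ < 1)
    (H : ∀ D : Submodule ℝ E, finrank ℝ D = 2 → ∃ c, c - μ • e ∈ D ∧
      ∀ X, X - μ • e ∈ D → ‖X‖ ≤ 1 → ‖(2:ℝ) • c - X‖ ≤ 1)
    (f : E →ₗ[ℝ] ℝ) (hf : ∀ x, f x ≤ ‖x‖) (hfe : f e = 1) (w w' : E) (hw : f w = 0)
    (hw' : f w' = 0) (hn : ‖w‖ = 1) (hn' : ‖w'‖ = 1) (α : ℝ) :
    ‖α • e + w‖ ≤ ‖α • e + w'‖ := by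
  have Hv := fpt_Hv hE e μ he hμ0 hμ1 H f hf hfe
  have tel : ∀ w w' : E, f w = 0 → f w' = 0 → ‖w‖ = 1 → ‖w'‖ = 1 →
      (∀ x y : ℝ, x • w + y • w' = 0 → x = 0 ∧ y = 0) → ‖α • e + w‖ ≤ ‖α • e + w'‖ := by
    intro w w' hw hw' hn hn' hind
    refine fpt_tel e (LinearMap.ker f) ?_ w w' hw hw' hn hn' hind α
    intro w hw hw0
    obtain ⟨v, -, -, h1, h2⟩ := Hv w hw hw0
    exact ⟨v, fun d hd => h1 d hd, h2⟩
  by_cases hind : ∀ x y : ℝ, x • w + y • w' = 0 → x = 0 ∧ y = 0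
  · exact tel w w' hw hw' hn hn' hind
  have hw0 : w ≠ 0 := by rintro rfl; simp at hn
  have hdep : ∃ c : ℝ, w' = c • w := by
    push Not at hind
    obtain ⟨x, y, h, hxy⟩ := hind
    by_cases hy : y = 0
    · rw [hy, zero_smul, add_zero] at h
      exact absurd hy (hxy ((smul_eq_zero.1 h).resolve_right hw0))
    · refine ⟨-(x / y), ?_⟩
      have : y • w' = -(x • w) := by rw [eq_neg_iff_add_eq_zero, add_comm]; exact h
      calc w' = y⁻¹ • (y • w') := by rw [smul_smul, inv_mul_cancel₀ hy, one_smul]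
        _ = _ := by rw [this, smul_neg, smul_smul, neg_smul]; congr 2; ring
  obtain ⟨c, hc⟩ := hdep
  have hc1 : |c| = 1 := by
    rw [hc, norm_smul, hn, mul_one] at hn'; exact hn'
  rcases (abs_eq zero_le_one).1 hc1 with h | h
  · rw [hc, h, one_smul]
  rw [h] at hc
  have hc' : w' = -w := by rw [hc]; simp
  obtain ⟨v, hv, hv0, h1, h2⟩ := Hv w hw hw0
  have hvn : ‖v‖ ≠ 0 := norm_ne_zero_iff.2 hv0
  have hwv : ∀ x y : ℝ, x • w + y • v = 0 → x = 0 ∧ y = 0 := by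
    intro x y hh
    have k := h2 0 x y
    rw [zero_smul, zero_add, hh, norm_zero, norm_smul, hn, mul_one] at k
    have hx : x = 0 := abs_eq_zero.1 (le_antisymm k (abs_nonneg _))
    rw [hx, zero_smul, zero_add] at hh
    exact ⟨hx, (smul_eq_zero.1 hh).resolve_right hv0⟩
  set u := ‖v‖⁻¹ • v with hu
  have hun : ‖u‖ = 1 := by rw [hu, norm_smul, norm_inv, norm_norm, inv_mul_cancel₀ hvn]
  have hfu : f u = 0 := by rw [hu, map_smul, hv, smul_zero]
  refine (tel w u hw hfu hn hun ?_).trans (tel u w' hfu hw' hun hn' ?_)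
  · intro x y hh
    have := hwv x (y * ‖v‖⁻¹) (by rw [mul_smul]; exact hh)
    exact ⟨this.1, (mul_eq_zero.1 this.2).resolve_right (inv_ne_zero hvn)⟩
  · intro x y hh
    have := hwv (-y) (x * ‖v‖⁻¹) (by rw [mul_smul, ← hu, ← hh, hc']; module)
    exact ⟨(mul_eq_zero.1 this.2).resolve_right (inv_ne_zero hvn), by linarith [this.1]⟩

theorem fpt_core {E : Type*} [NormedAddCommGroup E] [NormedSpace ℝ E] (hE : finrank ℝ E = 3)
    (e : E) (μ : ℝ) (he : ‖e‖ = 1) (hμ0 : 0 < μ) (hμ1 : μ < 1)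
    (H : ∀ D : Submodule ℝ E, finrank ℝ D = 2 → ∃ c, c - μ • e ∈ D ∧
      ∀ X, X - μ • e ∈ D → ‖X‖ ≤ 1 → ‖(2:ℝ) • c - X‖ ≤ 1) (x y : E) :
    ‖x + y‖ * ‖x + y‖ + ‖x - y‖ * ‖x - y‖ = 2 * (‖x‖ * ‖x‖ + ‖y‖ * ‖y‖) := by
  have : FiniteDimensional ℝ E := FiniteDimensional.of_finrank_pos (by omega)
  have he0 : e ≠ 0 := by rintro rfl; simp at he
  obtain ⟨f, hf, hfe⟩ : ∃ f : E →ₗ[ℝ] ℝ, (∀ x, f x ≤ ‖x‖) ∧ f e = 1 := by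
    obtain ⟨g, hg1, hg2⟩ := exists_dual_vector ℝ e (norm_ne_zero_iff.2 he0)
    refine ⟨g.toLinearMap, fun x => ?_, ?_⟩
    · have := g.le_opNorm x
      rw [hg1, one_mul] at this
      exact (le_abs_self _).trans this
    · show g e = 1
      rw [hg2, he]; simp
  have B3 := fpt_B3 hE e μ he hμ0 hμ1 H f hf hfe
  set T := LinearMap.ker f with hTd
  have hT : finrank ℝ T = 2 := by
    have h1 := LinearMap.finrank_range_add_finrank_ker f
    have h2 : LinearMap.range f = ⊤ := LinearMap.range_eq_top.2 (fun r => ⟨r • e, by simp [hfe]⟩)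
    rw [h2, finrank_top, hE, finrank_self, ← hTd] at h1
    omega
  obtain ⟨u1, hu1⟩ : ∃ u : T, u ≠ 0 := by
    have : Nontrivial T := Module.nontrivial_of_finrank_pos (R := ℝ) (by omega)
    exact exists_ne 0
  have hu1' : ‖(u1 : E)‖ ≠ 0 := by
    rw [norm_ne_zero_iff]; exact fun h => hu1 (Subtype.ext h)
  obtain ⟨u0, hu0, hun⟩ : ∃ u0 : E, f u0 = 0 ∧ ‖u0‖ = 1 :=
    ⟨‖(u1:E)‖⁻¹ • (u1:E), by rw [map_smul, LinearMap.mem_ker.1 u1.2, smul_zero], by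
      rw [norm_smul, norm_inv, norm_norm, inv_mul_cancel₀ hu1']⟩
  have red : ∀ (z : ℝ) (y : E), f y = 0 → ‖z • e + y‖ = ‖z • e + ‖y‖ • u0‖ := by
    intro z y hy
    by_cases hy0 : y = 0
    · simp [hy0]
    have hyn : ‖y‖ ≠ 0 := norm_ne_zero_iff.2 hy0
    have hun' : ‖‖y‖⁻¹ • y‖ = 1 := by rw [norm_smul, norm_inv, norm_norm, inv_mul_cancel₀ hyn]
    have hfu : f (‖y‖⁻¹ • y) = 0 := by rw [map_smul, hy, smul_zero]
    have key : ‖(z / ‖y‖) • e + ‖y‖⁻¹ • y‖ = ‖(z / ‖y‖) • e + u0‖ :=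
      le_antisymm (B3 _ _ hfu hu0 hun' hun _) (B3 _ _ hu0 hfu hun hun' _)
    have e1 : z • e + y = ‖y‖ • ((z / ‖y‖) • e + ‖y‖⁻¹ • y) := by
      rw [smul_add, smul_smul, smul_smul, mul_inv_cancel₀ hyn, one_smul, mul_div_cancel₀ _ hyn]
    have e2 : z • e + ‖y‖ • u0 = ‖y‖ • ((z / ‖y‖) • e + u0) := by
      rw [smul_add, smul_smul, mul_div_cancel₀ _ hyn]
    rw [e1, norm_smul, key, ← norm_smul, ← e2]
  have hneg : ∀ (z : ℝ) (y : E), f y = 0 → ‖z • e - y‖ = ‖z • e + y‖ := by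
    intro z y hy
    rw [sub_eq_add_neg, red z (-y) (by simp [hy]), norm_neg, ← red z y hy]
  have hz : ∀ (z : ℝ) (y : E), f y = 0 → |z| ≤ ‖z • e + y‖ := by
    intro z y hy
    have h1 := hf (z • e + y)
    have h2 := hf (-(z • e + y))
    rw [norm_neg] at h2
    simp only [map_neg, map_add, map_smul, hfe, hy, smul_eq_mul, mul_one, add_zero] at h1 h2
    exact abs_le.2 ⟨by linarith, h1⟩
  have hyb : ∀ (z : ℝ) (y : E), f y = 0 → ‖y‖ ≤ ‖z • e + y‖ := by
    intro z y hy
    have h1 : ‖(2:ℝ) • y‖ ≤ ‖z • e + y‖ + ‖z • e - y‖ := by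
      have : (2:ℝ) • y = (z • e + y) - (z • e - y) := by module
      rw [this]; exact norm_sub_le _ _
    rw [hneg z y hy, norm_smul, Real.norm_two] at h1
    linarith
  have hfr : ∀ r : ℝ, f (r • u0) = 0 := fun r => by rw [map_smul, hu0, smul_zero]
  set A : ℝ → Set ℝ := fun z => {r | 0 ≤ r ∧ ‖z • e + r • u0‖ ≤ 1} with hA
  set h : ℝ → ℝ := fun z => sSup (A z) with hh
  have hAbd : ∀ z r, r ∈ A z → r ≤ 1 := by
    intro z r hr
    have := hyb z (r • u0) (hfr r)
    rw [norm_smul, hun, mul_one, Real.norm_of_nonneg hr.1] at this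
    exact this.trans hr.2
  have hbdd : ∀ z, BddAbove (A z) := fun z => ⟨1, fun r hr => hAbd z r hr⟩
  have hlowA : ∀ z, |z| ≤ 1 → 1 - |z| ∈ A z := by
    intro z hz1
    refine ⟨by linarith, (norm_add_le _ _).trans ?_⟩
    rw [norm_smul, norm_smul, he, hun, Real.norm_eq_abs, Real.norm_of_nonneg (by linarith)]
    linarith
  have hAcl : ∀ z, IsClosed (A z) := by
    intro z
    have : A z = Ici 0 ∩ (fun r : ℝ => ‖z • e + r • u0‖) ⁻¹' Iic 1 := rfl
    rw [this]
    exact isClosed_Ici.inter (isClosed_Iic.preimage (by fun_prop))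
  have hmem : ∀ z, |z| ≤ 1 → h z ∈ A z := fun z hz1 =>
    (hAcl z).csSup_mem ⟨_, hlowA z hz1⟩ (hbdd z)
  have hle : ∀ z r, r ∈ A z → r ≤ h z := fun z r hr => le_csSup (hbdd z) hr
  have down : ∀ z r r', r' ∈ A z → 0 ≤ r → r ≤ r' → r ∈ A z := by
    intro z r r' hr' hr hrr
    refine ⟨hr, ?_⟩
    by_cases h0 : r' = 0
    · have : r = r' := by linarith
      rw [this]; exact hr'.2
    have hr0 : 0 < r' := lt_of_le_of_ne hr'.1 (Ne.symm h0)
    have h2 := hneg z (r' • u0) (hfr r')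
    set t := r / r' with ht
    have hrt : r = t * r' := by rw [ht]; field_simp
    have ht0 : 0 ≤ t := by positivity
    have ht1 : t ≤ 1 := by rw [ht, div_le_one hr0]; exact hrr
    have e1 : z • e + r • u0 = ((1 + t) / 2) • (z • e + r' • u0) + ((1 - t) / 2) • (z • e - r' • u0) := by
      rw [hrt]; module
    rw [e1]
    refine (norm_add_le _ _).trans ?_
    rw [norm_smul, norm_smul, h2, Real.norm_of_nonneg (by linarith), Real.norm_of_nonneg (by linarith)]
    nlinarith [hr'.2]
  have char : ∀ (z : ℝ) (y : E), f y = 0 → (‖z • e + y‖ ≤ 1 ↔ |z| ≤ 1 ∧ ‖y‖ ≤ h z) := by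
    intro z y hy
    constructor
    · intro hle1
      exact ⟨(hz z y hy).trans hle1, hle _ _ ⟨norm_nonneg _, by rw [← red z y hy]; exact hle1⟩⟩
    · rintro ⟨h1, h2⟩
      rw [red z y hy]
      exact (down z _ _ (hmem z h1) (norm_nonneg _) h2).2
  have hnegA : ∀ z, A (-z) = A z := by
    intro z
    ext r
    have : ‖(-z) • e + r • u0‖ = ‖z • e + r • u0‖ := by
      rw [← hneg z _ (hfr r), ← norm_neg]; congr 1; module
    simp only [hA, mem_ofPred_eq, this]
  have hle1 : ∀ z, |z| ≤ 1 → h z ≤ 1 := fun z hz1 => hAbd z _ (hmem z hz1)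
  have hlow : ∀ z, |z| ≤ 1 → 1 - |z| ≤ h z := fun z hz1 => hle z _ (hlowA z hz1)
  obtain ⟨hpar, hform⟩ := fpt_core2 hT h μ hμ0 hμ1 (by
      refine ⟨convex_Icc _ _, ?_⟩
      intro z1 hz1 z2 hz2 a b ha hb hab
      have m1 := hmem z1 (abs_le.2 hz1)
      have m2 := hmem z2 (abs_le.2 hz2)
      refine hle _ _ ⟨?_, ?_⟩
      · have := m1.1; have := m2.1; simp only [smul_eq_mul]; positivity
      · have e1 : (a • z1 + b • z2) • e + (a • h z1 + b • h z2) • u0 =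
          a • (z1 • e + h z1 • u0) + b • (z2 • e + h z2 • u0) := by
          simp only [smul_eq_mul]; module
        rw [e1]
        refine (norm_add_le _ _).trans ?_
        rw [norm_smul, norm_smul, Real.norm_of_nonneg ha, Real.norm_of_nonneg hb]
        nlinarith [m1.2, m2.2])
    (by intro z _; simp only [hh, hnegA]) (by
      have h1 := hle1 0 (by simp)
      have h2 := hlow 0 (by simp)
      rw [abs_zero, sub_zero] at h2
      exact le_antisymm h1 h2) hlow hle1 (by
      intro r hr
      by_cases hr0 : r < 0
      · exact hr0.le.trans (hmem 1 (by simp)).1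
      push Not at hr0
      refine hle _ _ ⟨hr0, ?_⟩
      have hlim : Filter.Tendsto (fun n : ℕ => ‖(1 - 1 / ((n:ℝ) + 1)) • e + r • u0‖) Filter.atTop
          (nhds ‖((1:ℝ) - 0) • e + r • u0‖) :=
        (((tendsto_one_div_add_atTop_nhds_zero_nat.const_sub 1).smul_const e).add_const _).norm
      rw [sub_zero] at hlim
      refine le_of_tendsto hlim (Filter.Eventually.of_forall fun n => ?_)
      have p1 : 0 < 1 / ((n:ℝ) + 1) := by positivity
      have p2 : 1 / ((n:ℝ) + 1) ≤ 1 := by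
        rw [div_le_one (by positivity)]; linarith [(Nat.cast_nonneg n : (0:ℝ) ≤ n)]
      refine (down _ r _ (hmem _ ?_) hr0 (hr _ (by linarith) (by linarith))).2
      rw [abs_of_nonneg (by linarith)]; linarith) (by
      intro ξ
      let φ : T →ₗ[ℝ] E := ξ.smulRight e + T.subtype
      have hφ : ∀ y, φ y = ξ y • e + (y : E) := fun y => rfl
      have hφi : Function.Injective φ := by
        rw [← LinearMap.ker_eq_bot, LinearMap.ker_eq_bot']
        intro y hy
        have h1 := congrArg f hy
        rw [hφ, map_add, map_smul, hfe, LinearMap.mem_ker.1 y.2, map_zero, smul_eq_mul, mul_one,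
          add_zero] at h1
        rw [hφ, h1, zero_smul, zero_add] at hy
        exact Subtype.ext hy
      obtain ⟨c, ⟨c0, hc0⟩, hc⟩ := H (LinearMap.range φ) (by rw [LinearMap.finrank_range_of_inj hφi, hT])
      rw [hφ] at hc0
      have hcc : c = (μ + ξ c0) • e + (c0:E) := by
        rw [sub_eq_iff_eq_add'.1 hc0.symm]; module
      refine ⟨c0, fun y h1 h2 => ?_⟩
      have k := hc ((μ + ξ y) • e + (y:E)) ⟨y, by rw [hφ]; module⟩
        ((char _ _ (LinearMap.mem_ker.1 y.2)).2 ⟨h1, h2⟩)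
      have e1 : (2:ℝ) • c - ((μ + ξ y) • e + (y:E)) =
          (μ + ξ ((2:ℝ) • c0 - y)) • e + (((2:ℝ) • c0 - y : T) : E) := by
        rw [hcc, map_sub, map_smul, Submodule.coe_sub, Submodule.coe_smul, smul_eq_mul]; module
      rw [e1] at k
      exact (char _ _ (LinearMap.mem_ker.1 ((2:ℝ) • c0 - y : T).2)).1 k)
  have unit : ∀ (z : ℝ) (y : E), f y = 0 → (‖z • e + y‖ ≤ 1 ↔ z ^ 2 + ‖y‖ ^ 2 ≤ 1) := by
    intro z y hy
    rw [char z y hy]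
    constructor
    · rintro ⟨h1, h2⟩
      have := hform z h1
      nlinarith [norm_nonneg y]
    · intro h1
      have hz1 : |z| ≤ 1 := by rw [← sq_le_one_iff_abs_le_one]; nlinarith [norm_nonneg y]
      refine ⟨hz1, ?_⟩
      refine (abs_le_of_sq_le_sq' (b := h z) ?_ (hmem z hz1).1).2
      rw [hform z hz1]; linarith
  have pyth : ∀ (z : ℝ) (y : E), f y = 0 → ‖z • e + y‖ ^ 2 = z ^ 2 + ‖y‖ ^ 2 := by
    intro z y hy
    have sc : ∀ t : ℝ, 0 < t → (‖z • e + y‖ ≤ t ↔ z ^ 2 + ‖y‖ ^ 2 ≤ t ^ 2) := by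
      intro t ht
      have h1 := unit (t⁻¹ * z) (t⁻¹ • y) (by rw [map_smul, hy, smul_zero])
      have e1 : (t⁻¹ * z) • e + t⁻¹ • y = t⁻¹ • (z • e + y) := by module
      rw [e1, norm_smul, norm_smul, Real.norm_of_nonneg (by positivity)] at h1
      have e2 : (t⁻¹ * z) ^ 2 + (t⁻¹ * ‖y‖) ^ 2 = (z ^ 2 + ‖y‖ ^ 2) / t ^ 2 := by field_simp
      rw [e2, div_le_one (by positivity), inv_mul_le_iff₀ ht, mul_one] at h1
      exact h1
    apply le_antisymm
    · rcases (by positivity : 0 ≤ z ^ 2 + ‖y‖ ^ 2).eq_or_lt with h0 | h0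
      · have hz0 : z = 0 := by nlinarith [norm_nonneg y, sq_nonneg z, sq_nonneg ‖y‖]
        have hy0 : y = 0 := by
          rw [← norm_eq_zero]; nlinarith [norm_nonneg y, sq_nonneg z, sq_nonneg ‖y‖]
        simp [hz0, hy0]
      · have k := (sc (√(z ^ 2 + ‖y‖ ^ 2)) (Real.sqrt_pos.2 h0)).2 (by rw [Real.sq_sqrt h0.le])
        have := pow_le_pow_left₀ (norm_nonneg _) k 2
        rwa [Real.sq_sqrt h0.le] at this
    · rcases (norm_nonneg (z • e + y)).eq_or_lt with h0 | h0
      · have k1 := hz z y hy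
        have k2 := hyb z y hy
        rw [← h0] at k1 k2
        have hz0 : z = 0 := abs_eq_zero.1 (le_antisymm k1 (abs_nonneg _))
        have hy0 : ‖y‖ = 0 := le_antisymm k2 (norm_nonneg _)
        rw [hz0, hy0]; simp
      · exact (sc _ h0).1 le_rfl
  have dec : ∀ x : E, ‖x‖ ^ 2 = (f x) ^ 2 + ‖x - f x • e‖ ^ 2 := by
    intro x
    have := pyth (f x) (x - f x • e) (by rw [map_sub, map_smul, hfe]; simp)
    rwa [add_sub_cancel] at this
  have hTm : ∀ x : E, x - f x • e ∈ T := fun x => by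
    rw [hTd, LinearMap.mem_ker, map_sub, map_smul, hfe]; simp
  have k := hpar ⟨_, hTm x⟩ ⟨_, hTm y⟩
  change ‖x - f x • e + (y - f y • e)‖ * ‖x - f x • e + (y - f y • e)‖ +
    ‖x - f x • e - (y - f y • e)‖ * ‖x - f x • e - (y - f y • e)‖ =
    2 * (‖x - f x • e‖ * ‖x - f x • e‖ + ‖y - f y • e‖ * ‖y - f y • e‖) at k
  have d1 := dec x
  have d2 := dec y
  have d3 := dec (x + y)
  have d4 := dec (x - y)
  have e3 : x + y - f (x + y) • e = x - f x • e + (y - f y • e) := by rw [map_add]; module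
  have e4 : x - y - f (x - y) • e = x - f x • e - (y - f y • e) := by rw [map_sub]; module
  rw [e3] at d3
  rw [e4] at d4
  rw [map_add] at d3
  rw [map_sub] at d4
  nlinarith

end

section

theorem fpt_gauge {E : Type*} [NormedAddCommGroup E] [NormedSpace ℝ E] (B : Set E)
    (hc : Convex ℝ B) (hk : IsCompact B) (h0 : (0 : E) ∈ interior B) :
    ∃ g : E → ℝ, Continuous g ∧ (∀ x, g x ≤ 1 ↔ x ∈ B) ∧ (∀ t : ℝ, 0 ≤ t → ∀ x, g (t • x) = t * g x) ∧
      (∀ x y, g (x + y) ≤ g x + g y) ∧ ∀ x, x ≠ 0 → 0 < g x := by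
  have hn : B ∈ nhds (0:E) := mem_interior_iff_mem_nhds.1 h0
  have ha : Absorbent ℝ B := absorbent_nhds_zero hn
  refine ⟨gauge B, continuous_gauge hc hn, fun x => ?_, fun t ht x => ?_, gauge_add_le hc ha, fun x hx => ?_⟩
  · rw [gauge_le_one_iff_mem_closure hc hn, hk.isClosed.closure_eq]
  · exact gauge_smul_of_nonneg ht x
  · exact (gauge_pos ha ((NormedSpace.isVonNBounded_iff ℝ).2 hk.isBounded)).2 hx

theorem fpt_supp {E : Type*} [AddCommGroup E] [Module ℝ E] (g : E → ℝ)
    (hh : ∀ t : ℝ, 0 ≤ t → ∀ x, g (t • x) = t * g x) (hs : ∀ x y, g (x + y) ≤ g x + g y)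
    (v : E) (hv : v ≠ 0) : ∃ f : E →ₗ[ℝ] ℝ, (∀ x, f x ≤ g x) ∧ f v = g v := by
  have g0 : g 0 = 0 := by have := hh 0 le_rfl 0; simpa using this
  let F : E →ₗ.[ℝ] ℝ := LinearPMap.mkSpanSingleton v (g v) hv
  have hvd : v ∈ F.domain := Submodule.mem_span_singleton_self v
  have hFv : F ⟨v, hvd⟩ = g v := LinearPMap.mkSpanSingleton_apply ℝ ℝ hv (g v)
  obtain ⟨f, hf1, hf2⟩ := exists_extension_of_le_sublinear F g (fun c hc x => hh c hc.le x) hs (by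
    rintro ⟨x, hx⟩
    obtain ⟨c, rfl⟩ := Submodule.mem_span_singleton.1 hx
    have e1 : F ⟨c • v, hx⟩ = c * g v := by
      rw [← hFv, ← smul_eq_mul, ← LinearPMap.map_smul]; rfl
    rw [e1]
    rcases le_total 0 c with h | h
    · rw [hh c h]
    · have k1 := hs (c • v) ((-c) • v)
      rw [← add_smul, add_neg_cancel, zero_smul, g0, hh (-c) (by linarith)] at k1
      show c * g v ≤ g (c • v)
      linarith)
  exact ⟨f, hf2, by rw [← hFv]; exact hf1 ⟨v, hvd⟩⟩

theorem fpt_rogers {E : Type*} [NormedAddCommGroup E] [InnerProductSpace ℝ E]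
    (hE : 3 ≤ finrank ℝ E) (B : Set E)
    (hc : Convex ℝ B) (hk : IsCompact B) (h0 : (0 : E) ∈ interior B)
    (hB : ∀ D : Submodule ℝ E, finrank ℝ D = 2 → ∃ c ∈ D, ∀ x ∈ B, x ∈ D → (2:ℝ) • c - x ∈ B) :
    ∃ o : E, ∀ x ∈ B, (2:ℝ) • o - x ∈ B := by
  have : FiniteDimensional ℝ E := FiniteDimensional.of_finrank_pos (by omega)
  obtain ⟨g, gc, gB, gh, gs, gp⟩ := fpt_gauge B hc hk h0
  have g0 : g 0 = 0 := by have := gh 0 le_rfl 0; simpa using this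
  have gn : ∀ x, 0 ≤ g x := by
    intro x
    by_cases hx : x = 0
    · rw [hx, g0]
    · exact (gp x hx).le
  have hU : IsCompact {x : E | g x = 1} := by
    refine hk.of_isClosed_subset (isClosed_eq gc continuous_const) ?_
    intro x hx
    exact (gB x).1 (le_of_eq hx)
  have : Nontrivial E := Module.nontrivial_of_finrank_pos (R := ℝ) (by omega)
  obtain ⟨a0, ha0⟩ := exists_ne (0:E)
  have hnorm : ∀ x, x ≠ 0 → g ((g x)⁻¹ • x) = 1 := by
    intro x hx
    rw [gh _ (inv_nonneg.2 (gn x)), inv_mul_cancel₀ (gp x hx).ne']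
  obtain ⟨x1, hx1, hmax⟩ := hU.exists_isMaxOn ⟨_, hnorm a0 ha0⟩ (gc.comp continuous_neg).continuousOn
  obtain ⟨l, hl⟩ : ∃ l, l = g (-x1) := ⟨_, rfl⟩
  have hmax' : ∀ z, g z = 1 → g (-z) ≤ l := by
    intro z hz; rw [hl]; exact hmax hz
  have gl : ∀ z, g (-z) ≤ l * g z := by
    intro z
    by_cases hz : z = 0
    · simp [hz, g0]
    have k := hmax' _ (hnorm z hz)
    rw [← smul_neg, gh _ (inv_nonneg.2 (gn z)), inv_mul_le_iff₀ (gp z hz)] at k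
    linarith
  by_cases hl1 : l ≤ 1
  · refine ⟨0, fun x hx => ?_⟩
    rw [smul_zero, zero_sub, ← gB]
    have := (gB x).2 hx
    nlinarith [gl x, gn x]
  push Not at hl1
  have hM : IsCompact {x : E | g x = 1 ∧ g (-x) = l} :=
    hU.of_isClosed_subset ((isClosed_eq gc continuous_const).inter
      (isClosed_eq (gc.comp continuous_neg) continuous_const)) (fun x hx => hx.1)
  obtain ⟨x, ⟨hgx, hgmx⟩, hxmax⟩ := hM.exists_isMaxOn ⟨x1, hx1, hl.symm⟩ continuous_norm.continuousOn
  have hx0 : x ≠ 0 := by rintro rfl; rw [g0] at hgx; norm_num at hgx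
  obtain ⟨f, hf, hfx⟩ := fpt_supp g gh gs (-x) (neg_ne_zero.2 hx0)
  rw [hgmx, map_neg] at hfx
  have hfx : f x = -l := by linarith
  have hxB : x ∈ B := (gB x).1 hgx.le
  obtain ⟨y, hy⟩ : ∃ y, y = l⁻¹ • (-x) := ⟨_, rfl⟩
  have hl0 : 0 < l := by linarith
  have hyB : y ∈ B := by
    rw [← gB, hy, gh _ (by positivity), hgmx, inv_mul_cancel₀ hl0.ne']
  have hfy : f y = 1 := by
    rw [hy, map_smul, map_neg, hfx, smul_eq_mul]; field_simp
  have fB1 : ∀ z ∈ B, f z ≤ 1 := fun z hz => (hf z).trans ((gB z).2 hz)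
  have fB2 : ∀ z ∈ B, -l ≤ f z := by
    intro z hz
    have k1 := hf (-z)
    rw [map_neg] at k1
    have k2 := (gB z).2 hz
    nlinarith [gl z]
  have face : ∀ z ∈ B, f z = -l → g z = 1 ∧ g (-z) = l := by
    intro z hz hfz
    have k1 := hf (-z)
    rw [map_neg, hfz, neg_neg] at k1
    have k2 := (gB z).2 hz
    have k3 := gl z
    constructor
    · apply le_antisymm k2
      by_contra hcon
      push Not at hcon
      nlinarith
    · nlinarith
  have cen : ∀ D : Submodule ℝ E, finrank ℝ D = 2 → x ∈ D → ∃ δ ∈ D, f δ = 0 ∧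
      ∀ z ∈ B, z ∈ D → x + y + δ - z ∈ B := by
    intro D hD hxD
    obtain ⟨c, hcD, hcB⟩ := hB D hD
    have hyD : y ∈ D := by rw [hy]; exact D.smul_mem _ (D.neg_mem hxD)
    have k1 := fB1 _ (hcB x hxB hxD)
    have k2 := fB2 _ (hcB y hyB hyD)
    rw [map_sub, map_smul, smul_eq_mul] at k1 k2
    refine ⟨(2:ℝ) • c - x - y, D.sub_mem (D.sub_mem (D.smul_mem _ hcD) hxD) hyD, ?_, ?_⟩
    · rw [map_sub, map_sub, map_smul, smul_eq_mul]; linarith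
    · intro z hz hzD
      have : x + y + ((2:ℝ) • c - x - y) - z = (2:ℝ) • c - z := by abel
      rw [this]; exact hcB z hz hzD
  have hyD : ∀ D : Submodule ℝ E, x ∈ D → y ∈ D := by
    intro D hxD; rw [hy]; exact D.smul_mem _ (D.neg_mem hxD)
  have seg : ∀ δ, f δ = 0 → x + δ ∈ B → y + δ ∈ B → ∀ t : ℝ, |t| ≤ l⁻¹ → y + t • δ ∈ B := by
    intro δ hδ h1 h2 t ht
    have h3 : y - l⁻¹ • δ ∈ B := by
      have := (face _ h1 (by rw [map_add, hδ, hfx, add_zero])).2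
      rw [← gB]
      have e1 : y - l⁻¹ • δ = l⁻¹ • (-(x + δ)) := by rw [hy]; module
      rw [e1, gh _ (by positivity), this, inv_mul_cancel₀ hl0.ne']
    have hli : l⁻¹ ≤ 1 := inv_le_one_of_one_le₀ hl1.le
    have hli0 : 0 < l⁻¹ := by positivity
    obtain ⟨t1, t2⟩ := abs_le.1 ht
    have e1 : y + t • δ = ((t + l⁻¹) / (1 + l⁻¹)) • (y + δ) + ((1 - t) / (1 + l⁻¹)) • (y - l⁻¹ • δ) := by
      match_scalars <;> field_simp <;> ring
    rw [e1]
    refine hc h2 h3 (div_nonneg (by linarith) (by linarith)) (div_nonneg (by linarith) (by linarith)) ?_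
    field_simp; ring
  have xind : ∀ η, η ≠ 0 → f η = 0 → ∀ a b : ℝ, a • x + b • η = 0 → a = 0 ∧ b = 0 := by
    intro η hη hfη a b h
    have k := congrArg f h
    rw [map_add, map_smul, map_smul, hfη, hfx, map_zero, smul_eq_mul, smul_zero, add_zero] at k
    have ha : a = 0 := by
      rcases mul_eq_zero.1 k with h | h
      · exact h
      · linarith
    rw [ha, zero_smul, zero_add] at h
    exact ⟨ha, (smul_eq_zero.1 h).resolve_right hη⟩
  -- no nonzero orthogonal symmetric direction at `y`
  have noeta : ∀ η, η ≠ 0 → f η = 0 → inner ℝ x η = 0 → y + η ∈ B → y - η ∈ B → False := by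
    intro η hη hfη hxη h1 h2
    have hxD : x ∈ Submodule.span ℝ {x, η} := Submodule.subset_span (by simp)
    have hηD : η ∈ Submodule.span ℝ {x, η} := Submodule.subset_span (by simp)
    obtain ⟨δ, hδD, hfδ, hδ⟩ := cen (Submodule.span ℝ {x, η}) (fpt_finrank_pair x η (xind η hη hfη)) hxD
    obtain ⟨a, s, has⟩ := Submodule.mem_span_pair.1 hδD
    have ha : a = 0 := by
      have k := congrArg f has
      rw [map_add, map_smul, map_smul, hfη, hfδ, hfx, smul_eq_mul, smul_zero, add_zero] at k
      rcases mul_eq_zero.1 k with h | h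
      · exact h
      · linarith
    rw [ha, zero_smul, zero_add] at has
    have hyD' := hyD _ hxD
    have key : ∀ r : ℝ, x + r • η ∈ B → r = 0 := by
      intro r hr
      have m := face _ hr (by rw [map_add, map_smul, hfη, hfx, smul_zero, add_zero])
      have n : ‖x + r • η‖ ≤ ‖x‖ := hxmax m
      have n2 : ‖x + r • η‖ ^ 2 = ‖x‖ ^ 2 + r ^ 2 * ‖η‖ ^ 2 := by
        rw [norm_add_sq_real, inner_smul_right, hxη, norm_smul, mul_pow, Real.norm_eq_abs, sq_abs]; ring
      have hη2 : 0 < ‖η‖ ^ 2 := by have := norm_pos_iff.2 hη; positivity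
      have : r ^ 2 * ‖η‖ ^ 2 ≤ 0 := by nlinarith [norm_nonneg (x + r • η), norm_nonneg x]
      have : r ^ 2 = 0 := by nlinarith [sq_nonneg r]
      simpa using this
    have r1 := key (s - 1) (by
      have := hδ _ h1 (Submodule.add_mem _ hyD' hηD)
      rw [← has] at this
      convert this using 1; module)
    have r2 := key (s + 1) (by
      have := hδ _ h2 (Submodule.sub_mem _ hyD' hηD)
      rw [← has] at this
      convert this using 1; module)
    linarith
  obtain ⟨D0, hD0x, hD0r, hD0⟩ : ∃ D0 : Submodule ℝ E, x ∈ D0 ∧ finrank ℝ D0 ≤ 2 ∧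
      ∀ D : Submodule ℝ E, finrank ℝ D = 2 → x ∈ D → D ≠ D0 → ∀ z ∈ B, z ∈ D → x + y - z ∈ B := by
    by_cases hex : ∃ D : Submodule ℝ E, finrank ℝ D = 2 ∧ x ∈ D ∧ ¬ ∀ z ∈ B, z ∈ D → x + y - z ∈ B
    · obtain ⟨D, hD, hxD, hnD⟩ := hex
      refine ⟨D, hxD, hD.le, ?_⟩
      intro D' hD' hxD' hne
      obtain ⟨δ, hδD, hfδ, hδ⟩ := cen D hD hxD
      obtain ⟨δ', hδD', hfδ', hδ'⟩ := cen D' hD' hxD'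
      have hδ0 : δ ≠ 0 := by
        rintro rfl; apply hnD; simpa using hδ
      by_cases hδ0' : δ' = 0
      · rw [hδ0'] at hδ'; simpa using hδ'
      exfalso
      have hspan : ∀ (D : Submodule ℝ E) (δ : E), finrank ℝ D = 2 → x ∈ D → δ ∈ D → δ ≠ 0 → f δ = 0 →
          Submodule.span ℝ {x, δ} = D := by
        intro D δ hD hx hd h0 hf0
        apply Submodule.eq_of_le_of_finrank_eq
        · rw [Submodule.span_le]
          rintro z (rfl | rfl)
          · exact hx
          · exact hd
        · rw [hD]; exact fpt_finrank_pair x δ (xind δ h0 hf0)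
      have hxδ : x + δ ∈ B := by
        convert hδ y hyB (hyD D hxD) using 1; abel
      have hyδ : y + δ ∈ B := by
        convert hδ x hxB hxD using 1; abel
      have hxδ' : x + δ' ∈ B := by
        convert hδ' y hyB (hyD D' hxD') using 1; abel
      have hyδ' : y + δ' ∈ B := by
        convert hδ' x hxB hxD' using 1; abel
      have s1 := seg δ hfδ hxδ hyδ
      have s2 := seg δ' hfδ' hxδ' hyδ'
      have hli0 : 0 < l⁻¹ := by positivity
      have comb : ∀ a b : ℝ, |a| ≤ l⁻¹ / 2 → |b| ≤ l⁻¹ / 2 → y + (a • δ + b • δ') ∈ B := by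
        intro a b ha hb
        have k1 := s1 (2 * a) (by rw [abs_mul, abs_two]; linarith)
        have k2 := s2 (2 * b) (by rw [abs_mul, abs_two]; linarith)
        have := hc k1 k2 (a := 1/2) (b := 1/2) (by norm_num) (by norm_num) (by norm_num)
        convert this using 1; module
      have main : ∀ a b : ℝ, a • δ + b • δ' ≠ 0 → inner ℝ x (a • δ + b • δ') = 0 → False := by
        intro a b hne0 hin
        set m := |a| + |b| + 1 with hm
        have hm0 : 0 < m := by positivity
        set t := l⁻¹ / 2 / m with ht
        have ht0 : 0 < t := by positivity
        have bd : ∀ r : ℝ, |r| ≤ m → |t * r| ≤ l⁻¹ / 2 := by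
          intro r hr
          rw [abs_mul, abs_of_pos ht0, ht, div_mul_eq_mul_div, div_le_iff₀ hm0]
          exact mul_le_mul_of_nonneg_left hr (by positivity)
        have ba := bd a (by rw [hm]; linarith [abs_nonneg b])
        have bb := bd b (by rw [hm]; linarith [abs_nonneg a])
        refine noeta (t • (a • δ + b • δ')) (smul_ne_zero ht0.ne' hne0) ?_ ?_ ?_ ?_
        · simp [hfδ, hfδ']
        · rw [inner_smul_right, hin, mul_zero]
        · convert comb (t * a) (t * b) ba bb using 1; module
        · convert comb (-(t * a)) (-(t * b)) (by rw [abs_neg]; exact ba) (by rw [abs_neg]; exact bb) using 1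
          module
      by_cases hin : inner ℝ x δ = 0
      · exact main 1 0 (by simpa using hδ0) (by simpa using hin)
      · refine main (inner ℝ x δ') (-(inner ℝ x δ)) ?_ ?_
        · intro h
          apply hne
          rw [← hspan D' δ' hD' hxD' hδD' hδ0' hfδ']
          have hmem : δ' ∈ D := by
            have : δ' = (inner ℝ x δ' / inner ℝ x δ) • δ := by
              have h2 : inner ℝ x δ • δ' = inner ℝ x δ' • δ := by
                rw [neg_smul, ← sub_eq_add_neg, sub_eq_zero] at h; exact h.symm
              rw [div_eq_inv_mul, mul_smul, ← h2, smul_smul, inv_mul_cancel₀ hin, one_smul]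
            rw [this]; exact D.smul_mem _ hδD
          exact hspan D δ' hD hxD hmem hδ0' hfδ'
        · rw [inner_add_right, inner_smul_right, inner_smul_right]; ring
    · push Not at hex
      refine ⟨Submodule.span ℝ {x}, Submodule.mem_span_singleton_self x, ?_, fun D hD hx _ => hex D hD hx⟩
      rw [finrank_span_singleton hx0]; norm_num
  have sym1 : ∀ z ∈ B, z ∉ D0 → x + y - z ∈ B := by
    intro z hz hzD
    have hzx : z ∈ Submodule.span ℝ {x, z} := Submodule.subset_span (by simp)
    refine hD0 (Submodule.span ℝ {x, z}) (fpt_finrank_pair x z ?_) (Submodule.subset_span (by simp)) ?_ z hz hzx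
    · intro a b h
      have hb : b = 0 := by
        by_contra hb
        apply hzD
        have : z = (-(b⁻¹ * a)) • x := by
          have h2 : b • z = -(a • x) := by rw [eq_neg_iff_add_eq_zero, add_comm]; exact h
          rw [neg_smul, mul_smul, ← smul_neg, ← h2, smul_smul, inv_mul_cancel₀ hb, one_smul]
        rw [this]; exact D0.smul_mem _ hD0x
      rw [hb, zero_smul, add_zero] at h
      exact ⟨(smul_eq_zero.1 h).resolve_right hx0, hb⟩
    · intro h; rw [h] at hzx; exact hzD hzx
  refine ⟨(1/2 : ℝ) • (x + y), fun z hz => ?_⟩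
  rw [smul_smul]; norm_num
  by_cases hzD : z ∈ D0
  swap
  · exact sym1 z hz hzD
  obtain ⟨v, hv⟩ : ∃ v, v ∉ D0 := by
    by_contra hcon
    push Not at hcon
    have : D0 = ⊤ := by rw [eq_top_iff]; exact fun x _ => hcon x
    rw [this, finrank_top] at hD0r
    omega
  have hv0 : v ≠ 0 := by rintro rfl; exact hv D0.zero_mem
  have hvB : (g v)⁻¹ • v ∈ B := (gB _).1 (hnorm v hv0).le
  set v' := (g v)⁻¹ • v with hv'
  have hv'D : v' ∉ D0 := by
    intro h; exact hv ((D0.smul_mem_iff (inv_ne_zero (gp v hv0).ne')).1 h)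
  have hlim : Filter.Tendsto (fun n : ℕ => x + y - (z + (1 / ((n:ℝ) + 1)) • (v' - z))) Filter.atTop
      (nhds (x + y - (z + (0:ℝ) • (v' - z)))) :=
    ((tendsto_one_div_add_atTop_nhds_zero_nat.smul_const _).const_add _).const_sub _
  rw [zero_smul, add_zero] at hlim
  refine hk.isClosed.mem_of_tendsto hlim (Filter.Eventually.of_forall fun n => sym1 _ ?_ ?_)
  · have p1 : 0 < 1 / ((n:ℝ) + 1) := by positivity
    have p2 : 1 / ((n:ℝ) + 1) ≤ 1 := by
      rw [div_le_one (by positivity)]; linarith [(Nat.cast_nonneg n : (0:ℝ) ≤ n)]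
    exact hc.add_smul_sub_mem hz hvB ⟨p1.le, p2⟩
  · intro h
    apply hv'D
    have p1 : 1 / ((n:ℝ) + 1) ≠ 0 := by positivity
    have h2 : (1 / ((n:ℝ) + 1)) • (v' - z) ∈ D0 := by
      have := D0.sub_mem h hzD; rwa [add_sub_cancel_left] at this
    have h3 := (D0.smul_mem_iff p1).1 h2
    have := D0.add_mem h3 hzD
    rwa [sub_add_cancel] at this

end

section

theorem fpt_core_abs {V : Type*} [AddCommGroup V] [Module ℝ V] (hV : finrank ℝ V = 3) (N : V → ℝ)
    (Nn : ∀ x, 0 ≤ N x) (Nh : ∀ (c : ℝ) x, N (c • x) = |c| * N x) (Ns : ∀ x y, N (x + y) ≤ N x + N y)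
    (N0 : ∀ x, N x = 0 ↔ x = 0) (p : V) (hp0 : 0 < N p) (hp1 : N p < 1)
    (H : ∀ D : Submodule ℝ V, finrank ℝ D = 2 → ∃ c, c - p ∈ D ∧
      ∀ X, X - p ∈ D → N X ≤ 1 → N ((2:ℝ) • c - X) ≤ 1) (x y : V) :
    N (x + y) * N (x + y) + N (x - y) * N (x - y) = 2 * (N x * N x + N y * N y) := by
  let _ : Norm V := ⟨N⟩
  have core : NormedSpace.Core ℝ V :=
    { norm_nonneg := Nn
      norm_smul := Nh
      norm_triangle := Ns
      norm_eq_zero_iff := N0 }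
  let _ : NormedAddCommGroup V := NormedAddCommGroup.ofCore core
  let _ : NormedSpace ℝ V := NormedSpace.ofCore core
  have hpe : N p • ((N p)⁻¹ • p) = p := by rw [smul_smul, mul_inv_cancel₀ hp0.ne', one_smul]
  refine fpt_core hV ((N p)⁻¹ • p) (N p) ?_ hp0 hp1 ?_ x y
  · show N ((N p)⁻¹ • p) = 1
    rw [Nh, abs_of_pos (by positivity), inv_mul_cancel₀ hp0.ne']
  · intro D hD
    rw [hpe]
    exact H D hD

theorem fpt_bilin {V : Type*} [AddCommGroup V] [Module ℝ V] (N : V → ℝ)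
    (Nn : ∀ x, 0 ≤ N x) (Nh : ∀ (c : ℝ) x, N (c • x) = |c| * N x) (Ns : ∀ x y, N (x + y) ≤ N x + N y)
    (N0 : ∀ x, N x = 0 ↔ x = 0)
    (par : ∀ x y, N (x + y) * N (x + y) + N (x - y) * N (x - y) = 2 * (N x * N x + N y * N y)) :
    ∃ b : V →ₗ[ℝ] V →ₗ[ℝ] ℝ, (∀ x y, b x y = b y x) ∧ ∀ x, b x x = N x ^ 2 := by
  let _ : Norm V := ⟨N⟩
  have core : NormedSpace.Core ℝ V :=
    { norm_nonneg := Nn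
      norm_smul := Nh
      norm_triangle := Ns
      norm_eq_zero_iff := N0 }
  let _ : NormedAddCommGroup V := NormedAddCommGroup.ofCore core
  let _ : NormedSpace ℝ V := NormedSpace.ofCore core
  let _ : InnerProductSpace ℝ V := InnerProductSpace.ofNorm ℝ par
  refine ⟨innerₗ V, fun x y => ?_, fun x => ?_⟩
  · simp [real_inner_comm]
  · simp only [innerₗ_apply_apply, real_inner_self_eq_norm_sq]; rfl

theorem fpt_dim {E : Type*} [AddCommGroup E] [Module ℝ E] [FiniteDimensional ℝ E] (n : ℕ)
    (hn : n ≤ finrank ℝ E) (k : ℕ) : ∀ U : Submodule ℝ E, finrank ℝ U ≤ n → n ≤ finrank ℝ U + k →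
    ∃ W : Submodule ℝ E, U ≤ W ∧ finrank ℝ W = n := by
  induction k with
  | zero => intro U h1 h2; exact ⟨U, le_rfl, by omega⟩
  | succ k ih =>
    intro U h1 h2
    by_cases h : finrank ℝ U = n
    · exact ⟨U, le_rfl, h⟩
    obtain ⟨v, hv⟩ : ∃ v, v ∉ U := by
      by_contra hcon
      push Not at hcon
      have : U = ⊤ := by rw [eq_top_iff]; exact fun x _ => hcon x
      rw [this, finrank_top] at h h1
      omega
    have a1 : finrank ℝ U < finrank ℝ (U ⊔ Submodule.span ℝ {v} : Submodule ℝ E) := by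
      apply Submodule.finrank_lt_finrank_of_lt
      refine lt_of_le_of_ne le_sup_left ?_
      intro heq
      apply hv
      rw [heq]
      exact Submodule.mem_sup_right (Submodule.mem_span_singleton_self v)
    have a2 := Submodule.finrank_add_le_finrank_add_finrank U (Submodule.span ℝ {v})
    have hv0 : v ≠ 0 := by rintro rfl; exact hv U.zero_mem
    rw [finrank_span_singleton hv0] at a2
    obtain ⟨W, hW1, hW2⟩ := ih (U ⊔ Submodule.span ℝ {v}) (by omega) (by omega)
    exact ⟨W, le_sup_left.trans hW1, hW2⟩

theorem fpt_dim3 {E : Type*} [AddCommGroup E] [Module ℝ E]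
    (hE : 3 ≤ finrank ℝ E) (x y z : E) :
    ∃ W : Submodule ℝ E, finrank ℝ W = 3 ∧ x ∈ W ∧ y ∈ W ∧ z ∈ W := by
  have : FiniteDimensional ℝ E := FiniteDimensional.of_finrank_pos (by omega)
  have h1 : finrank ℝ (Submodule.span ℝ (Set.range ![x, y, z])) ≤ 3 := by
    have := finrank_range_le_card (R := ℝ) ![x, y, z]
    simpa [Set.finrank] using this
  obtain ⟨W, hW, hr⟩ := fpt_dim 3 hE 3 _ h1 (by omega)
  refine ⟨W, hr, ?_, ?_, ?_⟩
  · exact hW (Submodule.subset_span ⟨0, rfl⟩)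
  · exact hW (Submodule.subset_span ⟨1, rfl⟩)
  · exact hW (Submodule.subset_span ⟨2, rfl⟩)

theorem fpt_affine {E : Type*} [NormedAddCommGroup E] [InnerProductSpace ℝ E]
    (hE : 3 ≤ finrank ℝ E) (B : Set E)
    (hc : Convex ℝ B) (hk : IsCompact B) (h0 : (0 : E) ∈ interior B)
    (hB : ∀ D : Submodule ℝ E, finrank ℝ D = 2 → ∃ c ∈ D, ∀ x ∈ B, x ∈ D → (2:ℝ) • c - x ∈ B)
    (hns : ¬ ∀ x ∈ B, -x ∈ B) :
    ∃ (o : E) (b : E →ₗ[ℝ] E →ₗ[ℝ] ℝ), (∀ x y, b x y = b y x) ∧ (∀ x, x ≠ 0 → 0 < b x x) ∧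
      ∀ x, x ∈ B ↔ b (x - o) (x - o) ≤ 1 := by
  have : FiniteDimensional ℝ E := FiniteDimensional.of_finrank_pos (by omega)
  obtain ⟨o, ho⟩ := fpt_rogers hE B hc hk h0 hB
  have ho0 : o ≠ 0 := by
    rintro rfl; apply hns; simpa using ho
  set B' : Set E := (fun X => X + o) ⁻¹' B with hB'
  have hB'c : Convex ℝ B' := hc.affine_preimage (AffineMap.id ℝ E + AffineMap.const ℝ E o)
  have hB'k : IsCompact B' := (Homeomorph.addRight o).isCompact_preimage.2 hk
  have hint : ∀ X, X + o ∈ interior B → X ∈ interior B' := by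
    intro X hX
    exact preimage_interior_subset_interior_preimage (by fun_prop : Continuous fun X : E => X + o) hX
  have hp : -o ∈ interior B' := hint _ (by rwa [neg_add_cancel])
  have hsym : ∀ X ∈ B', -X ∈ B' := by
    intro X hX
    have := ho _ hX
    show -X + o ∈ B
    convert this using 1; module
  have hp' : o ∈ interior B' := by
    have h1 : o ∈ (fun X : E => -X) ⁻¹' interior B' := hp
    have h2 := preimage_interior_subset_interior_preimage (continuous_neg : Continuous fun X : E => -X) h1
    refine interior_mono ?_ h2
    intro X hX
    have := hsym _ hX
    rwa [neg_neg] at this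
  have h0' : (0:E) ∈ interior B' := by
    have := hB'c.interior hp' hp (a := 1/2) (b := 1/2) (by norm_num) (by norm_num) (by norm_num)
    convert this using 1; module
  obtain ⟨N, Nc, NB, Nh, Ns, Np⟩ := fpt_gauge B' hB'c hB'k h0'
  have Nz : N 0 = 0 := by have := Nh 0 le_rfl 0; simpa using this
  have N0 : ∀ x, N x = 0 ↔ x = 0 := by
    intro x
    constructor
    · intro h; by_contra hx; exact (Np x hx).ne' h
    · rintro rfl; exact Nz
  have Nn : ∀ x, 0 ≤ N x := by
    intro x
    by_cases hx : x = 0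
    · rw [hx, Nz]
    · exact (Np x hx).le
  have Nle : ∀ x, N (-x) ≤ N x := by
    intro x
    by_cases hx : x = 0
    · simp [hx]
    have k := Np x hx
    have h1 : (N x)⁻¹ • x ∈ B' := by
      rw [← NB, Nh _ (by positivity), inv_mul_cancel₀ k.ne']
    have h2 := (NB _).2 (hsym _ h1)
    rw [← smul_neg, Nh _ (by positivity), inv_mul_le_iff₀ k, mul_one] at h2
    exact h2
  have Nneg : ∀ x, N (-x) = N x := by
    intro x
    apply le_antisymm (Nle x)
    have := Nle (-x); rwa [neg_neg] at this
  have Nh' : ∀ (c : ℝ) x, N (c • x) = |c| * N x := by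
    intro c x
    rcases le_total 0 c with h | h
    · rw [Nh c h, abs_of_nonneg h]
    · rw [abs_of_nonpos h, ← Nh (-c) (by linarith), ← Nneg]; simp
  have hNp1 : N (-o) < 1 := by
    have hcont : Continuous fun t : ℝ => t • (-o) := by fun_prop
    have hopen : IsOpen ((fun t : ℝ => t • (-o)) ⁻¹' interior B') := isOpen_interior.preimage hcont
    have h1 : (1:ℝ) ∈ (fun t : ℝ => t • (-o)) ⁻¹' interior B' := by
      show (1:ℝ) • (-o) ∈ interior B'
      rwa [one_smul]
    obtain ⟨ε, hε, hball⟩ := Metric.isOpen_iff.1 hopen 1 h1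
    have h2 : (1 + ε / 2) • (-o) ∈ interior B' := hball (by
      rw [Metric.mem_ball, Real.dist_eq, add_sub_cancel_left, abs_of_pos (by positivity)]; linarith)
    have h3 := (NB _).2 (interior_subset h2)
    rw [Nh _ (by positivity)] at h3
    nlinarith [Np (-o) (neg_ne_zero.2 ho0)]
  have par : ∀ x y, N (x + y) * N (x + y) + N (x - y) * N (x - y) = 2 * (N x * N x + N y * N y) := by
    intro x y
    obtain ⟨W, hW, hpW, hxW, hyW⟩ := fpt_dim3 hE (-o) x y
    have := fpt_core_abs hW (fun X : W => N X) (fun X => Nn _) (fun c X => Nh' c X) (fun X Y => Ns X Y)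
      (fun X => by rw [N0]; exact Submodule.coe_eq_zero) ⟨-o, hpW⟩ (Np _ (neg_ne_zero.2 ho0)) hNp1 (by
        intro D hD
        obtain ⟨c, hcD, hcB⟩ := hB (D.map W.subtype) (by
          rw [← hD]; exact (Submodule.equivMapOfInjective _ W.injective_subtype D).finrank_eq.symm)
        obtain ⟨c', hc', rfl⟩ := hcD
        refine ⟨c' + ⟨-o, hpW⟩, by simpa using hc', ?_⟩
        intro X hX hNX
        have hXB : (X : E) + o ∈ B := (NB _).1 hNX
        have k := hcB _ hXB ⟨X - ⟨-o, hpW⟩, hX, by simp⟩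
        refine (NB _).2 ?_
        show ((((2:ℝ) • (c' + ⟨-o, hpW⟩) - X : W)) : E) + o ∈ B
        convert k using 1
        simp only [Submodule.coe_sub, Submodule.coe_smul, Submodule.coe_add, Submodule.subtype_apply]
        module) ⟨x, hxW⟩ ⟨y, hyW⟩
    exact this
  obtain ⟨b, hb1, hb2⟩ := fpt_bilin N Nn Nh' Ns N0 par
  refine ⟨o, b, hb1, fun x hx => ?_, fun x => ?_⟩
  · rw [hb2]; have := Np x hx; positivity
  · rw [hb2]
    have : x ∈ B ↔ x - o ∈ B' := by
      show x ∈ B ↔ x - o + o ∈ B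
      rw [sub_add_cancel]
    rw [this, ← NB, sq_le_one_iff₀ (Nn _)]

end

section

theorem fpt_chord {F : Type*} [NormedAddCommGroup F] [NormedSpace ℝ F] (K : Set F)
    (hk : IsCompact K) (z u : F) (hz : z ∈ interior K) (hu : u ≠ 0) :
    ∃ t : ℝ, 0 < t ∧ z + t • u ∈ frontier K ∧ z + t • u ∈ K ∧ ∀ s : ℝ, z + s • u ∈ K → s ≤ t := by
  have hcont : Continuous fun t : ℝ => z + t • u := by fun_prop
  set A : Set ℝ := (fun t : ℝ => z + t • u) ⁻¹' K with hA
  have hcl : IsClosed A := hk.isClosed.preimage hcont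
  have hun : 0 < ‖u‖ := norm_pos_iff.2 hu
  obtain ⟨M, hM⟩ := hk.isBounded.exists_norm_le
  have hbd : ∀ t ∈ A, t ≤ (M + ‖z‖) / ‖u‖ := by
    intro t ht
    rw [le_div_iff₀ hun]
    have h1 := hM _ ht
    have h2 : ‖t • u‖ ≤ ‖z + t • u‖ + ‖z‖ := by
      have : t • u = (z + t • u) - z := by abel
      calc ‖t • u‖ = ‖(z + t • u) - z‖ := by rw [← this]
        _ ≤ _ := norm_sub_le _ _
    rw [norm_smul, Real.norm_eq_abs] at h2
    nlinarith [le_abs_self t]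
  have hne : A.Nonempty := ⟨0, by show z + (0:ℝ) • u ∈ K; simpa using interior_subset hz⟩
  have hbdd : BddAbove A := ⟨_, hbd⟩
  have push : ∀ t, z + t • u ∈ interior K → ∃ s, t < s ∧ s ∈ A := by
    intro t ht
    obtain ⟨ε, hε, hball⟩ := Metric.isOpen_iff.1 (isOpen_interior.preimage hcont) t ht
    refine ⟨t + ε / 2, by linarith, ?_⟩
    have : t + ε / 2 ∈ Metric.ball t ε := by
      rw [Metric.mem_ball, Real.dist_eq, add_sub_cancel_left, abs_of_pos (by positivity)]; linarith
    have h3 : z + (t + ε / 2) • u ∈ interior K := hball this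
    exact (interior_subset h3 : z + (t + ε / 2) • u ∈ K)
  have hmem : sSup A ∈ A := hcl.csSup_mem hne hbdd
  refine ⟨sSup A, ?_, ?_, hmem, fun s hs => le_csSup hbdd hs⟩
  · obtain ⟨s, hs, hsA⟩ := push 0 (by simpa using hz)
    exact hs.trans_le (le_csSup hbdd hsA)
  · refine ⟨subset_closure hmem, fun hi => ?_⟩
    obtain ⟨s, hs, hsA⟩ := push _ hi
    exact absurd (le_csSup hbdd hsA) (not_le.2 hs)

/-- A positive combination of an interior point and a point of `K` is interior. -/
theorem fpt_int {F : Type*} [NormedAddCommGroup F] [NormedSpace ℝ F] (K : Set F)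
    (hc : Convex ℝ K) (z w x : F) (hz : z ∈ interior K) (hw : w ∈ K) (a b s : ℝ) (ha : 0 < a)
    (hb : 0 ≤ b) (h : s • ((x, 1) : F × ℝ) = a • (z, 1) + b • (w, 1)) : x ∈ interior K := by
  have h2 : s = a + b := by simpa using congrArg Prod.snd h
  have h1 : s • x = a • z + b • w := by simpa using congrArg Prod.fst h
  have hs : 0 < s := by linarith
  have e : x = (a / s) • z + (b / s) • w := by
    have : x = s⁻¹ • (s • x) := by rw [smul_smul, inv_mul_cancel₀ hs.ne', one_smul]
    rw [this, h1, smul_add, smul_smul, smul_smul, div_eq_inv_mul, div_eq_inv_mul]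
  rw [e]
  refine hc.combo_interior_self_mem_interior hz hw (by positivity) (by positivity) ?_
  rw [← add_div, ← h2, div_self hs.ne']

/-- A line through an interior point meets the frontier in two points spanning it. -/
theorem fpt_line {F : Type*} [NormedAddCommGroup F] [NormedSpace ℝ F] (K : Set F)
    (hk : IsCompact K) (z : F) (hz : z ∈ interior K) (W : Submodule ℝ (F × ℝ))
    (hzW : (z, (1:ℝ)) ∈ W) (v : F × ℝ) (hv : v ∈ W) (hvz : ∀ s : ℝ, v ≠ s • (z, 1)) :
    ∃ x y : F, x ∈ frontier K ∧ y ∈ frontier K ∧ x ∈ K ∧ y ∈ K ∧ x ≠ y ∧ (x, (1:ℝ)) ∈ W ∧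
      (y, (1:ℝ)) ∈ W ∧
      v ∈ Submodule.span ℝ {(x, (1:ℝ)), (y, (1:ℝ))} ∧
      ∃ a b : ℝ, 0 < a ∧ 0 < b ∧ a + b = 1 ∧ z = a • x + b • y := by
  set u : F := v.1 - v.2 • z with hu
  have hu0 : u ≠ 0 := by
    intro h
    apply hvz v.2
    ext
    · simpa using sub_eq_zero.1 h
    · simp
  obtain ⟨t1, ht1, f1, k1, -⟩ := fpt_chord K hk z u hz hu0
  obtain ⟨t2, ht2, f2, k2, -⟩ := fpt_chord K hk z (-u) hz (neg_ne_zero.2 hu0)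
  have hD : 0 < t1 + t2 := by linarith
  have hdir : (u, (0:ℝ)) = v - v.2 • (z, (1:ℝ)) := by ext <;> simp [hu]
  have huW : (u, (0:ℝ)) ∈ W := by rw [hdir]; exact W.sub_mem hv (W.smul_mem _ hzW)
  have eX : (z + t1 • u, (1:ℝ)) = (z, 1) + t1 • (u, (0:ℝ)) := by ext <;> simp
  have eY : (z + t2 • (-u), (1:ℝ)) = (z, 1) - t2 • (u, (0:ℝ)) := by ext <;> simp [sub_eq_add_neg]
  have ezz : z = (t2 / (t1 + t2)) • (z + t1 • u) + (t1 / (t1 + t2)) • (z + t2 • (-u)) := by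
    match_scalars <;> field_simp <;> ring
  refine ⟨z + t1 • u, z + t2 • (-u), f1, f2, k1, k2, ?_, ?_, ?_, ?_, ?_⟩
  · intro h
    have h2 : (t1 + t2) • u = 0 := by
      have := sub_eq_zero.2 h
      rw [← this]; module
    exact (smul_ne_zero hD.ne' hu0) h2
  · rw [eX]; exact W.add_mem hzW (W.smul_mem _ huW)
  · rw [eY]; exact W.sub_mem hzW (W.smul_mem _ huW)
  · rw [Submodule.mem_span_pair, eX, eY]
    have ev : v = v.2 • (z, (1:ℝ)) + (u, (0:ℝ)) := by rw [hdir]; abel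
    refine ⟨(v.2 * t2 + 1) / (t1 + t2), (v.2 * t1 - 1) / (t1 + t2), ?_⟩
    conv_rhs => rw [ev]
    generalize (u, (0:ℝ)) = U
    generalize (z, (1:ℝ)) = Z
    generalize v.2 = r
    match_scalars <;> field_simp <;> ring
  · exact ⟨t2 / (t1 + t2), t1 / (t1 + t2), by positivity, by positivity, by field_simp; ring, ezz⟩

/-- The section hypothesis, linearised. -/
def FptS {F : Type*} [NormedAddCommGroup F] [NormedSpace ℝ F] (K : Set F) (p : F)
    (ω : F × ℝ →ₗ[ℝ] ℝ) : Prop :=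
  ∀ W : Submodule ℝ (F × ℝ), finrank ℝ W = 3 → (p, (1:ℝ)) ∈ W → ∃ Q ∈ W, Q ≠ 0 ∧
    ∀ x ∈ frontier K, ∀ y ∈ frontier K, x ≠ y → (x, (1:ℝ)) ∈ W → (y, (1:ℝ)) ∈ W →
      Q ∈ Submodule.span ℝ {(x, (1:ℝ)), (y, (1:ℝ))} →
      ω (x, 1) ≠ 0 ∧ ω (y, 1) ≠ 0 ∧ ∃ k : ℝ, k ≠ 0 ∧ Q = k • (ω (y, 1) • (x, 1) + ω (x, 1) • (y, 1))

/-- The pole property, linearised. -/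
def FptP {F : Type*} [NormedAddCommGroup F] [NormedSpace ℝ F] (K : Set F) (p : F)
    (ω : F × ℝ →ₗ[ℝ] ℝ) : Prop :=
  ∀ x ∈ frontier K, ∀ y ∈ frontier K, x ≠ y →
      (p, (1:ℝ)) ∈ Submodule.span ℝ {(x, (1:ℝ)), (y, (1:ℝ))} →
      ω (x, 1) ≠ 0 ∧ ω (y, 1) ≠ 0 ∧
        ∃ k : ℝ, k ≠ 0 ∧ (p, (1:ℝ)) = k • (ω (y, 1) • (x, 1) + ω (x, 1) • (y, 1))

/-- Each section has a chord, through `p`, whose line contains the section pole. -/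
theorem fpt_line' {F : Type*} [NormedAddCommGroup F] [NormedSpace ℝ F] (K : Set F)
    (hk : IsCompact K) (z : F) (hz : z ∈ interior K) (W : Submodule ℝ (F × ℝ)) (hW : finrank ℝ W = 3)
    (hzW : (z, (1:ℝ)) ∈ W) (v : F × ℝ) (hv : v ∈ W) :
    ∃ x y : F, x ∈ frontier K ∧ y ∈ frontier K ∧ x ∈ K ∧ y ∈ K ∧ x ≠ y ∧ (x, (1:ℝ)) ∈ W ∧
      (y, (1:ℝ)) ∈ W ∧
      v ∈ Submodule.span ℝ {(x, (1:ℝ)), (y, (1:ℝ))} ∧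
      ∃ a b : ℝ, 0 < a ∧ 0 < b ∧ a + b = 1 ∧ z = a • x + b • y := by
  by_cases hvz : ∀ s : ℝ, v ≠ s • (z, 1)
  · exact fpt_line K hk z hz W hzW v hv hvz
  push Not at hvz
  obtain ⟨s, hs⟩ := hvz
  obtain ⟨v', hv', hvz'⟩ : ∃ v' ∈ W, ∀ s : ℝ, v' ≠ s • (z, 1) := by
    by_contra hcon
    push Not at hcon
    have h1 : W ≤ Submodule.span ℝ {(z, (1:ℝ))} := by
      intro w hw
      obtain ⟨s, hs⟩ := hcon w hw
      exact Submodule.mem_span_singleton.2 ⟨s, hs.symm⟩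
    have h2 := Submodule.finrank_mono h1
    rw [finrank_span_singleton (by simp), hW] at h2
    omega
  obtain ⟨x, y, h1, h2, h3, h4, h5, h6, h7, h8, a, b, ha, hb, hab, hz'⟩ :=
    fpt_line K hk z hz W hzW v' hv' hvz'
  refine ⟨x, y, h1, h2, h3, h4, h5, h6, h7, ?_, a, b, ha, hb, hab, hz'⟩
  rw [Submodule.mem_span_pair]
  refine ⟨s * a, s * b, ?_⟩
  rw [hs]
  ext
  · simp [hz', smul_smul]
  · simp [← mul_add, hab]

theorem fpt_p_notin {F : Type*} [NormedAddCommGroup F] [NormedSpace ℝ F] (hF : 3 ≤ finrank ℝ F)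
    (K : Set F) (hk : IsCompact K) (p : F) (hp : p ∈ interior K)
    (ω : F × ℝ →ₗ[ℝ] ℝ) (hS : FptS K p ω) : ω (p, 1) ≠ 0 := by
  have : FiniteDimensional ℝ F := FiniteDimensional.of_finrank_pos (by omega)
  intro h0
  have h1 := LinearMap.finrank_range_add_finrank_ker ω
  have h2 : finrank ℝ (LinearMap.range ω) ≤ 1 := by
    have := Submodule.finrank_le (LinearMap.range ω); rwa [finrank_self] at this
  rw [finrank_prod, finrank_self] at h1
  obtain ⟨W, hW, hpW, -, -⟩ := fpt_dim3 (E := LinearMap.ker ω) (by omega) ⟨_, h0⟩ 0 0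
  have hW' : finrank ℝ (W.map (LinearMap.ker ω).subtype) = 3 := by
    rw [← hW]; exact (Submodule.equivMapOfInjective _ (LinearMap.ker ω).injective_subtype W).finrank_eq.symm
  have hpW' : (p, (1:ℝ)) ∈ W.map (LinearMap.ker ω).subtype := ⟨_, hpW, rfl⟩
  obtain ⟨Q, hQW, -, hQ⟩ := hS _ hW' hpW'
  obtain ⟨x, y, hx, hy, -, -, hxy, hxW, hyW, hspan, -⟩ := fpt_line' K hk p hp _ hW' hpW' Q hQW
  apply (hQ x hx y hy hxy hxW hyW hspan).1
  obtain ⟨w, -, hw⟩ := hxW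
  rw [← hw]; exact w.2

theorem fpt_open_seg {F : Type*} [NormedAddCommGroup F] [NormedSpace ℝ F] (K : Set F)
    (hc : Convex ℝ K) (z x y : F) (hz : z ∈ interior K) (hx : x ∈ K) (hy : y ∈ K) (a b : ℝ)
    (ha : 0 < a) (hb : 0 < b) (hab : a + b = 1) (hzxy : z = a • x + b • y) (c e : ℝ) (hc0 : 0 < c)
    (he : 0 < e) (hce : c + e = 1) : c • x + e • y ∈ interior K := by
  rcases le_total (c * b) (e * a) with h | h
  · -- subtract a multiple of `z`, remaining coefficient on `y`
    refine fpt_int K hc z y _ hz hy (c / a) (e - c / a * b) 1 (by positivity) ?_ ?_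
    · rw [sub_nonneg, div_mul_eq_mul_div, div_le_iff₀ ha]; exact h
    · rw [hzxy]
      ext
      · simp only [one_smul, Prod.fst_add, Prod.smul_fst]
        match_scalars <;> field_simp <;> ring
      · simp; field_simp; nlinarith
  · refine fpt_int K hc z x _ hz hx (e / b) (c - e / b * a) 1 (by positivity) ?_ ?_
    · rw [sub_nonneg, div_mul_eq_mul_div, div_le_iff₀ hb]; exact h
    · rw [hzxy]
      ext
      · simp only [one_smul, Prod.fst_add, Prod.smul_fst]
        match_scalars <;> field_simp <;> ring
      · simp; field_simp; nlinarith

theorem fpt_ker2 {F : Type*} [AddCommGroup F] [Module ℝ F] (hF : 3 ≤ finrank ℝ F)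
    (f g : F →ₗ[ℝ] ℝ) : ∃ δ, δ ≠ 0 ∧ f δ = 0 ∧ g δ = 0 := by
  have : FiniteDimensional ℝ F := FiniteDimensional.of_finrank_pos (by omega)
  have h1 := LinearMap.finrank_range_add_finrank_ker (f.prod g)
  have h2 := Submodule.finrank_le (LinearMap.range (f.prod g))
  rw [finrank_prod, finrank_self] at h2
  have : Nontrivial (LinearMap.ker (f.prod g)) :=
    Module.nontrivial_of_finrank_pos (R := ℝ) (by omega)
  obtain ⟨δ, hδ⟩ := exists_ne (0 : LinearMap.ker (f.prod g))
  refine ⟨δ, fun h => hδ (Subtype.ext h), ?_, ?_⟩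
  · exact congrArg Prod.fst (LinearMap.mem_ker.1 δ.2)
  · exact congrArg Prod.snd (LinearMap.mem_ker.1 δ.2)

end

section

theorem fpt_finrank_triple {V : Type*} [AddCommGroup V] [Module ℝ V] (x y z : V)
    (h : ∀ a b c : ℝ, a • x + b • y + c • z = 0 → a = 0 ∧ b = 0 ∧ c = 0) :
    finrank ℝ (Submodule.span ℝ {x, y, z}) = 3 := by
  have hli : LinearIndependent ℝ ![x, y, z] := by
    rw [Fintype.linearIndependent_iff]
    intro g hg
    rw [Fin.sum_univ_three] at hg
    obtain ⟨h0, h1, h2⟩ := h _ _ _ hg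
    intro i
    fin_cases i <;> assumption
  have := finrank_span_eq_card hli
  have hr : Set.range ![x, y, z] = {x, y, z} := by
    ext w; simp [Matrix.range_cons, Matrix.range_empty]; tauto
  rw [hr] at this
  simpa using this

theorem fpt_q {F : Type*} [NormedAddCommGroup F] [NormedSpace ℝ F] (K : Set F)
    (hc : Convex ℝ K) (z x y : F) (hz : z ∈ interior K) (hx : x ∈ K) (hy : y ∈ K) (a b : ℝ)
    (ha : 0 < a) (hb : 0 < b) (hab : a + b = 1) (hzxy : z = a • x + b • y) (ox oy k : ℝ)
    (ho : 0 < ox * oy) (hk : k ≠ 0) (Q : F × ℝ)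
    (hQ : Q = k • (oy • (x, (1:ℝ)) + ox • (y, (1:ℝ)))) :
    ∃ (s : ℝ) (q : F), s ≠ 0 ∧ q ∈ interior K ∧ Q = s • (q, (1:ℝ)) := by
  have hsum : ox + oy ≠ 0 := by
    intro h
    have h' : oy = -ox := by linarith
    rw [h'] at ho
    nlinarith [mul_self_nonneg ox]
  have h1 : 0 < oy / (ox + oy) := by
    have : oy / (ox + oy) = (oy * oy + ox * oy) / (ox + oy) ^ 2 := by field_simp; ring
    rw [this]; apply div_pos _ (by positivity); nlinarith [mul_self_nonneg oy]
  have h2 : 0 < ox / (ox + oy) := by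
    have : ox / (ox + oy) = (ox * ox + ox * oy) / (ox + oy) ^ 2 := by field_simp
    rw [this]; apply div_pos _ (by positivity); nlinarith [mul_self_nonneg ox]
  refine ⟨k * (ox + oy), (oy / (ox + oy)) • x + (ox / (ox + oy)) • y, mul_ne_zero hk hsum,
    fpt_open_seg K hc z x y hz hx hy a b ha hb hab hzxy _ _ h1 h2 (by field_simp; ring), ?_⟩
  rw [hQ]
  ext
  · simp only [Prod.smul_fst, Prod.fst_add]
    match_scalars <;> field_simp
  · simp; left; ring

theorem fpt_avoid {F : Type*} [NormedAddCommGroup F] [NormedSpace ℝ F] (hF : 3 ≤ finrank ℝ F)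
    (K : Set F) (hc : Convex ℝ K) (hk : IsCompact K) (p : F) (hp : p ∈ interior K)
    (ω : F × ℝ →ₗ[ℝ] ℝ) (hS : FptS K p ω) : ∀ x ∈ K, ω (x, 1) ≠ 0 := by
  intro x' hx' hx'0
  have hωp := fpt_p_notin hF K hk p hp ω hS
  have hlin : ∀ (x u : F) (t : ℝ), ω (x + t • u, 1) = ω (x, 1) + t * ω (u, 0) := by
    intro x u t
    have : ((x + t • u, 1) : F × ℝ) = (x, 1) + t • (u, 0) := by ext <;> simp
    rw [this, map_add, map_smul, smul_eq_mul]
  obtain ⟨x0, hx0, hx0K, hω0⟩ : ∃ x0 ∈ frontier K, x0 ∈ K ∧ ω (x0, 1) = 0 := by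
    by_cases h : x' ∈ interior K
    · obtain ⟨δ, hδ, h1, -⟩ := fpt_ker2 hF (ω ∘ₗ LinearMap.inl ℝ F ℝ) 0
      obtain ⟨t, -, h2, h3, -⟩ := fpt_chord K hk x' δ h hδ
      refine ⟨_, h2, h3, ?_⟩
      rw [hlin, hx'0, show ω (δ, 0) = 0 from h1]; simp
    · exact ⟨x', ⟨subset_closure hx', h⟩, hx', hx'0⟩
  obtain ⟨f, hf⟩ := geometric_hahn_banach_open_point hc.interior isOpen_interior hx0.2
  obtain ⟨δ, hδ, h1, h2⟩ := fpt_ker2 hF (ω ∘ₗ LinearMap.inl ℝ F ℝ) (f : F →ₗ[ℝ] ℝ)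
  replace h1 : ω (δ, 0) = 0 := h1
  replace h2 : f δ = 0 := h2
  set W : Submodule ℝ (F × ℝ) := Submodule.span ℝ {(p, (1:ℝ)), (x0, (1:ℝ)), (δ, (0:ℝ))} with hWd
  have hW : finrank ℝ W = 3 := by
    apply fpt_finrank_triple
    intro a b c h
    have e1 := congrArg ω h
    simp only [map_add, map_smul, hω0, h1, smul_eq_mul, mul_zero, add_zero, map_zero] at e1
    have ha : a = 0 := by simpa [hωp] using e1
    have e2 := congrArg Prod.snd h
    have hb : b = 0 := by simpa [ha] using e2
    have e3 := congrArg Prod.fst h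
    have hcc : c = 0 := by simpa [ha, hb, hδ] using e3
    exact ⟨ha, hb, hcc⟩
  have hpW : (p, (1:ℝ)) ∈ W := Submodule.subset_span (by simp)
  have hx0W : (x0, (1:ℝ)) ∈ W := Submodule.subset_span (by simp)
  obtain ⟨Q, hQW, hQ0, hQ⟩ := hS W hW hpW
  obtain ⟨x, y, hx, hy, hxK, hyK, hxy, hxW, hyW, hspan, a, b, ha, hb, hab, hpe⟩ :=
    fpt_line' K hk p hp W hW hpW Q hQW
  obtain ⟨n1, n2, k, hk0, hQe⟩ := hQ x hx y hy hxy hxW hyW hspan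
  have hpos : 0 < ω (x, 1) * ω (y, 1) := by
    by_contra hneg
    have hneg' : ω (x, 1) * ω (y, 1) < 0 :=
      lt_of_le_of_ne (not_lt.1 hneg) (mul_ne_zero n1 n2)
    set ox := ω (x, 1) with hox
    set oy := ω (y, 1) with hoy
    have hd : ox - oy ≠ 0 := by intro h; rw [sub_eq_zero.1 h] at hneg'; nlinarith [mul_self_nonneg oy]
    have c1 : 0 < - oy / (ox - oy) := by
      have : - oy / (ox - oy) = (oy * oy - ox * oy) / (ox - oy) ^ 2 := by field_simp; ring
      rw [this]; apply div_pos _ (by positivity); nlinarith [mul_self_nonneg oy]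
    have c2 : 0 < ox / (ox - oy) := by
      have : ox / (ox - oy) = (ox * ox - ox * oy) / (ox - oy) ^ 2 := by field_simp
      rw [this]; apply div_pos _ (by positivity); nlinarith [mul_self_nonneg ox]
    have c3 : - oy / (ox - oy) + ox / (ox - oy) = 1 := by field_simp; ring
    have hzi := fpt_open_seg K hc p x y hp hxK hyK a b ha hb hab hpe _ _ c1 c2 c3
    set z := (- oy / (ox - oy)) • x + (ox / (ox - oy)) • y with hz
    have hze : (z, (1:ℝ)) = (- oy / (ox - oy)) • (x, (1:ℝ)) + (ox / (ox - oy)) • (y, (1:ℝ)) := by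
      ext
      · simp [hz]
      · simpa using c3.symm
    have hzW : (z, (1:ℝ)) ∈ W := by
      rw [hze]; exact W.add_mem (W.smul_mem _ hxW) (W.smul_mem _ hyW)
    have hz0 : ω (z, 1) = 0 := by
      rw [hze, map_add, map_smul, map_smul, ← hox, ← hoy, smul_eq_mul, smul_eq_mul]
      field_simp; ring
    rw [hWd, Submodule.mem_span_triple] at hzW
    obtain ⟨α, β, γ, he⟩ := hzW
    have e1 := congrArg ω he
    rw [hz0] at e1
    simp only [map_add, map_smul, hω0, h1, smul_eq_mul, mul_zero, add_zero] at e1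
    have hα : α = 0 := by simpa [hωp] using e1
    have e2 := congrArg Prod.snd he
    have hβ : β = 1 := by simpa [hα] using e2
    have e3 := congrArg Prod.fst he
    have hzz : x0 + γ • δ = z := by simpa [hα, hβ] using e3
    have := hf z hzi
    rw [← hzz, map_add, map_smul, h2] at this
    simp at this
  obtain ⟨s, q, hs, hq, hQs⟩ := fpt_q K hc p x y hp hxK hyK a b ha hb hab hpe _ _ k hpos hk0 Q hQe
  have hqx : q - x0 ≠ 0 := by
    intro h; rw [sub_eq_zero.1 h] at hq; exact hx0.2 hq
  obtain ⟨t, ht, hyf, hyK', -⟩ := fpt_chord K hk q (q - x0) hq hqx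
  have hqW : (q, (1:ℝ)) ∈ W := by
    have : (q, (1:ℝ)) = s⁻¹ • Q := by rw [hQs, smul_smul, inv_mul_cancel₀ hs, one_smul]
    rw [this]; exact W.smul_mem _ hQW
  have hye : (q + t • (q - x0), (1:ℝ)) = (1 + t) • (q, (1:ℝ)) - t • (x0, (1:ℝ)) := by
    ext
    · simp; module
    · simp
  refine (hQ x0 hx0 _ hyf ?_ hx0W ?_ ?_).1 hω0
  · intro h
    have h3 : (1 + t) • (q - x0) = 0 := by
      have h4 := sub_eq_zero.2 h
      have h5 : (1 + t) • (q - x0) = -(x0 - (q + t • (q - x0))) := by module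
      rw [h5, h4, neg_zero]
    exact smul_ne_zero (by linarith) hqx h3
  · rw [hye]; exact W.sub_mem (W.smul_mem _ hqW) (W.smul_mem _ hx0W)
  · rw [Submodule.mem_span_pair, hQs]
    refine ⟨s * t / (1 + t), s / (1 + t), ?_⟩
    have : 1 + t ≠ 0 := by linarith
    rw [hye]
    generalize (q, (1:ℝ)) = Z
    generalize (x0, (1:ℝ)) = X
    match_scalars <;> field_simp <;> ring

/-- Normalisation of the functional. -/
theorem fpt_normalise {F : Type*} [NormedAddCommGroup F] [NormedSpace ℝ F]
    (hF : 3 ≤ finrank ℝ F)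
    (K : Set F) (hc : Convex ℝ K) (hk : IsCompact K) (p : F) (hp : p ∈ interior K)
    (ω : F × ℝ →ₗ[ℝ] ℝ) (hS : FptS K p ω) (hP : ¬ FptP K p ω) :
    ∃ ω' : F × ℝ →ₗ[ℝ] ℝ, FptS K p ω' ∧ ¬ FptP K p ω' ∧ ω' (p, 1) = 1 ∧
      ∀ x ∈ K, 0 < ω' (x, 1) := by
  have hωp := fpt_p_notin hF K hk p hp ω hS
  have hne := fpt_avoid hF K hc hk p hp ω hS
  set r := ω (p, 1) with hr
  have key : ∀ (Q X Y : F × ℝ),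
      (ω X ≠ 0 ∧ ω Y ≠ 0 ∧ ∃ k : ℝ, k ≠ 0 ∧ Q = k • (ω Y • X + ω X • Y)) ↔
      ((r⁻¹ • ω) X ≠ 0 ∧ (r⁻¹ • ω) Y ≠ 0 ∧
        ∃ k : ℝ, k ≠ 0 ∧ Q = k • ((r⁻¹ • ω) Y • X + (r⁻¹ • ω) X • Y)) := by
    intro Q X Y
    simp only [LinearMap.smul_apply, smul_eq_mul]
    constructor
    · rintro ⟨h1, h2, k, hk, h3⟩
      refine ⟨by positivity, by positivity, k * r, by positivity, ?_⟩
      rw [h3]; match_scalars <;> field_simp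
    · rintro ⟨h1, h2, k, hk, h3⟩
      refine ⟨right_ne_zero_of_mul h1, right_ne_zero_of_mul h2, k * r⁻¹, by positivity, ?_⟩
      rw [h3]; match_scalars <;> field_simp
  have hp1 : (r⁻¹ • ω) (p, 1) = 1 := by
    rw [LinearMap.smul_apply, ← hr, smul_eq_mul, inv_mul_cancel₀ hωp]
  refine ⟨r⁻¹ • ω, ?_, ?_, hp1, ?_⟩
  · intro W hW hpW
    obtain ⟨Q, h1, h2, h3⟩ := hS W hW hpW
    exact ⟨Q, h1, h2, fun x hx y hy hxy hxW hyW hs => (key _ _ _).1 (h3 x hx y hy hxy hxW hyW hs)⟩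
  · intro h
    apply hP
    intro x hx y hy hxy hs
    exact (key _ _ _).2 (h x hx y hy hxy hs)
  · intro x hx
    by_contra hneg
    have hx0 : (r⁻¹ • ω) (x, 1) ≠ 0 := by
      rw [LinearMap.smul_apply, smul_eq_mul]; exact mul_ne_zero (inv_ne_zero hωp) (hne x hx)
    set o := (r⁻¹ • ω) (x, 1) with ho
    have hlt : o < 0 := lt_of_le_of_ne (not_lt.1 hneg) hx0
    have hd : 0 < 1 - o := by linarith
    have hzK := hc (interior_subset hp) hx (a := - o / (1 - o)) (b := 1 / (1 - o))
      (div_nonneg (by linarith) hd.le) (by positivity) (by field_simp; ring)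
    apply hne _ hzK
    have h1 : (r⁻¹ • ω) ((-o / (1 - o)) • p + (1 / (1 - o)) • x, 1) = 0 := by
      have : ((-o / (1 - o)) • p + (1 / (1 - o)) • x, (1:ℝ)) =
          (-o / (1 - o)) • (p, (1:ℝ)) + (1 / (1 - o)) • (x, (1:ℝ)) := by
        ext
        · simp
        · simp; field_simp; ring
      rw [this, map_add, map_smul, map_smul, hp1, ← ho, smul_eq_mul, smul_eq_mul]
      field_simp; ring
    rw [LinearMap.smul_apply, smul_eq_mul] at h1
    exact (mul_eq_zero.1 h1).resolve_left (inv_ne_zero hωp)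

end

section

theorem fpt_coord {F : Type*} [NormedAddCommGroup F] [NormedSpace ℝ F] [FiniteDimensional ℝ F]
    (P : F × ℝ) (ω : F × ℝ →ₗ[ℝ] ℝ) (hP : ω P = 1) :
    ∃ (j : EuclideanSpace ℝ (Fin (finrank ℝ F)) →ₗ[ℝ] F × ℝ)
      (r : F × ℝ →ₗ[ℝ] EuclideanSpace ℝ (Fin (finrank ℝ F))),
      (∀ X, ω (j X) = 0) ∧ (∀ X, r (j X) = X) ∧ (∀ V, j (r V) = V - ω V • P) := by
  have h1 := LinearMap.finrank_range_add_finrank_ker ω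
  have hs : LinearMap.range ω = ⊤ := by
    rw [LinearMap.range_eq_top]
    intro c
    exact ⟨c • P, by rw [map_smul, hP]; simp⟩
  rw [hs, finrank_top, finrank_self, finrank_prod, finrank_self] at h1
  have h2 : finrank ℝ (EuclideanSpace ℝ (Fin (finrank ℝ F))) = finrank ℝ (LinearMap.ker ω) := by
    rw [finrank_euclideanSpace_fin]; omega
  let ι := LinearEquiv.ofFinrankEq _ _ h2
  let π : F × ℝ →ₗ[ℝ] LinearMap.ker ω :=
    (LinearMap.id - ω.smulRight P).codRestrict (LinearMap.ker ω) (by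
      intro c; rw [LinearMap.mem_ker]; simp [hP])
  have hπ : ∀ V, ((π V : LinearMap.ker ω) : F × ℝ) = V - ω V • P := fun V => rfl
  refine ⟨(LinearMap.ker ω).subtype ∘ₗ ι.toLinearMap, ι.symm.toLinearMap ∘ₗ π, ?_, ?_, ?_⟩
  · intro X; exact (ι X).2
  · intro X
    have : π (ι X) = ι X := by
      apply Subtype.ext
      rw [hπ, LinearMap.mem_ker.1 (ι X).2, zero_smul, sub_zero]
    simp [this]
  · intro V
    simp [hπ]

/-- The section step of the central argument. -/
theorem fpt_sec {F : Type*} [NormedAddCommGroup F] [NormedSpace ℝ F]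
    (K : Set F) (hc : Convex ℝ K) (hk : IsCompact K) (ω : F × ℝ →ₗ[ℝ] ℝ)
    (hpos : ∀ x ∈ K, 0 < ω (x, 1)) (q x : F) (hq : q ∈ interior K) (hx : x ∈ K) (hxq : x ≠ q)
    (s : ℝ) (Q : F × ℝ) (hQs : Q = s • (q, (1:ℝ))) (hQ : ∀ t1 t2 : ℝ, 0 < t1 → 0 < t2 →
      q + t1 • (x - q) ∈ frontier K → q + t2 • (-(x - q)) ∈ frontier K → ∃ k : ℝ, k ≠ 0 ∧
      Q = k • (ω (q + t2 • (-(x - q)), 1) • (q + t1 • (x - q), (1:ℝ)) +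
        ω (q + t1 • (x - q), 1) • (q + t2 • (-(x - q)), (1:ℝ)))) :
    ∃ y ∈ K, ∃ l : ℝ, 0 < l ∧
      (2 * (ω (q, 1))⁻¹) • (q, (1:ℝ)) - (ω (x, 1))⁻¹ • (x, (1:ℝ)) = l • (y, (1:ℝ)) := by
  set u := x - q with hu
  have hu0 : u ≠ 0 := sub_ne_zero.2 hxq
  obtain ⟨t1, ht1, f1, k1, m1⟩ := fpt_chord K hk q u hq hu0
  obtain ⟨t2, ht2, f2, k2, -⟩ := fpt_chord K hk q (-u) hq (neg_ne_zero.2 hu0)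
  have h11 : 1 ≤ t1 := m1 1 (by rw [hu]; simpa using hx)
  obtain ⟨k, hk0, hQe⟩ := hQ t1 t2 ht1 ht2 f1 f2
  have hqK := hpos q (interior_subset hq)
  have hxK := hpos x hx
  set m := ω (u, 0) with hm
  set w := ω (q, 1) with hw
  have e1 : ω (q + t1 • u, 1) = w + t1 * m := by
    have : ((q + t1 • u, 1) : F × ℝ) = (q, 1) + t1 • (u, 0) := by ext <;> simp
    rw [this, map_add, map_smul, smul_eq_mul]
  have e2 : ω (q + t2 • (-u), 1) = w - t2 * m := by
    have : ((q + t2 • (-u), 1) : F × ℝ) = (q, 1) - t2 • (u, 0) := by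
      ext <;> simp [sub_eq_add_neg]
    rw [this, map_sub, map_smul, smul_eq_mul]
  have e3 : ω (x, 1) = w + m := by
    have : ((x, 1) : F × ℝ) = (q, 1) + (u, 0) := by ext <;> simp [hu]
    rw [this, map_add]
  rw [e1, e2, hQs] at hQe
  rw [e3] at hxK
  have c2 : s = k * ((w - t2 * m) + (w + t1 * m)) := by
    simpa using congrArg Prod.snd hQe
  have c1 : s • q = k • ((w - t2 * m) • (q + t1 • u) + (w + t1 * m) • (q + t2 • (-u))) := by
    simpa using congrArg Prod.fst hQe
  have c3 : (w - t2 * m) * t1 = (w + t1 * m) * t2 := by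
    have h4 : (k * ((w - t2 * m) * t1 - (w + t1 * m) * t2)) • u = 0 := by
      have h5 : (k * ((w - t2 * m) * t1 - (w + t1 * m) * t2)) • u =
        k • ((w - t2 * m) • (q + t1 • u) + (w + t1 * m) • (q + t2 • (-u))) - s • q := by
        rw [c2]; module
      rw [h5, ← c1, sub_self]
    rcases smul_eq_zero.1 h4 with h | h
    · rcases mul_eq_zero.1 h with h | h
      · exact absurd h hk0
      · linarith
    · exact absurd h hu0
  have c4 : 0 < w + 2 * m := by
    have : (w + 2 * m) * (t1 * t2) = w * ((t1 - 1) * t2 + t1) := by linear_combination -c3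
    have h5 : 0 < w * ((t1 - 1) * t2 + t1) := by
      apply mul_pos hqK; nlinarith [mul_nonneg (sub_nonneg.2 h11) ht2.le]
    rw [← this] at h5
    exact pos_of_mul_pos_left h5 (by positivity)
  have c5 : w ≤ (w + 2 * m) * t2 := by
    have : ((w + 2 * m) * t2 - w) * t1 = w * (t1 - 1) * t2 := by linear_combination -c3
    have h5 : 0 ≤ w * (t1 - 1) * t2 := by
      have := sub_nonneg.2 h11; positivity
    rw [← this] at h5
    have := nonneg_of_mul_nonneg_left h5 ht1
    linarith
  set τ := w / (w + 2 * m) with hτ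
  have hτ0 : 0 < τ := by positivity
  have hτ1 : τ ≤ t2 := by rw [hτ, div_le_iff₀ c4]; linarith
  refine ⟨q + τ • (-u), ?_, (w + 2 * m) / (w * (w + m)), by positivity, ?_⟩
  · have : q + τ • (-u) = (1 - τ / t2) • q + (τ / t2) • (q + t2 • (-u)) := by
      match_scalars <;> field_simp <;> ring
    rw [this]
    apply hc (interior_subset hq) k2 _ (by positivity) (by ring)
    rw [sub_nonneg, div_le_one ht2]; exact hτ1
  · rw [e3]
    have hx' : x = q + u := by rw [hu]; abel
    ext
    · simp only [Prod.fst_sub, Prod.smul_fst]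
      have g1 : (w + 2 * m) / (w * (w + m)) * τ = (w + m)⁻¹ := by
        rw [hτ]; field_simp
      have g2 : (w + 2 * m) / (w * (w + m)) = 2 * w⁻¹ - (w + m)⁻¹ := by
        field_simp; ring
      have g3 : ((w + 2 * m) / (w * (w + m))) • (q + τ • (-u)) =
          ((w + 2 * m) / (w * (w + m))) • q -
            ((w + 2 * m) / (w * (w + m)) * τ) • u := by module
      rw [hx', g3, g1, g2]
      module
    · simp
      field_simp
      ring

theorem fpt_central {F : Type*} [NormedAddCommGroup F] [NormedSpace ℝ F] (hF : 3 ≤ finrank ℝ F)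
    (K : Set F) (hc : Convex ℝ K) (hk : IsCompact K) (p : F) (hp : p ∈ interior K)
    (ω : F × ℝ →ₗ[ℝ] ℝ) (hS : FptS K p ω) (hP : ¬ FptP K p ω) (hp1 : ω (p, 1) = 1)
    (hpos : ∀ x ∈ K, 0 < ω (x, 1)) :
    ∃ (r : F × ℝ →ₗ[ℝ] EuclideanSpace ℝ (Fin (finrank ℝ F)))
      (o : EuclideanSpace ℝ (Fin (finrank ℝ F)))
      (b : EuclideanSpace ℝ (Fin (finrank ℝ F)) →ₗ[ℝ] EuclideanSpace ℝ (Fin (finrank ℝ F)) →ₗ[ℝ] ℝ),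
      (∀ x y, b x y = b y x) ∧ (∀ x, x ≠ 0 → 0 < b x x) ∧ (∀ V, ω V = 0 → r V = 0 → V = 0) ∧
      ∀ x, x ∈ K ↔ 0 < ω (x, 1) ∧
        b (r (x, 1) - ω (x, 1) • o) (r (x, 1) - ω (x, 1) • o) ≤ ω (x, 1) ^ 2 := by
  have : FiniteDimensional ℝ F := FiniteDimensional.of_finrank_pos (by omega)
  obtain ⟨j, r, hj, hrj, hjr⟩ := fpt_coord (p, (1:ℝ)) ω hp1
  have hjinj : Function.Injective j := Function.LeftInverse.injective hrj
  have hrp : r (p, 1) = 0 := by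
    apply hjinj; rw [hjr, hp1, map_zero]; simp
  set B : Set (EuclideanSpace ℝ (Fin (finrank ℝ F))) :=
    {X | ∃ x ∈ K, ∃ s : ℝ, 0 < s ∧ (p, (1:ℝ)) + j X = s • (x, (1:ℝ))} with hB
  have hΦ : ∀ x ∈ K, (p, (1:ℝ)) + j ((ω (x, 1))⁻¹ • r (x, 1)) = (ω (x, 1))⁻¹ • (x, (1:ℝ)) := by
    intro x hx
    have := (hpos x hx).ne'
    rw [map_smul, hjr]
    match_scalars <;> field_simp
    simp
  have hsc : ∀ (X) (x : F) (s : ℝ), 0 < s → (p, (1:ℝ)) + j X = s • (x, (1:ℝ)) →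
      s = (ω (x, 1))⁻¹ ∧ X = (ω (x, 1))⁻¹ • r (x, 1) := by
    intro X x s hs h
    have h1 := congrArg ω h
    rw [map_add, hp1, hj, map_smul, smul_eq_mul, add_zero] at h1
    have hs' : s = (ω (x, 1))⁻¹ := eq_inv_of_mul_eq_one_left h1.symm
    have h2 := congrArg r h
    rw [map_add, hrp, hrj, map_smul, zero_add] at h2
    exact ⟨hs', by rw [h2, hs']⟩
  have hBc : Convex ℝ B := by
    rintro X ⟨x, hx, s, hs, hX⟩ Y ⟨y, hy, t, ht, hY⟩ a b ha hb hab
    have hst : 0 < a * s + b * t := by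
      rcases ha.eq_or_lt with h | h
      · have : b = 1 := by linarith
        rw [← h, this]; simpa using ht
      · have := mul_pos h hs
        have := mul_nonneg hb ht.le
        linarith
    refine ⟨(a * s / (a * s + b * t)) • x + (b * t / (a * s + b * t)) • y,
      hc hx hy (by positivity) (by positivity) (by field_simp), a * s + b * t, hst, ?_⟩
    have h1 : (p, (1:ℝ)) + j (a • X + b • Y) =
        a • ((p, (1:ℝ)) + j X) + b • ((p, (1:ℝ)) + j Y) := by
      have : (p, (1:ℝ)) = (a + b) • (p, (1:ℝ)) := by rw [hab, one_smul]
      rw [map_add, map_smul, map_smul]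
      conv_lhs => rw [this]
      module
    rw [h1, hX, hY]
    ext
    · simp only [Prod.fst_add, Prod.smul_fst]
      match_scalars <;> field_simp
    · simp
  have hBe : B = (fun x => (ω (x, 1))⁻¹ • r (x, 1)) '' K := by
    ext X
    constructor
    · rintro ⟨x, hx, s, hs, h⟩
      exact ⟨x, hx, (hsc X x s hs h).2.symm⟩
    · rintro ⟨x, hx, rfl⟩
      exact ⟨x, hx, _, inv_pos.2 (hpos x hx), hΦ x hx⟩
  have hωc : Continuous ω := LinearMap.continuous_of_finiteDimensional ω
  have hrc : Continuous r := LinearMap.continuous_of_finiteDimensional r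
  have hjc : Continuous j := LinearMap.continuous_of_finiteDimensional j
  have hBk : IsCompact B := by
    rw [hBe]
    apply hk.image_of_continuousOn
    have c1 : ContinuousOn (fun x => (ω (x, 1))⁻¹) K := by
      apply ContinuousOn.inv₀ (by fun_prop)
      intro x hx; exact (hpos x hx).ne'
    have c2 : ContinuousOn (fun x => r (x, 1)) K := by fun_prop
    exact c1.smul c2
  have hB0 : (0 : EuclideanSpace ℝ (Fin (finrank ℝ F))) ∈ interior B := by
    rw [mem_interior_iff_mem_nhds]
    have hcj : Continuous fun X => ((p, (1:ℝ)) + j X) := by fun_prop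
    have e1 : ∀ᶠ X in nhds (0 : EuclideanSpace ℝ (Fin (finrank ℝ F))),
        0 < ((p, (1:ℝ)) + j X).2 := by
      apply (continuous_snd.comp hcj).continuousAt.eventually (lt_mem_nhds _)
      simp
    have e2 : ∀ᶠ X in nhds (0 : EuclideanSpace ℝ (Fin (finrank ℝ F))),
        (((p, (1:ℝ)) + j X).2)⁻¹ • ((p, (1:ℝ)) + j X).1 ∈ K := by
      have hcont : ContinuousAt (fun X => (((p, (1:ℝ)) + j X).2)⁻¹ • ((p, (1:ℝ)) + j X).1)
          (0 : EuclideanSpace ℝ (Fin (finrank ℝ F))) := by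
        apply ContinuousAt.smul
        · apply ContinuousAt.inv₀ (continuous_snd.comp hcj).continuousAt
          simp
        · exact (continuous_fst.comp hcj).continuousAt
      apply hcont.eventually
      simp only [map_zero, add_zero, inv_one, one_smul]
      exact mem_interior_iff_mem_nhds.1 hp
    filter_upwards [e1, e2] with X h1 h2
    refine ⟨_, h2, _, h1, ?_⟩
    ext
    · rw [Prod.smul_fst, smul_smul, mul_inv_cancel₀ h1.ne', one_smul]
    · simp
  have hBs : ∀ D : Submodule ℝ (EuclideanSpace ℝ (Fin (finrank ℝ F))), finrank ℝ D = 2 →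
      ∃ c ∈ D, ∀ x ∈ B, x ∈ D → (2:ℝ) • c - x ∈ B := by
    intro D hD
    set W : Submodule ℝ (F × ℝ) := Submodule.span ℝ {(p, (1:ℝ))} ⊔ D.map j with hWd
    have hW : finrank ℝ W = 3 := by
      have h1 := Submodule.finrank_sup_add_finrank_inf_eq (Submodule.span ℝ {(p, (1:ℝ))}) (D.map j)
      have h2 : Submodule.span ℝ {(p, (1:ℝ))} ⊓ D.map j = ⊥ := by
        rw [eq_bot_iff]
        rintro V ⟨h1, h2⟩
        obtain ⟨c, hc'⟩ := Submodule.mem_span_singleton.1 h1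
        obtain ⟨X, -, hX⟩ := h2
        have : c = 0 := by
          have h3 := hj X
          rw [hX, ← hc', map_smul, hp1] at h3
          simpa using h3
        rw [Submodule.mem_bot, ← hc', this, zero_smul]
      have h3 : finrank ℝ (D.map j) = 2 := by
        rw [← hD]; exact (Submodule.equivMapOfInjective j hjinj D).finrank_eq.symm
      rw [h2, finrank_bot, finrank_span_singleton (by simp), h3] at h1
      omega
    have hpW : (p, (1:ℝ)) ∈ W :=
      Submodule.mem_sup_left (Submodule.mem_span_singleton_self _)
    have hWr : ∀ V ∈ W, r V ∈ D := by
      have : W ≤ D.comap r := by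
        rw [hWd, sup_le_iff]
        constructor
        · rw [Submodule.span_singleton_le_iff_mem, Submodule.mem_comap, hrp]; exact D.zero_mem
        · rintro _ ⟨X, hX, rfl⟩
          rw [Submodule.mem_comap, hrj]; exact hX
      exact this
    obtain ⟨Q, hQW, hQ0, hQ⟩ := hS W hW hpW
    obtain ⟨x, y, hx, hy, hxK, hyK, hxy, hxW, hyW, hspan, a, b, ha, hb, hab, hpe⟩ :=
      fpt_line' K hk p hp W hW hpW Q hQW
    obtain ⟨-, -, k, hk0, hQe⟩ := hQ x hx y hy hxy hxW hyW hspan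
    obtain ⟨s, q, hs, hq, hQs⟩ := fpt_q K hc p x y hp hxK hyK a b ha hb hab hpe _ _ k
      (mul_pos (hpos x hxK) (hpos y hyK)) hk0 Q hQe
    have hqW : (q, (1:ℝ)) ∈ W := by
      have : (q, (1:ℝ)) = s⁻¹ • Q := by rw [hQs, smul_smul, inv_mul_cancel₀ hs, one_smul]
      rw [this]; exact W.smul_mem _ hQW
    have hqK := interior_subset hq
    refine ⟨(ω (q, 1))⁻¹ • r (q, 1), D.smul_mem _ (hWr _ hqW), ?_⟩
    rintro X ⟨z, hz, l, hl, hX⟩ hXD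
    obtain ⟨hl', hX'⟩ := hsc X z l hl hX
    have hzW : (z, (1:ℝ)) ∈ W := by
      have h1 : (z, (1:ℝ)) = l⁻¹ • ((p, (1:ℝ)) + j X) := by
        rw [hX, smul_smul, inv_mul_cancel₀ hl.ne', one_smul]
      rw [h1]
      exact W.smul_mem _ (W.add_mem hpW (Submodule.mem_sup_right ⟨X, hXD, rfl⟩))
    by_cases hzq : z = q
    · rw [hX', hzq]
      refine ⟨q, hqK, _, inv_pos.2 (hpos q hqK), ?_⟩
      rw [two_smul, add_sub_cancel_right]; exact hΦ q hqK
    obtain ⟨y', hy', l', hl'0, hfin⟩ := fpt_sec K hc hk ω hpos q z hq hz hzq s Q hQs (by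
      intro t1 t2 ht1 ht2 f1 f2
      have hE1 : (q + t1 • (z - q), (1:ℝ)) = (1 - t1) • (q, (1:ℝ)) + t1 • (z, (1:ℝ)) := by
        ext
        · simp; module
        · simp
      have hE2 : (q + t2 • (-(z - q)), (1:ℝ)) = (1 + t2) • (q, (1:ℝ)) - t2 • (z, (1:ℝ)) := by
        ext
        · simp; module
        · simp
      refine (hQ _ f1 _ f2 ?_ ?_ ?_ ?_).2.2
      · intro h
        have h3 : (t1 + t2) • (z - q) = 0 := by
          have h4 := sub_eq_zero.2 h
          rw [← h4]; module
        exact smul_ne_zero (by linarith) (sub_ne_zero.2 hzq) h3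
      · rw [hE1]; exact W.add_mem (W.smul_mem _ hqW) (W.smul_mem _ hzW)
      · rw [hE2]; exact W.sub_mem (W.smul_mem _ hqW) (W.smul_mem _ hzW)
      · rw [Submodule.mem_span_pair, hQs]
        have : t1 + t2 ≠ 0 := by linarith
        refine ⟨s * t2 / (t1 + t2), s * t1 / (t1 + t2), ?_⟩
        rw [hE1, hE2]
        generalize (q, (1:ℝ)) = Z
        generalize (z, (1:ℝ)) = Y
        match_scalars <;> field_simp <;> ring)
    refine ⟨y', hy', l', hl'0, ?_⟩
    rw [← hfin, ← hl', ← hX, mul_smul, ← hΦ q hqK, map_sub, map_smul]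
    module
  have hns : ¬ ∀ x ∈ B, -x ∈ B := by
    intro hsym
    apply hP
    have half : ∀ x ∈ frontier K, ∀ y ∈ frontier K, ∀ a b : ℝ, 0 < a → 0 < b →
        (p, (1:ℝ)) = a • (x, (1:ℝ)) + b • (y, (1:ℝ)) → 1 / 2 ≤ a * ω (x, 1) := by
      intro x hx y hy a b ha hb he
      by_contra hlt
      push Not at hlt
      have hxK : x ∈ K := hk.isClosed.frontier_subset hx
      have hwx := hpos x hxK
      obtain ⟨z, hz, s, hs, h⟩ := hsym ((ω (x, 1))⁻¹ • r (x, 1))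
        ⟨x, hxK, _, inv_pos.2 hwx, hΦ x hxK⟩
      have h1 : (x, (1:ℝ)) = ω (x, 1) • ((2:ℝ) • (p, (1:ℝ)) - s • (z, (1:ℝ))) := by
        rw [← h, map_neg]
        have h2 := hΦ x hxK
        have h3 : (2:ℝ) • (p, (1:ℝ)) - ((p, (1:ℝ)) + -j ((ω (x, 1))⁻¹ • r (x, 1))) =
          (p, (1:ℝ)) + j ((ω (x, 1))⁻¹ • r (x, 1)) := by module
        rw [h3, h2, smul_smul, mul_inv_cancel₀ hwx.ne', one_smul]
      apply hy.2
      refine fpt_int K hc p z y hp hz (1 - 2 * (a * ω (x, 1))) (a * ω (x, 1) * s) b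
        (by linarith) (by positivity) ?_
      have h4 : b • (y, (1:ℝ)) = (p, (1:ℝ)) - a • (x, (1:ℝ)) := by rw [he]; abel
      rw [h4]
      generalize (z, (1:ℝ)) = Z at *
      generalize (p, (1:ℝ)) = P at *
      generalize ω (x, 1) = w at *
      rw [h1]
      module
    intro x hx y hy hxy hpxy
    have hxK : x ∈ K := hk.isClosed.frontier_subset hx
    have hyK : y ∈ K := hk.isClosed.frontier_subset hy
    have hwx := hpos x hxK
    have hwy := hpos y hyK
    obtain ⟨a, b, he⟩ := Submodule.mem_span_pair.1 hpxy
    have hab : a + b = 1 := by simpa using congrArg Prod.snd he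
    have ha : 0 < a := by
      by_contra h
      push Not at h
      apply hy.2
      refine fpt_int K hc p x y hp hxK 1 (-a) b one_pos (by linarith) ?_
      rw [← he]; module
    have hb : 0 < b := by
      by_contra h
      push Not at h
      apply hx.2
      refine fpt_int K hc p y x hp hyK 1 (-b) a one_pos (by linarith) ?_
      rw [← he]; module
    have h1 := half x hx y hy a b ha hb he.symm
    have h2 := half y hy x hx b a hb ha (by rw [← he]; abel)
    have h3 : a * ω (x, 1) + b * ω (y, 1) = 1 := by
      have := congrArg ω he
      rwa [map_add, map_smul, map_smul, hp1, smul_eq_mul, smul_eq_mul] at this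
    have h4 : a = 1 / (2 * ω (x, 1)) := by field_simp; linarith
    have h5 : b = 1 / (2 * ω (y, 1)) := by field_simp; linarith
    refine ⟨hwx.ne', hwy.ne', 1 / (2 * ω (x, 1) * ω (y, 1)), by positivity, ?_⟩
    rw [← he, h4, h5]
    match_scalars <;> field_simp
  obtain ⟨o, b, hbs, hbp, hbB⟩ := fpt_affine (by rw [finrank_euclideanSpace_fin]; exact hF)
    B hBc hBk hB0 hBs hns
  refine ⟨r, o, b, hbs, hbp, ?_, ?_⟩
  · intro V h1 h2
    have := hjr V
    rw [h1, h2, map_zero, zero_smul, sub_zero] at this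
    exact this.symm
  · intro x
    have scale : 0 < ω (x, 1) → ((ω (x, 1))⁻¹ • r (x, 1) ∈ B ↔
        b (r (x, 1) - ω (x, 1) • o) (r (x, 1) - ω (x, 1) • o) ≤ ω (x, 1) ^ 2) := by
      intro hw
      rw [hbB]
      have : r (x, 1) - ω (x, 1) • o = ω (x, 1) • ((ω (x, 1))⁻¹ • r (x, 1) - o) := by
        rw [smul_sub, smul_smul, mul_inv_cancel₀ hw.ne', one_smul]
      rw [this, LinearMap.map_smul₂, map_smul, smul_eq_mul, smul_eq_mul, ← mul_assoc,
        ← pow_two]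
      constructor
      · intro h; exact mul_le_of_le_one_right (by positivity) h
      · intro h; exact le_of_mul_le_mul_left (by rwa [mul_one]) (by positivity : 0 < ω (x, 1) ^ 2)
    constructor
    · intro hx
      exact ⟨hpos x hx, (scale (hpos x hx)).1 ⟨x, hx, _, inv_pos.2 (hpos x hx), hΦ x hx⟩⟩
    · rintro ⟨hw, h⟩
      obtain ⟨y, hy, s, hs, h2⟩ := (scale hw).2 h
      have h3 : (ω (x, 1))⁻¹ • (x, (1:ℝ)) = s • (y, (1:ℝ)) := by
        rw [← h2, map_smul, hjr]
        match_scalars <;> field_simp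
        simp
      have h4 : (ω (x, 1))⁻¹ = s := by simpa using congrArg Prod.snd h3
      have h5 : (ω (x, 1))⁻¹ • x = s • y := by simpa using congrArg Prod.fst h3
      rw [h4] at h5
      rwa [smul_right_injective F hs.ne' h5]

end

section

theorem fpt_back {F E : Type*} [NormedAddCommGroup F] [NormedSpace ℝ F] [FiniteDimensional ℝ F]
    [Nontrivial F] [AddCommGroup E] [Module ℝ E]
    (K : Set F) (hk : IsCompact K) (p : F) (hp : p ∈ interior K)
    (ω : F × ℝ →ₗ[ℝ] ℝ) (ψ : F × ℝ →ₗ[ℝ] E) (b : E →ₗ[ℝ] E →ₗ[ℝ] ℝ) (hbs : ∀ x y, b x y = b y x)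
    (hbp : ∀ x, x ≠ 0 → 0 < b x x) (hinj : ∀ V, ω V = 0 → ψ V = 0 → V = 0)
    (hK : ∀ x, x ∈ K ↔ 0 < ω (x, 1) ∧ b (ψ (x, 1)) (ψ (x, 1)) ≤ ω (x, 1) ^ 2) :
    ∃ (c : F →ₗ[ℝ] F →ₗ[ℝ] ℝ) (o : F) (ρ : ℝ), (∀ x y, c x y = c y x) ∧
      (∀ x, x ≠ 0 → 0 < c x x) ∧ 0 < ρ ∧ ∀ x, x ∈ K ↔ c (x - o) (x - o) ≤ ρ := by
  have hbn : ∀ x, 0 ≤ b x x := by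
    intro x
    by_cases h : x = 0
    · rw [h]; simp
    · exact (hbp x h).le
  have hpK := (hK p).1 (interior_subset hp)
  have hsplit : ∀ x u : F, ∀ t : ℝ, ((x + t • u, 1) : F × ℝ) = (x, 1) + t • (u, 0) := by
    intro x u t; ext <;> simp
  -- positivity along nonnegative directions
  have pos0 : ∀ x : F, x ≠ 0 → 0 ≤ ω (x, 0) → ω (x, 0) ^ 2 < b (ψ (x, 0)) (ψ (x, 0)) := by
    intro x hx hα
    by_contra hle
    push Not at hle
    rcases hα.eq_or_lt with h0 | h0
    · rw [← h0] at hle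
      have h1 : ψ (x, 0) = 0 := by
        by_contra h
        have := hbp _ h
        nlinarith
      have := hinj (x, 0) h0.symm h1
      exact hx (congrArg Prod.fst this)
    · obtain ⟨t, ht, -, -, hmax⟩ := fpt_chord K hk p x hp hx
      have : p + (t + 1) • x ∈ K := by
        rw [hK, hsplit]
        simp only [map_add, map_smul, LinearMap.add_apply, LinearMap.smul_apply, smul_eq_mul]
        obtain ⟨hβ, hS⟩ := hpK
        have hcs := hbn (ω (x, 0) • ψ (p, 1) - ω (p, 1) • ψ (x, 0))
        simp only [map_sub, map_smul, LinearMap.sub_apply, LinearMap.smul_apply, smul_eq_mul] at hcs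
        rw [hbs (ψ (x, 0)) (ψ (p, 1))] at hcs ⊢
        generalize ω (x, 0) = α at *
        generalize ω (p, 1) = β at *
        generalize b (ψ (p, 1)) (ψ (x, 0)) = m at *
        generalize b (ψ (p, 1)) (ψ (p, 1)) = s at *
        generalize b (ψ (x, 0)) (ψ (x, 0)) = r at *
        have hm : m ≤ α * β := by
          have h1 := mul_le_mul_of_nonneg_left hS (sq_nonneg α)
          have h2 := mul_le_mul_of_nonneg_left hle (sq_nonneg β)
          have h3 : 0 ≤ (α * β) * (α * β - m) := by nlinarith
          have := nonneg_of_mul_nonneg_right h3 (by positivity)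
          linarith
        refine ⟨by positivity, ?_⟩
        have h4 := mul_le_mul_of_nonneg_left hm (by positivity : 0 ≤ t + 1)
        have h5 := mul_le_mul_of_nonneg_left hle (by positivity : 0 ≤ (t + 1) ^ 2)
        nlinarith
      have := hmax _ this
      linarith
  let ωl : F →ₗ[ℝ] ℝ := ω ∘ₗ LinearMap.inl ℝ F ℝ
  let ψl : F →ₗ[ℝ] E := ψ ∘ₗ LinearMap.inl ℝ F ℝ
  let c : F →ₗ[ℝ] F →ₗ[ℝ] ℝ := b.compl₁₂ ψl ψl - ωl.smulRight ωl
  have hcd : ∀ x y, c x y = b (ψ (x, 0)) (ψ (y, 0)) - ω (x, 0) * ω (y, 0) := fun x y => rfl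
  have hcs : ∀ x y, c x y = c y x := by
    intro x y; rw [hcd, hcd, hbs, mul_comm]
  have hcp : ∀ x, x ≠ 0 → 0 < c x x := by
    intro x hx
    rcases le_total 0 (ω (x, 0)) with h | h
    · have := pos0 x hx h
      rw [hcd]; linarith
    · have hn : ω (-x, 0) = - ω (x, 0) := by
        rw [← map_neg]; simp
      have hn' : ψ (-x, 0) = - ψ (x, 0) := by
        rw [← map_neg]; simp
      have := pos0 (-x) (neg_ne_zero.2 hx) (by rw [hn]; linarith)
      rw [hn, hn'] at this
      simp only [map_neg, LinearMap.neg_apply, neg_neg] at this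
      rw [hcd]; linarith
  have hcn : ∀ x, 0 ≤ c x x := by
    intro x
    by_cases h : x = 0
    · rw [h]; simp
    · exact (hcp x h).le
  have hcinj : Function.Injective c := by
    rw [injective_iff_map_eq_zero]
    intro x hx
    by_contra h
    have := hcp x h
    rw [hx] at this
    simp at this
  have hcsurj : Function.Surjective c :=
    (LinearMap.injective_iff_surjective_of_finrank_eq_finrank
      (by rw [Module.finrank_linearMap, finrank_self, mul_one])).1 hcinj
  let ℓ : F →ₗ[ℝ] ℝ := (b (ψ (0, 1))) ∘ₗ ψl - ω (0, 1) • ωl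
  have hℓ : ∀ x, ℓ x = b (ψ (0, 1)) (ψ (x, 0)) - ω (0, 1) * ω (x, 0) := fun x => rfl
  obtain ⟨o, ho⟩ := hcsurj (-ℓ)
  have ho' : ∀ x, c o x = - ℓ x := fun x => by rw [ho]; rfl
  set ρ : ℝ := c o o - (b (ψ (0, 1)) (ψ (0, 1)) - ω (0, 1) ^ 2) with hρ
  have hG : ∀ x, b (ψ (x, 1)) (ψ (x, 1)) - ω (x, 1) ^ 2 = c (x - o) (x - o) - ρ := by
    intro x
    have e1 : ((x, 1) : F × ℝ) = (0, 1) + (x, 0) := by ext <;> simp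
    have e2 : c (x - o) (x - o) = c x x - 2 * c o x + c o o := by
      simp only [map_sub, LinearMap.sub_apply]
      rw [hcs x o]; ring
    rw [e2, ho', hρ, e1, hcd x x, hℓ]
    simp only [map_add, LinearMap.add_apply]
    rw [hbs (ψ (x, 0)) (ψ (0, 1))]
    ring
  have hne : ∀ x, c (x - o) (x - o) ≤ ρ → ω (x, 1) ≠ 0 := by
    intro x hx h0
    have h1 := hG x
    rw [h0] at h1
    have h2 : ψ (x, 1) = 0 := by
      by_contra h
      have := hbp _ h
      nlinarith
    have := hinj _ h0 h2
    simpa using congrArg Prod.snd this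
  have hpo : c (p - o) (p - o) ≤ ρ := by
    have := hG p; linarith [hpK.2]
  have hmain : ∀ x, x ∈ K ↔ c (x - o) (x - o) ≤ ρ := by
    intro x
    constructor
    · intro hx
      have := hG x; linarith [((hK x).1 hx).2]
    · intro hx
      rw [hK]
      refine ⟨?_, by have := hG x; linarith⟩
      by_contra hneg
      have hlt : ω (x, 1) < 0 := lt_of_le_of_ne (not_lt.1 hneg) (hne x hx)
      set L1 := ω (x, 1) with hL1
      set L0 := ω (p, 1) with hL0
      have hL0p : 0 < L0 := hpK.1
      have hd : 0 < L0 - L1 := by linarith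
      set μ := L0 / (L0 - L1) with hμ
      have hμ0 : 0 ≤ μ := by positivity
      have hμ1 : 0 ≤ 1 - μ := by rw [hμ, sub_nonneg, div_le_one hd]; linarith
      apply hne (p + μ • (x - p))
      · have e1 : p + μ • (x - p) - o = (1 - μ) • (p - o) + μ • (x - o) := by module
        have e2 : c (p + μ • (x - p) - o) (p + μ • (x - p) - o) =
            (1 - μ) * c (p - o) (p - o) + μ * c (x - o) (x - o) -
              μ * (1 - μ) * c ((x - o) - (p - o)) ((x - o) - (p - o)) := by
          rw [e1]
          generalize p - o = y
          generalize x - o = z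
          simp only [map_add, map_sub, map_smul, LinearMap.add_apply, LinearMap.sub_apply,
            LinearMap.smul_apply, smul_eq_mul]
          rw [hcs z y]; ring
        rw [e2]
        have := mul_nonneg (mul_nonneg hμ0 hμ1) (hcn ((x - o) - (p - o)))
        have := mul_le_mul_of_nonneg_left hpo hμ1
        have := mul_le_mul_of_nonneg_left hx hμ0
        linarith
      · have e1 : ((p + μ • (x - p), 1) : F × ℝ) = (1 - μ) • (p, 1) + μ • (x, 1) := by
          ext
          · simp; module
          · simp
        rw [e1, map_add, map_smul, map_smul, ← hL0, ← hL1, smul_eq_mul, smul_eq_mul, hμ]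
        field_simp; ring
  refine ⟨c, o, ρ, hcs, hcp, ?_, hmain⟩
  have hρ0 : 0 ≤ ρ := (hcn _).trans hpo
  rcases hρ0.eq_or_lt with h | h
  · exfalso
    have huniq : ∀ x ∈ K, x = o := by
      intro x hx
      by_contra hxo
      have h1 := hcp _ (sub_ne_zero.2 hxo)
      have h2 := (hmain x).1 hx
      linarith
    obtain ⟨u, hu⟩ := exists_ne (0 : F)
    obtain ⟨t, ht, -, h1, -⟩ := fpt_chord K hk p u hp hu
    have h2 := huniq _ h1
    rw [← huniq p (interior_subset hp)] at h2
    exact smul_ne_zero ht.ne' hu (by simpa using h2)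
  · exact h

theorem fpt_diag {d : ℕ} (c : (Fin d → ℝ) →ₗ[ℝ] (Fin d → ℝ) →ₗ[ℝ] ℝ) (hcs : ∀ x y, c x y = c y x)
    (hcp : ∀ x, x ≠ 0 → 0 < c x x) :
    ∃ A : (Fin d → ℝ) ≃ₗ[ℝ] (Fin d → ℝ), ∀ x, c x x = ∑ i, (A x i) ^ 2 := by
  obtain ⟨w, hw, ⟨e⟩⟩ := QuadraticForm.equivalent_one_neg_one_weighted_sum_squared
    (LinearMap.BilinMap.toQuadraticMap c) (by
      rw [QuadraticMap.associated_left_inverse _ hcs]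
      intro x hx
      by_contra h
      exact (hcp x h).ne' (hx x))
  have hval : ∀ x, c x x = ∑ i, w i * (e x i * e x i) := by
    intro x
    have := e.map_app' x
    rw [LinearMap.BilinMap.toQuadraticMap_apply] at this
    rw [← this, QuadraticMap.weightedSumSquares_apply]
    rfl
  have hw1 : ∀ i, w i = 1 := by
    intro i
    rcases hw i with h | h
    · exfalso
      set x := e.symm (Pi.single i 1) with hx
      have hex : e x = Pi.single i 1 := e.apply_symm_apply _
      have hx0 : x ≠ 0 := by
        intro h0
        have h1 : e x = 0 := by rw [h0]; exact map_zero e.toLinearEquiv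
        rw [hex] at h1
        simpa using congrFun h1 i
      have h2 := hcp x hx0
      rw [hval, hex, Finset.sum_eq_single i] at h2
      · simp [h] at h2
        linarith
      · intro j _ hj; simp [hj]
      · simp
    · exact h
  have hd : finrank ℝ (Fin d → ℝ) = d := by simp
  refine ⟨e.toLinearEquiv.trans (LinearEquiv.funCongrLeft ℝ ℝ (finCongr hd.symm)), ?_⟩
  intro x
  rw [hval, ← (finCongr hd.symm).sum_comp]
  apply Finset.sum_congr rfl
  intro i _
  rw [hw1, one_mul, pow_two]
  rfl

/-- Everything except the projective bookkeeping. -/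
theorem fpt_main_lin {F : Type*} [NormedAddCommGroup F] [NormedSpace ℝ F] (hF : 3 ≤ finrank ℝ F)
    (K : Set F) (hc : Convex ℝ K) (hk : IsCompact K) (p : F) (hp : p ∈ interior K)
    (ω : F × ℝ →ₗ[ℝ] ℝ) (hS : FptS K p ω) (hP : ¬ FptP K p ω) :
    ∃ (c : F →ₗ[ℝ] F →ₗ[ℝ] ℝ) (o : F) (ρ : ℝ), (∀ x y, c x y = c y x) ∧
      (∀ x, x ≠ 0 → 0 < c x x) ∧ 0 < ρ ∧ ∀ x, x ∈ K ↔ c (x - o) (x - o) ≤ ρ := by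
  have : FiniteDimensional ℝ F := FiniteDimensional.of_finrank_pos (by omega)
  have : Nontrivial F := Module.nontrivial_of_finrank_pos (R := ℝ) (by omega)
  obtain ⟨ω', hS', hP', hp1, hpos⟩ := fpt_normalise hF K hc hk p hp ω hS hP
  obtain ⟨r, o, b, hbs, hbp, hinj, hK⟩ := fpt_central hF K hc hk p hp ω' hS' hP' hp1 hpos
  refine fpt_back K hk p hp ω' (r - ω'.smulRight o) b hbs hbp ?_ ?_
  · intro V h1 h2
    apply hinj V h1
    simpa [h1] using h2
  · intro x
    exact hK x

end

/-- Homogeneous coordinates. -/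
def fptSnoc (d : ℕ) : ((Fin d → ℝ) × ℝ) ≃ₗ[ℝ] PV d where
  toFun v := Fin.snoc (α := fun _ => ℝ) v.1 v.2
  invFun w := (fun i => w i.castSucc, w (Fin.last d))
  map_add' v w := by
    ext i
    refine Fin.lastCases ?_ (fun j => ?_) i <;> simp
  map_smul' r v := by
    ext i
    refine Fin.lastCases ?_ (fun j => ?_) i <;> simp
  left_inv v := by ext <;> simp
  right_inv w := by
    ext i
    refine Fin.lastCases ?_ (fun j => ?_) i <;> simp

/-- Homogeneous coordinates for a chart. -/
def fptHat {d : ℕ} (e : PV d ≃ₗ[ℝ] PV d) : ((Fin d → ℝ) × ℝ) ≃ₗ[ℝ] PV d := (fptSnoc d).trans e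

theorem fptHat_ne {d : ℕ} (e : PV d ≃ₗ[ℝ] PV d) (v : (Fin d → ℝ) × ℝ) (hv : v ≠ 0) :
    fptHat e v ≠ 0 := (LinearEquiv.map_ne_zero_iff _).2 hv

theorem fpt_chartMap {d : ℕ} (e : PV d ≃ₗ[ℝ] PV d) (x : Fin d → ℝ) :
    chartMap e x = Projectivization.mk ℝ (fptHat e (x, 1)) (fptHat_ne e _ (by simp)) := rfl

theorem fpt_mk_surj {d : ℕ} (e : PV d ≃ₗ[ℝ] PV d) (q : RP d) :
    ∃ (v : (Fin d → ℝ) × ℝ) (hv : v ≠ 0), q = Projectivization.mk ℝ (fptHat e v) (fptHat_ne e v hv) := by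
  have h : (fptHat e).symm q.rep ≠ 0 := (LinearEquiv.map_ne_zero_iff _).2 q.rep_nonzero
  refine ⟨(fptHat e).symm q.rep, h, ?_⟩
  have : ∀ (w : PV d) (hw : w ≠ 0), w = q.rep → q = Projectivization.mk ℝ w hw := by
    rintro w hw rfl; exact q.mk_rep.symm
  exact this _ _ (by simp)

theorem fpt_mem_line {d : ℕ} (e : PV d ≃ₗ[ℝ] PV d) (a b v : (Fin d → ℝ) × ℝ) (ha : a ≠ 0)
    (hb : b ≠ 0) (hv : v ≠ 0) :
    Projectivization.mk ℝ (fptHat e v) (fptHat_ne e v hv) ∈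
      projLine (Projectivization.mk ℝ (fptHat e a) (fptHat_ne e a ha))
        (Projectivization.mk ℝ (fptHat e b) (fptHat_ne e b hb)) ↔ v ∈ Submodule.span ℝ {a, b} := by
  unfold projLine
  rw [mem_ofPred_eq, Projectivization.submodule_mk, Projectivization.submodule_mk,
    Projectivization.submodule_mk, Submodule.span_singleton_le_iff_mem, ← Submodule.span_union,
    Set.singleton_union, Submodule.mem_span_pair, Submodule.mem_span_pair]
  simp only [← map_smul, ← map_add]
  constructor
  · rintro ⟨s, t, h⟩; exact ⟨s, t, (fptHat e).injective h⟩
  · rintro ⟨s, t, h⟩; exact ⟨s, t, by rw [h]⟩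

theorem fpt_mem_proj {d : ℕ} (e : PV d ≃ₗ[ℝ] PV d) (v : (Fin d → ℝ) × ℝ) (hv : v ≠ 0)
    (W : Submodule ℝ (PV d)) :
    Projectivization.mk ℝ (fptHat e v) (fptHat_ne e v hv) ∈ projSet W ↔ fptHat e v ∈ W := by
  unfold projSet
  rw [mem_ofPred_eq, Projectivization.submodule_mk, Submodule.span_singleton_le_iff_mem]

theorem fpt_mk_eq {d : ℕ} (e : PV d ≃ₗ[ℝ] PV d) (v : (Fin d → ℝ) × ℝ) (hv : v ≠ 0)
    (w : PV d) (hw : w ≠ 0)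
    (h : Projectivization.mk ℝ (fptHat e v) (fptHat_ne e v hv) = Projectivization.mk ℝ w hw) :
    ∃ k : ℝ, k ≠ 0 ∧ w = fptHat e (k • v) := by
  obtain ⟨k, hk⟩ := (Projectivization.mk_eq_mk_iff' ℝ _ _ _ _).1 h.symm
  refine ⟨k, ?_, by rw [map_smul, hk]⟩
  rintro rfl
  rw [zero_smul] at hk
  exact hw hk.symm

theorem fpt_harm {d : ℕ} (e : PV d ≃ₗ[ℝ] PV d) (a b g r : (Fin d → ℝ) × ℝ) (ha : a ≠ 0)
    (hb : b ≠ 0) (hg : g ≠ 0) (hr : r ≠ 0)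
    (h : HarmonicQuad (Projectivization.mk ℝ (fptHat e a) (fptHat_ne e a ha))
        (Projectivization.mk ℝ (fptHat e b) (fptHat_ne e b hb))
        (Projectivization.mk ℝ (fptHat e g) (fptHat_ne e g hg))
        (Projectivization.mk ℝ (fptHat e r) (fptHat_ne e r hr))) :
    ∃ α β δ : ℝ, α ≠ 0 ∧ β ≠ 0 ∧ δ ≠ 0 ∧ g = α • a + β • b ∧ r = δ • (α • a - β • b) := by
  obtain ⟨a', b', ha', hb', h1, h2, e1, e2, e3, e4⟩ := h
  obtain ⟨ka, hka, rfl⟩ := fpt_mk_eq e a ha a' ha' e1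
  obtain ⟨kb, hkb, rfl⟩ := fpt_mk_eq e b hb b' hb' e2
  obtain ⟨kg, hkg, e5⟩ := fpt_mk_eq e g hg _ h1 e3
  obtain ⟨kr, hkr, e6⟩ := fpt_mk_eq e r hr _ h2 e4
  rw [← map_add] at e5
  rw [← map_sub] at e6
  have e5' := (fptHat e).injective e5
  have e6' := (fptHat e).injective e6
  refine ⟨kg⁻¹ * ka, kg⁻¹ * kb, kr⁻¹ * kg, by positivity, by positivity, by positivity, ?_, ?_⟩
  · rw [mul_smul, mul_smul, ← smul_add, e5', smul_smul, inv_mul_cancel₀ hkg, one_smul]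
  · rw [mul_smul kg⁻¹, mul_smul kg⁻¹, ← smul_sub, e6', smul_smul, smul_smul]
    field_simp
    simp

theorem fpt_harm_mk {d : ℕ} (e : PV d ≃ₗ[ℝ] PV d) (a b g r : (Fin d → ℝ) × ℝ) (ha : a ≠ 0)
    (hb : b ≠ 0) (hg : g ≠ 0) (hr : r ≠ 0) (α β k l : ℝ) (hα : α ≠ 0) (hβ : β ≠ 0)
    (h1 : g = k • (α • a + β • b)) (h2 : r = l • (α • a - β • b)) :
    HarmonicQuad (Projectivization.mk ℝ (fptHat e a) (fptHat_ne e a ha))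
        (Projectivization.mk ℝ (fptHat e b) (fptHat_ne e b hb))
        (Projectivization.mk ℝ (fptHat e g) (fptHat_ne e g hg))
        (Projectivization.mk ℝ (fptHat e r) (fptHat_ne e r hr)) := by
  have n1 : α • a + β • b ≠ 0 := by
    intro h; rw [h, smul_zero] at h1; exact hg h1
  have n2 : α • a - β • b ≠ 0 := by
    intro h; rw [h, smul_zero] at h2; exact hr h2
  have s1 : fptHat e (α • a) + fptHat e (β • b) = fptHat e (α • a + β • b) := (map_add _ _ _).symm
  have s2 : fptHat e (α • a) - fptHat e (β • b) = fptHat e (α • a - β • b) := (map_sub _ _ _).symm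
  refine ⟨fptHat e (α • a), fptHat e (β • b), fptHat_ne e _ (smul_ne_zero hα ha),
    fptHat_ne e _ (smul_ne_zero hβ hb), by rw [s1]; exact fptHat_ne e _ n1,
    by rw [s2]; exact fptHat_ne e _ n2, ?_, ?_, ?_, ?_⟩
  · rw [Projectivization.mk_eq_mk_iff']
    exact ⟨α⁻¹, by rw [map_smul, smul_smul, inv_mul_cancel₀ hα, one_smul]⟩
  · rw [Projectivization.mk_eq_mk_iff']
    exact ⟨β⁻¹, by rw [map_smul, smul_smul, inv_mul_cancel₀ hβ, one_smul]⟩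
  · rw [Projectivization.mk_eq_mk_iff']
    exact ⟨k, by rw [s1, ← map_smul, ← h1]⟩
  · rw [Projectivization.mk_eq_mk_iff']
    exact ⟨l, by rw [s2, ← map_smul, ← h2]⟩

theorem fpt_hat_indep {F : Type*} [AddCommGroup F] [Module ℝ F] (x y : F) (hxy : x ≠ y) (a b : ℝ)
    (h : a • (x, (1:ℝ)) + b • (y, (1:ℝ)) = 0) : a = 0 ∧ b = 0 := by
  have h2 : a + b = 0 := by simpa using congrArg Prod.snd h
  have h1 : a • x + b • y = 0 := by simpa using congrArg Prod.fst h
  have hb : b = -a := by linarith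
  rw [hb] at h1
  have h3 : a • (x - y) = 0 := by rw [← h1]; module
  rcases smul_eq_zero.1 h3 with h | h
  · exact ⟨h, by rw [hb, h, neg_zero]⟩
  · exact absurd (sub_eq_zero.1 h) hxy

theorem fpt_chart_inj {d : ℕ} (e : PV d ≃ₗ[ℝ] PV d) (x y : Fin d → ℝ)
    (h : chartMap e x = chartMap e y) : x = y := by
  rw [fpt_chartMap, fpt_chartMap] at h
  obtain ⟨k, hk, h1⟩ := fpt_mk_eq e (x, 1) (by simp) _ _ h
  have h2 := (fptHat e).injective h1
  by_contra hxy
  have := (fpt_hat_indep x y hxy k (-1) (by rw [← h2]; simp)).2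
  norm_num at this

theorem fpt_frontier {F : Type*} [NormedAddCommGroup F] [NormedSpace ℝ F]
    (K S : Set F) (hc : Convex ℝ K) (hS : S ⊆ K) (p x : F) (hp : p ∈ interior K)
    (hx : x ∈ frontier K) (hpS : p ∈ S) (hxS : x ∈ S) : x ∈ intrinsicFrontier ℝ S := by
  have hpA := subset_affineSpan ℝ S hpS
  have hxA := subset_affineSpan ℝ S hxS
  refine ⟨⟨x, hxA⟩, ⟨subset_closure hxS, ?_⟩, rfl⟩
  intro hi
  let g : ℝ → affineSpan ℝ S := fun t => ⟨AffineMap.lineMap p x t, AffineMap.lineMap_mem t hpA hxA⟩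
  have hg : Continuous g := by
    apply Continuous.subtype_mk
    exact AffineMap.lineMap_continuous
  have hg1 : g 1 = ⟨x, hxA⟩ := by
    apply Subtype.ext; simp [g]
  rw [← hg1] at hi
  obtain ⟨ε, hε, hball⟩ := Metric.isOpen_iff.1 (isOpen_interior.preimage hg) 1 hi
  have hmem : 1 + ε / 2 ∈ Metric.ball (1:ℝ) ε := by
    rw [Metric.mem_ball, Real.dist_eq, add_sub_cancel_left, abs_of_pos (by positivity)]; linarith
  have h3 : g (1 + ε / 2) ∈ interior ((↑) ⁻¹' S : Set (affineSpan ℝ S)) := hball hmem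
  have h4 : AffineMap.lineMap p x (1 + ε / 2) ∈ S := by
    have h3a := interior_subset h3
    exact h3a
  have h5 := hS h4
  apply hx.2
  refine fpt_int K hc p _ x hp h5 (ε / 2) 1 (1 + ε / 2) (by positivity) (by norm_num) ?_
  rw [AffineMap.lineMap_apply_module]
  ext
  · simp only [Prod.fst_add, Prod.smul_fst]; module
  · simp; ring

theorem fpt_functional {V : Type*} [AddCommGroup V] [Module ℝ V] [FiniteDimensional ℝ V] (n : ℕ)
    (hV : finrank ℝ V = n + 1) (W : Submodule ℝ V) (hW : finrank ℝ W = n) :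
    ∃ f : V →ₗ[ℝ] ℝ, ∀ v, f v = 0 ↔ v ∈ W := by
  have h1 := W.finrank_quotient_add_finrank
  let E : (V ⧸ W) ≃ₗ[ℝ] ℝ := LinearEquiv.ofFinrankEq _ _ (by rw [finrank_self]; omega)
  refine ⟨E.toLinearMap ∘ₗ W.mkQ, fun v => ?_⟩
  simp

/-- **False Pole Theorem** -/
theorem false_pole_theorem {d : ℕ} (hd : 3 ≤ d)
    -- `K ⊆ ℝ^d` is a convex body, regarded as a subset of an affine chart of `ℝP^d`
    (e : PV d ≃ₗ[ℝ] PV d) (K : Set (Fin d → ℝ))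
    (hconv : Convex ℝ K) (hcpt : IsCompact K) (hint : (interior K).Nonempty)
    -- `p` is an interior point of `K`
    (p : Fin d → ℝ) (hp : p ∈ interior K)
    -- `H` is a hyperplane of `ℝP^d`
    (H : Set (RP d)) (WH : Submodule ℝ (PV d)) (hWH : Module.finrank ℝ WH = d)
    (hH : H = projSet WH)
    -- `p` is a false pole of `K` with respect to `H`
    (hfp : IsFalsePole e K (chartMap e p) H) :
    IsEllipsoidIn d K := by
  obtain ⟨f, hf⟩ := fpt_functional d (by simp) WH hWH
  set ω : (Fin d → ℝ) × ℝ →ₗ[ℝ] ℝ := f ∘ₗ (fptHat e).toLinearMap with hωd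
  have hω : ∀ v, ω v = 0 ↔ fptHat e v ∈ WH := fun v => hf _
  have hat0 : ∀ x : Fin d → ℝ, (x, (1:ℝ)) ≠ 0 := fun x => by simp
  have hS : FptS K p ω := by
    intro W hW hpW
    have hW' : finrank ℝ (W.map (fptHat e).toLinearMap) = 3 := by
      rw [← hW]; exact ((fptHat e).submoduleMap W).finrank_eq.symm
    have hmap : ∀ v, fptHat e v ∈ W.map (fptHat e).toLinearMap ↔ v ∈ W := by
      intro v
      constructor
      · rintro ⟨w, hw, h⟩
        rwa [← (fptHat e).injective h]
      · intro h; exact ⟨v, h, rfl⟩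
    obtain ⟨q, hqW, hq⟩ := hfp.2 (W.map (fptHat e).toLinearMap) hW'
      ((fpt_mem_proj e (p, 1) (hat0 p) _).2 ((hmap _).2 hpW))
    obtain ⟨Q, hQ0, rfl⟩ := fpt_mk_surj e q
    have hQW : Q ∈ W := (hmap Q).1 ((fpt_mem_proj e Q hQ0 _).1 hqW)
    refine ⟨Q, hQW, hQ0, ?_⟩
    intro x hx y hy hxy hxW hyW hspan
    have hfr : ∀ z ∈ frontier K, (z, (1:ℝ)) ∈ W →
        chartMap e z ∈ sectionFrontier e K (W.map (fptHat e).toLinearMap) := by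
      intro z hz hzW
      refine ⟨z, ?_, rfl⟩
      apply fpt_frontier K _ hconv inter_subset_right p z hp hz
      · exact ⟨(fpt_mem_proj e (p, 1) (hat0 p) _).2 ((hmap _).2 hpW), interior_subset hp⟩
      · exact ⟨(fpt_mem_proj e (z, 1) (hat0 z) _).2 ((hmap _).2 hzW),
          hcpt.isClosed.frontier_subset hz⟩
    have hspW : Submodule.span ℝ {(x, (1:ℝ)), (y, (1:ℝ))} ≤ W := by
      rw [Submodule.span_le]
      rintro v (rfl | rfl)
      · exact hxW
      · exact hyW
    -- the harmonic relation for every point of the line lying on the polar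
    have hharm : ∀ R : (Fin d → ℝ) × ℝ, R ≠ 0 → R ∈ Submodule.span ℝ {(x, (1:ℝ)), (y, (1:ℝ))} →
        ω R = 0 → ∃ α β δ : ℝ, α ≠ 0 ∧ β ≠ 0 ∧ δ ≠ 0 ∧ Q = α • (x, (1:ℝ)) + β • (y, (1:ℝ)) ∧
          R = δ • (α • (x, (1:ℝ)) - β • (y, (1:ℝ))) := by
      intro R hR hRs hRω
      apply fpt_harm e _ _ _ _ (hat0 x) (hat0 y) hQ0 hR
      apply hq _ _ _ (hfr x hx hxW) (hfr y hy hyW)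
      · intro h; exact hxy (fpt_chart_inj e x y h)
      · exact (fpt_mem_line e _ _ _ (hat0 x) (hat0 y) hQ0).2 hspan
      · exact (fpt_mem_line e _ _ _ (hat0 x) (hat0 y) hR).2 hRs
      · refine ⟨(fpt_mem_proj e R hR _).2 ((hmap R).2 (hspW hRs)), ?_⟩
        rw [hH]
        exact (fpt_mem_proj e R hR _).2 ((hω R).1 hRω)
    by_cases hR : ω (y, 1) • (x, (1:ℝ)) - ω (x, 1) • (y, (1:ℝ)) = 0
    · exfalso
      have h1 := fpt_hat_indep x y hxy (ω (y, 1)) (-ω (x, 1)) (by rw [neg_smul, ← sub_eq_add_neg]; exact hR)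
      obtain ⟨α, β, δ, hα, hβ, hδ, -, h2⟩ := hharm (x, 1) (hat0 x)
        (Submodule.subset_span (by simp)) (by simpa using h1.2)
      have h3 := fpt_hat_indep x y hxy (δ * α - 1) (-(δ * β)) (by
        have h4 : (δ * α - 1) • (x, (1:ℝ)) + (-(δ * β)) • (y, (1:ℝ)) =
          δ • (α • (x, (1:ℝ)) - β • (y, (1:ℝ))) - (x, (1:ℝ)) := by module
        rw [h4, ← h2, sub_self])
      exact mul_ne_zero hδ hβ (by simpa using h3.2)
    · obtain ⟨α, β, δ, hα, hβ, hδ, h1, h2⟩ := hharm _ hR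
        (Submodule.mem_span_pair.2 ⟨ω (y, 1), -ω (x, 1), by module⟩) (by
          rw [map_sub, map_smul, map_smul, smul_eq_mul, smul_eq_mul]; ring)
      obtain ⟨h3, h4⟩ := fpt_hat_indep x y hxy (ω (y, 1) - δ * α) (δ * β - ω (x, 1)) (by
        have h4 : (ω (y, 1) - δ * α) • (x, (1:ℝ)) + (δ * β - ω (x, 1)) • (y, (1:ℝ)) =
          (ω (y, 1) • (x, (1:ℝ)) - ω (x, 1) • (y, (1:ℝ))) -
            δ • (α • (x, (1:ℝ)) - β • (y, (1:ℝ))) := by module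
        rw [h4, ← h2, sub_self])
      have h5 : ω (y, 1) = δ * α := by linarith
      have h6 : ω (x, 1) = δ * β := by linarith
      rw [h5, h6]
      refine ⟨mul_ne_zero hδ hβ, mul_ne_zero hδ hα, δ⁻¹, inv_ne_zero hδ, ?_⟩
      rw [h1, smul_add, smul_smul, smul_smul, ← mul_assoc, ← mul_assoc, inv_mul_cancel₀ hδ,
        one_mul, one_mul]
  have hP : ¬ FptP K p ω := by
    intro hP
    apply hfp.1
    rintro A B q ⟨x, hx, rfl⟩ ⟨y, hy, rfl⟩ hAB hpl hql hqH
    have hxy : x ≠ y := fun h => hAB (by rw [h])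
    obtain ⟨R, hR0, rfl⟩ := fpt_mk_surj e q
    have hps := (fpt_mem_line e _ _ _ (hat0 x) (hat0 y) (hat0 p)).1 hpl
    have hRs := (fpt_mem_line e _ _ _ (hat0 x) (hat0 y) hR0).1 hql
    rw [hH] at hqH
    have hRω := (hω R).2 ((fpt_mem_proj e R hR0 _).1 hqH)
    obtain ⟨n1, n2, k, hk, hpe⟩ := hP x hx y hy hxy hps
    obtain ⟨s, t, hst⟩ := Submodule.mem_span_pair.1 hRs
    have h1 : s * ω (x, 1) + t * ω (y, 1) = 0 := by
      rw [← hst, map_add, map_smul, map_smul, smul_eq_mul, smul_eq_mul] at hRω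
      exact hRω
    refine fpt_harm_mk e _ _ _ _ (hat0 x) (hat0 y) (hat0 p) hR0 (ω (y, 1)) (ω (x, 1)) k
      (s / ω (y, 1)) n2 n1 hpe ?_
    have h2 : t = - (s / ω (y, 1) * ω (x, 1)) := by field_simp; linarith
    have h3 : s = s / ω (y, 1) * ω (y, 1) := by field_simp
    rw [← hst, h2]
    conv_lhs => rw [h3]
    match_scalars <;> field_simp
  obtain ⟨c, o, ρ, hcs, hcp, hρ, hK⟩ := fpt_main_lin (by simpa using hd) K hconv hcpt p hp ω hS hP
  obtain ⟨A, hA⟩ := fpt_diag c hcs hcp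
  have hsq : 0 < Real.sqrt ρ := Real.sqrt_pos.2 hρ
  let M : (Fin d → ℝ) ≃ₗ[ℝ] (Fin d → ℝ) :=
    (LinearEquiv.smulOfUnit (Units.mk0 (Real.sqrt ρ) hsq.ne')).trans A.symm
  have hM : ∀ y, M y = A.symm (Real.sqrt ρ • y) := fun y => rfl
  refine ⟨M.toAffineEquiv.trans (AffineEquiv.constVAdd ℝ (Fin d → ℝ) o), ?_⟩
  have hT : ∀ y, (M.toAffineEquiv.trans (AffineEquiv.constVAdd ℝ (Fin d → ℝ) o)) y =
      o + A.symm (Real.sqrt ρ • y) := fun y => rfl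
  have hball : ∀ y, y ∈ euclUnitBall d ↔ o + A.symm (Real.sqrt ρ • y) ∈ K := by
    intro y
    rw [hK, add_sub_cancel_left, hA]
    simp only [LinearEquiv.apply_symm_apply, Pi.smul_apply, smul_eq_mul, mul_pow]
    rw [← Finset.mul_sum, Real.sq_sqrt hρ.le]
    unfold euclUnitBall
    rw [mem_ofPred_eq]
    constructor
    · intro h; exact mul_le_of_le_one_right hρ.le h
    · intro h; exact le_of_mul_le_mul_left (by rwa [mul_one]) hρ
  ext x
  constructor
  · intro hx
    refine ⟨(Real.sqrt ρ)⁻¹ • A (x - o), ?_, ?_⟩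
    · rw [hball, smul_smul, mul_inv_cancel₀ hsq.ne', one_smul]
      simpa using hx
    · rw [hT, smul_smul, mul_inv_cancel₀ hsq.ne', one_smul]
      simp
  · rintro ⟨y, hy, rfl⟩
    rw [hT]; exact (hball y).1 hy
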